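/- Let I : T*U → ℝ be a smooth function that is a homogeneous polynomial in momenta of degree 6, satisfies {H, I} = 0, {p_φ, I} = 0, {p_t, I} = 0, and is anti-invariant under the reflection (p_φ, p_t) ↦ (−p_φ, −p_t) (i.e. every monomial of I has odd total degree in p_φ and p_t). Then I is identically zero. -/

import Mathlib

open Real Finset

noncomputable section

/-- A phase-space point `(x, y, φ, t, p_x, p_y, p_φ, p_t)` of `T*U ⊂ ℝ⁴ × ℝ⁴`. -/
abbrev PhasePt := Fin 8 → ℝ

/-- The phase space `T*U` over `U = {x > 1, -1 < y < 1}`. -/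
def TStar : Set PhasePt := {z | 1 < z 0 ∧ -1 < z 1 ∧ z 1 < 1}

/-- The base domain `U`. -/
def Ubase : Set (Fin 4 → ℝ) := {w | 1 < w 0 ∧ -1 < w 1 ∧ w 1 < 1}

/-- Projection to the base coordinates `(x, y, φ, t)`. -/
def basePt (z : PhasePt) : Fin 4 → ℝ := fun q => z ⟨q.1, by omega⟩

/-- Partial derivative in the `i`-th coordinate. -/
def pd (i : Fin 8) (f : PhasePt → ℝ) (z : PhasePt) : ℝ :=
  fderiv ℝ f z (Pi.single i 1)

/-- The canonical Poisson bracket on `T*U`. -/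
def pois (f g : PhasePt → ℝ) (z : PhasePt) : ℝ :=
    (pd 0 f z * pd 4 g z - pd 4 f z * pd 0 g z)
  + (pd 1 f z * pd 5 g z - pd 5 f z * pd 1 g z)
  + (pd 2 f z * pd 6 g z - pd 6 f z * pd 2 g z)
  + (pd 3 f z * pd 7 g z - pd 7 f z * pd 3 g z)

/-- The geodesic Hamiltonian of the Zipoy-Voorhees metric with parameter `δ = 2`. -/
def Ham (z : PhasePt) : ℝ :=
  (1/2) * ( (((z 0)^2 - 1) * (z 4)^2 + (1 - (z 1)^2) * (z 5)^2)
      / ((((z 0 + 1)/(z 0 - 1))^2) * (((z 0)^2 - 1)^4 / ((z 0)^2 - (z 1)^2)^3))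
    + (z 6)^2 / ((((z 0 + 1)/(z 0 - 1))^2) * (((z 0)^2 - 1) * (1 - (z 1)^2)))
    - ((z 0 + 1)/(z 0 - 1))^2 * (z 7)^2 )

/-- The momentum `p_φ`. -/
def Pphi (z : PhasePt) : ℝ := z 6

/-- The momentum `p_t`. -/
def Ptm (z : PhasePt) : ℝ := z 7

/-- `I` is polynomial in momenta of degree `≤ d`, with smooth coefficients. -/
def IsPolyMom (d : ℕ) (I : PhasePt → ℝ) : Prop :=
  ∃ c : ℕ → ℕ → ℕ → ℕ → ((Fin 4 → ℝ) → ℝ),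
    (∀ i j k m, ContDiffOn ℝ (⊤ : ℕ∞) (c i j k m) Ubase) ∧
    ∀ z ∈ TStar, I z =
      ∑ i ∈ Finset.range (d+1), ∑ j ∈ Finset.range (d+1),
      ∑ k ∈ Finset.range (d+1), ∑ m ∈ Finset.range (d+1),
        (if i + j + k + m ≤ d then
          c i j k m (basePt z) * (z 4)^i * (z 5)^j * (z 6)^k * (z 7)^m else 0)

/-- `I` is a homogeneous polynomial in momenta of degree `d`, with smooth coefficients. -/
def IsHomPolyMom (d : ℕ) (I : PhasePt → ℝ) : Prop :=
  ∃ c : ℕ → ℕ → ℕ → ℕ → ((Fin 4 → ℝ) → ℝ),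
    (∀ i j k m, ContDiffOn ℝ (⊤ : ℕ∞) (c i j k m) Ubase) ∧
    ∀ z ∈ TStar, I z =
      ∑ i ∈ Finset.range (d+1), ∑ j ∈ Finset.range (d+1),
      ∑ k ∈ Finset.range (d+1), ∑ m ∈ Finset.range (d+1),
        (if i + j + k + m = d then
          c i j k m (basePt z) * (z 4)^i * (z 5)^j * (z 6)^k * (z 7)^m else 0)

/-- Functional independence: the differentials are linearly independent at every point
of a dense subset of `T*U`. -/
def FunIndep (f₁ f₂ f₃ f₄ : PhasePt → ℝ) : Prop :=
  ∃ S : Set PhasePt, S ⊆ TStar ∧ TStar ⊆ closure S ∧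
    ∀ z ∈ S, LinearIndependent ℝ
      ![fderiv ℝ f₁ z, fderiv ℝ f₂ z, fderiv ℝ f₃ z, fderiv ℝ f₄ z]


/-- `I` is a homogeneous polynomial in momenta of degree `d` all of whose monomials have
odd total degree in `p_φ, p_t`. -/
def IsHomPolyMomOdd (d : ℕ) (I : PhasePt → ℝ) : Prop :=
  ∃ c : ℕ → ℕ → ℕ → ℕ → ((Fin 4 → ℝ) → ℝ),
    (∀ i j k m, ContDiffOn ℝ (⊤ : ℕ∞) (c i j k m) Ubase) ∧
    (∀ i j k m, ¬ Odd (k + m) → c i j k m = 0) ∧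
    ∀ z ∈ TStar, I z =
      ∑ i ∈ Finset.range (d+1), ∑ j ∈ Finset.range (d+1),
      ∑ k ∈ Finset.range (d+1), ∑ m ∈ Finset.range (d+1),
        (if i + j + k + m = d then
          c i j k m (basePt z) * (z 4)^i * (z 5)^j * (z 6)^k * (z 7)^m else 0)


set_option linter.unusedSimpArgs false


theorem cancU {R : Type*} [CommRing R] {u a b : R} (hu : IsUnit u) (h : u * a - u * b = 0) : a = b :=
  hu.mul_left_cancel (sub_eq_zero.mp h)

def m11 {R : Type*} [CommRing R] (x y : R) : R :=
  490*(x-1)^2*(x+1)^2*(x^2-y^2)*y^3*x*(2*x-3)^2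

def m12 {R : Type*} [CommRing R] (x y : R) : R :=
  (-4)*(240*x^10-300*x^9*y^2-168*x^9-125*x^8*y^4+1230*x^8*y^2-2136*x^8+850*x^7*y^4-1056*x^7*y^2+2886*x^7-1355*x^6*y^4-1155*x^6*y^2+3669*x^6-1106*x^5*y^4+3732*x^5*y^2-8334*x^5+3886*x^4*y^4-7644*x^4*y^2+3861*x^4-3608*x^3*y^4+8856*x^3*y^2+2940*x^2*y^4-3699*x^2*y^2-1752*x*y^4+288*y^4)

def m13 {R : Type*} [CommRing R] (x y : R) : R :=
  14*(40*x^5-25*x^4*y^2-84*x^4-20*x^3*y^2+32*x^3+184*x^2*y^2+6*x^2-52*x*y^2-81*y^2)*(x-1)*(x+1)*y^2*x*(2*x-3)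

def m21 {R : Type*} [CommRing R] (x y : R) : R :=
  980*(x-1)*(x+1)*(1-y^2)*(x^2-y^2)*y

def m22 {R : Type*} [CommRing R] (x y : R) : R :=
  28*(25*x^2*y^2+379*x^2-20*x*y^2+20*x-299*y^2-105)*(1-y^2)

def m23 {R : Type*} [CommRing R] (x y : R) : R :=
  (125*x^4*y^4-3630*x^4*y^2+1921*x^4-550*x^3*y^4+8312*x^3*y^2-7762*x^3+4790*x^2*y^4-10508*x^2*y^2+8886*x^2-9522*x*y^4+11832*x*y^2-2310*x+8097*y^4-11886*y^2+2205)

def m31 {R : Type*} [CommRing R] (x y : R) : R :=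
  5*(5*x^2*y^2-25*x^2-32*x*y^2+32*x+41*y^2-21)*(x-1)*(x+1)*y

def m32 {R : Type*} [CommRing R] (x y : R) : R :=
  (-56)*(15*x^2*y^2-x^2-12*x*y^2+12*x+7*y^2-21)

def m33 {R : Type*} [CommRing R] (x y : R) : R :=
  (75*x^4*y^2-69*x^4-100*x^3*y^2-508*x^3-866*x^2*y^2+1242*x^2+1812*x*y^2-1204*x-1117*y^2+735)

def DeltaP {R : Type*} [CommRing R] (x y : R) : R :=
  m11 x y * (m22 x y * m33 x y - m23 x y * m32 x y)
  - m12 x y * (m21 x y * m33 x y - m23 x y * m31 x y)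
  + m13 x y * (m21 x y * m32 x y - m22 x y * m31 x y)

theorem derOfNat {R : Type*} [CommRing R] [Algebra ℝ R] (d : Derivation ℝ R R) (n : ℕ) [n.AtLeastTwo] :
    d (ofNat(n) : R) = 0 := by
  exact d.map_natCast n

set_option maxRecDepth 10000 in
set_option maxHeartbeats 4000000 in
theorem core2 {R : Type*} [CommRing R] [Algebra ℝ R] (dx dy : Derivation ℝ R R)
    (x y : R) (hxx : dx x = 1) (hxy : dx y = 0) (hyx : dy x = 0) (hyy : dy y = 1)
    (hc : ∀ f, dy (dx f) = dx (dy f))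
    (h2 : IsUnit (2 : R)) (hDelta : IsUnit (DeltaP x y))
    (al b : R)
    (hE1 : (-2)*(x-1)*(x+1)*(dx al) + (x-1)*(x+1)*y*(dy b) + 8*(2*x-3)*b = 0)
    (hE21 : (-5)*(x-1)^2*(x+1)^2*(x^2-y^2)*y^2*(dy (dy al)) + (-5)*(x^2+8*x-13)*(x-1)*(x+1)*(x^2-y^2)*y*(dy al) + 4*(x-1)^2*(x+1)^2*y^2*x*(dx al) + (-17)*(x-1)^2*(x+1)^2*y^3*x*(dy b) + (5*x^6+8*x^5+15*x^4*y^2-70*x^4-56*x^3*y^2+136*x^3+38*x^2*y^2-91*x^2-88*x*y^2+103*y^2)*al + (-15)*(x^2+4*x-7)*(x-1)*(x+1)*y^2*x*b = 0)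
    (hE23 : 2*(x-1)^2*(x+1)^2*(x^2-y^2)*(dx (dx al)) + (-6)*(x-1)^2*(x+1)^2*(x^2-y^2)*y*(dx (dy b)) + (-20)*(x-1)*(x+1)*(1-y^2)*y*(dy al) + 4*(x^3-2*x^2+x*y^2-2*x+2*y^2)*(x-1)*(x+1)*(dx al) + (-2)*(6*x^3-12*x^2+x*y^2-7*x+12*y^2)*(x-1)*(x+1)*y*(dy b) + (-1)*(5*x^4+36*x^3-15*x^2*y^2-59*x^2-36*x*y^2+69*y^2)*(x-1)*(x+1)*(dx b) + (-4)*(15*x^2*y^2+3*x^2-44*x*y^2+44*x+59*y^2-77)*al + (-2)*(5*x^5+14*x^4-20*x^3*y^2-100*x^3+98*x^2*y^2+70*x^2+56*x*y^2+59*x-182*y^2)*b = 0)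
    (hE24 : (-5)*(x-1)^2*(x+1)^2*(x^2-y^2)*(dx (dx b)) + 40*(x-1)*(x+1)*(1-y^2)*(dx al) + (-50)*(x-1)*(x+1)*(1-y^2)*y*(dy b) + (-30)*(x-1)*(x+1)*(x^2-y^2)*(x-2)*(dx b) + (-128)*(1-y^2)*al + (-2)*(15*x^4-60*x^3-40*x^2*y^2+92*x^2-136*x*y^2+196*x+236*y^2-303)*b = 0)
    (hE30 : 5*(x-1)*(x+1)*(x^2-y^2)*y^2*(dy (dy al)) + (5*x^2+12*x-23)*(x^2-y^2)*y*(dy al) + 15*(x-1)*(x+1)*y^3*x*(dy b) + (-1)*(5*x^4+12*x^3-5*x^2*y^2-23*x^2+12*x*y^2-13*y^2)*al + 15*(x-1)*(x+1)*y^2*x*b = 0)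
    (hE36 : 35*(x-1)^2*(x+1)^2*(x^2-y^2)*(dx (dx b)) + 210*(x-1)*(x+1)*(1-y^2)*y*(dy b) + 14*(15*x-46)*(x-1)*(x+1)*(x^2-y^2)*(dx b) + 2*(105*x^4-644*x^3-360*x^2*y^2+1492*x^2+680*x*y^2-36*x-1132*y^2-105)*b = 0)
    : al = 0 ∧ b = 0 := by
  have h32 : IsUnit (32 : R) := by
    have := h2.pow 5
    norm_num at this
    exact this
  have hR1 : 7*(x-1)*(x+1)*(x^2-y^2)*y*(2*x-3)*(dy al) + (2*x^5-10*x^4*y^2+21*x^4+34*x^3*y^2-74*x^3-23*x^2*y^2+57*x^2+38*x*y^2-45*y^2)*al + 7*(x-1)*(x+1)*y^2*x*(2*x-3)*b = 0 := by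
    apply cancU h2
    linear_combination -((x-1)*(x+1))*hE30 - hE21 - 2*(x-1)*(x+1)*y^2*x*hE1
  have hR2 : 7*(x-1)*(x+1)*(x^2-y^2)*(dx b) + 28*(1-y^2)*al + (14*x^3+5*x^2*y^2-53*x^2-32*x*y^2+18*x+69*y^2-21)*b = 0 := by
    apply cancU h32
    linear_combination -7*hE24 - hE36 - 140*(1-y^2)*hE1
  have hR1y := congrArg dy hR1
  simp only [map_add, map_sub, map_neg, map_zero, Derivation.leibniz, Derivation.leibniz_pow, Derivation.map_one_eq_zero, derOfNat, hxx, hxy, hyx, hyy, hc, smul_eq_mul, nsmul_eq_mul, mul_one, mul_zero, zero_add, add_zero, sub_zero, zero_sub, neg_zero, zero_mul] at hR1y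
  have hR2x := congrArg dx hR2
  simp only [map_add, map_sub, map_neg, map_zero, Derivation.leibniz, Derivation.leibniz_pow, Derivation.map_one_eq_zero, derOfNat, hxx, hxy, hyx, hyy, hc, smul_eq_mul, nsmul_eq_mul, mul_one, mul_zero, zero_add, add_zero, sub_zero, zero_sub, neg_zero, zero_mul] at hR2x
  have hR2y := congrArg dy hR2
  simp only [map_add, map_sub, map_neg, map_zero, Derivation.leibniz, Derivation.leibniz_pow, Derivation.map_one_eq_zero, derOfNat, hxx, hxy, hyx, hyy, hc, smul_eq_mul, nsmul_eq_mul, mul_one, mul_zero, zero_add, add_zero, sub_zero, zero_sub, neg_zero, zero_mul] at hR2y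
  have hE1x := congrArg dx hE1
  simp only [map_add, map_sub, map_neg, map_zero, Derivation.leibniz, Derivation.leibniz_pow, Derivation.map_one_eq_zero, derOfNat, hxx, hxy, hyx, hyy, hc, smul_eq_mul, nsmul_eq_mul, mul_one, mul_zero, zero_add, add_zero, sub_zero, zero_sub, neg_zero, zero_mul] at hE1x
  have hQ1 : m11 x y * dy b + m12 x y * al + m13 x y * b = 0 := by
    unfold m11 m12 m13
    linear_combination (49*(x-1)*(x+1)*(x^2-y^2)*(2*x-3)^2)*hE30 + ((-35)*(x-1)*(x+1)*(x^2-y^2)*y*(2*x-3))*hR1y + ((10*x^5-50*x^4*y^2-63*x^4+30*x^3*y^2+134*x^3+263*x^2*y^2-93*x^2-174*x*y^2-57*y^2))*hR1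
  have hQ2 : m21 x y * dy b + m22 x y * al + m23 x y * b = 0 := by
    unfold m21 m22 m23
    linear_combination (7*(x^2-y^2))*hE36 + ((-35)*(x-1)*(x+1)*(x^2-y^2))*hR2x + ((-490)*(1-y^2)*(x^2-y^2))*hE1 + ((25*x^2*y^2+379*x^2-20*x*y^2+20*x-299*y^2-105))*hR2
  have hQ3 : m31 x y * dy b + m32 x y * al + m33 x y * b = 0 := by
    unfold m31 m32 m33
    linear_combination (7)*hE23 + (7*(x-1)*(x+1)*(x^2-y^2))*hE1x + (5*(x-1)*(x+1)*y)*hR2y + ((-28)*(x-y^2)*(x+1))*hE1 + (5*(x^2+4*x-7))*hR2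
  have ha : DeltaP x y * al = 0 := by
    simp only [DeltaP]
    linear_combination -(m21 x y * m33 x y - m23 x y * m31 x y) * hQ1 + (m11 x y * m33 x y - m13 x y * m31 x y) * hQ2 - (m11 x y * m23 x y - m13 x y * m21 x y) * hQ3
  have hb : DeltaP x y * b = 0 := by
    simp only [DeltaP]
    linear_combination (m21 x y * m32 x y - m22 x y * m31 x y) * hQ1 - (m11 x y * m32 x y - m12 x y * m31 x y) * hQ2 + (m11 x y * m22 x y - m12 x y * m21 x y) * hQ3
  exact ⟨hDelta.mul_right_eq_zero.mp ha, hDelta.mul_right_eq_zero.mp hb⟩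

set_option maxHeartbeats 4000000 in
set_option maxRecDepth 10000 in
theorem core1 {R : Type*} [CommRing R] [Algebra ℝ R] (dx dy : Derivation ℝ R R)
    (x y : R) (hxx : dx x = 1) (hxy : dx y = 0) (hyx : dy x = 0) (hyy : dy y = 1)
    (hc : ∀ f, dy (dx f) = dx (dy f))
    (hx : IsUnit x) (hY : IsUnit (1-y^2)) (hD : IsUnit (x^2-y^2)) (hy : IsUnit y) (hDelta : IsUnit (DeltaP x y))
    (A0 A1 B0 B1 C0 L0 L1 L2 L3 K0 K1 K2 K3 J0 J1 J2 J3 J4 J5 : R)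
    (fA0 : A0 + (-1)*(x-2)*A1 = 0)
    (fB0 : A1 + 2*B0 + (-1)*(x-2)*B1 = 0)
    (fC0 : B1 + C0 = 0)
    (eC2 : (-1)*C0 + L3 = 0)
    (eC1 : (-1)*(x-1)*(x+1)*(x^2-y^2)*(dx C0) + (-2)*(x^3-6*x^2-x+6*y^2)*C0 + L2 = 0)
    (eC0 : (-1)*(1-y^2)*(x^2-y^2)*y*(dy C0) + (2*x^2*y^2-x^2-y^4)*C0 + L1 = 0)
    (eB2 : (-2)*(x-1)*(x+1)*(x^2-y^2)*(dx B1) + (-12)*(1-y^2)*B0 + (-2)*(2*x^3-6*x^2-3*x*y^2+x+6*y^2)*B1 + 3*K3 + L2 + (-6)*(1-y^2)*(x-2)*L3 = 0)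
    (eB1 : (-2)*(x-1)*(x+1)*(1-y^2)*(x^2-y^2)*(dx B0) + (-1)*(x-1)*(x+1)*(1-y^2)*(x^2-y^2)*y*(dy B1) + 4*(2*x^2-x*y^2+x-2*y^2)*(1-y^2)*B0 + (-2)*(x^2+y^4-2*y^2)*(x-1)*(x+1)*B1 + (1-y^2)*K2 + 2*(x-1)*(x+1)*L1 + (-1)*(1-y^2)*(x-2)*L2 = 0)
    (eA1 : (-1)*(x-1)*(x+1)*(1-y^2)*(x^2-y^2)*(dx A0) + (-1)*(x-1)*(x+1)*(1-y^2)*(x^2-y^2)*y*(dy A1) + 2*(x^2-x-2*y^2)*(x-1)*(1-y^2)*A0 + (-2)*(x^2*y^2+x^2-2*y^2)*(x-1)*(x+1)*A1 + 2*K1 + (-1)*(1-y^2)*(x-2)*K2 = 0)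
    (eB0 : (-2)*(x-1)*(x+1)*(1-y^2)*(x^2-y^2)*y*(dy B0) + (-2)*(x^2-y^4)*(x-1)*(x+1)*B0 + (-1)*(x^3-2*x^2-4*x*y^2+3*x+2*y^2)*(x-1)*(x+1)*y^2*B1 + K1 + 3*L0 + (-1)*(x-1)*(x+1)*(x-2)*L1 = 0)
    (eA0 : (-1)*(x-1)*(x+1)*(1-y^2)*(x^2-y^2)*y*(dy A0) + (-1)*(2*x^2*y^2+x^2-3*y^4)*(x-1)*(x+1)*A0 + (-1)*(x^3-2*x^2-4*x*y^2+3*x+2*y^2)*(x-1)*(x+1)*y^2*A1 + 3*K0 + (-1)*(x-2)*K1 = 0)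
    (eA2 : (-2)*(x-1)*(x+1)*(x^2-y^2)*(dx A1) + (-6)*(1-y^2)*A0 + (-2)*(2*x^2-x*y^2+x-2*y^2)*A1 + K2 + (-3)*(x-2)*K3 = 0)
    (eL0 : (-1)*(1-y^2)*(x^2-y^2)*y*(dy L0) + (x^2-y^2)*J1 + (x^2+3*y^4-4*y^2)*L0 + (-1)*(x^3-2*x^2-4*x*y^2+3*x+2*y^2)*(x-1)*(x+1)*y^2*L1 = 0)
    (eL1 : (-1)*(x-1)*(x+1)*(x^2-y^2)*(dx L0) + (-1)*(x-1)^2*(x+1)^2*(x^2-y^2)*y*(dy L1) + (x^2-y^2)*J2 + 2*(2*x^3+2*x^2-5*x*y^2+3*x-2*y^2)*L0 + (-1)*(x^3-2*x^2-4*x*y^2+3*x+2*y^2)*(x-1)*(x+1)*y^2*L2 = 0)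
    (eL2 : (-2)*(x-1)^2*(x+1)^2*(x^2-y^2)*(dx L1) + (-1)*(x-1)*(x+1)*(1-y^2)*(x^2-y^2)*y*(dy L2) + 3*(x^2-y^2)*J3 + (-18)*(1-y^2)*L0 + 6*(2*x^2-x*y^2+x-2*y^2)*(x-1)*(x+1)*L1 + (2*x^2*y^2-x^2-5*y^4+4*y^2)*(x-1)*(x+1)*L2 + (-6)*(x^3-2*x^2-4*x*y^2+3*x+2*y^2)*(x-1)*(x+1)*(1-y^2)*y^2*L3 = 0)
    (eL3 : (-1)*(x-1)*(x+1)*(x^2-y^2)*(dx L2) + (-2)*(x-1)*(x+1)*(1-y^2)*(x^2-y^2)*y*(dy L3) + (x^2-y^2)*J4 + (-12)*(x-1)*(x+1)*L1 + 8*(x^2-y^2)*L2 + 4*(2*x^2*y^2-x^2-5*y^4+4*y^2)*(x-1)*(x+1)*L3 = 0)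
    (eL4 : (-2)*(x-1)*(x+1)*(x^2-y^2)*(dx L3) + (x^2-y^2)*J5 + (-3)*L2 + (-2)*(2*x^3-10*x^2-5*x*y^2+3*x+10*y^2)*L3 = 0)
    (eK0 : (-1)*(1-y^2)*(x^2-y^2)*y*(dy K0) + (x^2-y^2)*y^2*J0 + (-1)*(x^2-y^2)*(x-2)*J1 + (-1)*(2*x^2*y^2-x^2-5*y^4+4*y^2)*K0 + (-1)*(x^3-2*x^2-4*x*y^2+3*x+2*y^2)*y^2*K1 = 0)
    (eK1 : (-1)*(x-1)*(x+1)*(1-y^2)*(x^2-y^2)*(dx K0) + (-1)*(x-1)*(x+1)*(1-y^2)*(x^2-y^2)*y*(dy K1) + 4*(x-1)*(x+1)*(x^2-y^2)*J1 + (-1)*(1-y^2)*(x^2-y^2)*(x-2)*J2 + 2*(3*x^3-2*x^2-6*x*y^2+3*x+2*y^2)*(1-y^2)*K0 + (-2)*(x-1)*(x+1)*(x^2-y^2)*y^2*K1 + (-1)*(x^3-2*x^2-4*x*y^2+3*x+2*y^2)*(x-1)*(x+1)*(1-y^2)*y^2*K2 = 0)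
    (eK3 : (-1)*(x-1)*(x+1)*(1-y^2)*(x^2-y^2)*(dx K2) + (-1)*(x-1)*(x+1)*(1-y^2)*(x^2-y^2)*y*(dy K3) + 2*(x^2-y^2)*J3 + (-1)*(1-y^2)*(x^2-y^2)*(x-2)*J4 + (-12)*(1-y^2)*K1 + 2*(1-y^2)*(x^2-y^2)*x*K2 + (-2)*(x^2+3*y^4-4*y^2)*(x-1)*(x+1)*K3 = 0)
    (eK4 : (-4)*(x-1)*(x+1)*(x^2-y^2)*(dx K3) + (x^2-y^2)*J4 + (-4)*(1-y^2)*(x^2-y^2)*(x-2)*J5 + (-12)*(1-y^2)*K2 + 4*(2*x^2+3*x*y^2-3*x-2*y^2)*K3 = 0)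
    (eJ0 : (-1)*(1-y^2)*(x^2-y^2)*y*(dy J0) + (x^2+3*y^4-4*y^2)*J0 + (-5)*(x^3-2*x^2-4*x*y^2+3*x+2*y^2)*J1 = 0)
    (eJ6 : (-4)*(x-1)*(x+1)*(x^2-y^2)*(dx J5) + (-15)*J4 + (-4)*(2*x^3-6*x^2-5*x*y^2+3*x+6*y^2)*J5 = 0)
    : A0 = 0 ∧ A1 = 0 ∧ B0 = 0 ∧ B1 = 0 ∧ C0 = 0 ∧ L0 = 0 ∧ L1 = 0 ∧ L2 = 0 ∧ L3 = 0 ∧ K0 = 0 ∧ K1 = 0 ∧ K2 = 0 ∧ K3 = 0 ∧ J0 = 0 ∧ J1 = 0 ∧ J2 = 0 ∧ J3 = 0 ∧ J4 = 0 ∧ J5 = 0 := by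
  have h2 : IsUnit (2 : R) := by
    have := (IsUnit.mk0 (2:ℝ) two_ne_zero).map (algebraMap ℝ R)
    rwa [map_ofNat] at this
  have h3 : IsUnit (3 : R) := by
    have := (IsUnit.mk0 (3:ℝ) three_ne_zero).map (algebraMap ℝ R)
    rwa [map_ofNat] at this
  obtain ⟨b, hb⟩ : ∃ b, b = -C0 := ⟨_, rfl⟩
  obtain ⟨al, hal⟩ : ∃ al, al = (x-2)*b - B0 := ⟨_, rfl⟩
  have sC0 : C0 = -b := by linear_combination hb
  have sB0 : B0 = -al + (x-2)*b := by linear_combination hal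
  have sB1 : B1 = b := by linear_combination fC0 - sC0
  have sA1 : A1 = 2*al - (x-2)*b := by linear_combination fB0 - 2*sB0 + (x-2)*sB1
  have sA0 : A0 = 2*(x-2)*al - (x-2)^2*b := by linear_combination fA0 + (x-2)*sA1
  clear fA0 fB0 fC0 hb hal
  simp only [sC0, map_add, map_sub, map_neg, map_zero, Derivation.leibniz, Derivation.leibniz_pow, Derivation.map_one_eq_zero, derOfNat, hxx, hxy, hyx, hyy, hc, smul_eq_mul, nsmul_eq_mul, mul_one, mul_zero, zero_add, add_zero, sub_zero, zero_sub, neg_zero, zero_mul] at eC2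
  have sL3 : L3 = (-1)*b := by
    linear_combination eC2
  clear eC2
  simp only [sC0, map_add, map_sub, map_neg, map_zero, Derivation.leibniz, Derivation.leibniz_pow, Derivation.map_one_eq_zero, derOfNat, hxx, hxy, hyx, hyy, hc, smul_eq_mul, nsmul_eq_mul, mul_one, mul_zero, zero_add, add_zero, sub_zero, zero_sub, neg_zero, zero_mul] at eC1
  have sL2 : L2 = (-1)*(x-1)*(x+1)*(x^2-y^2)*(dx b) + (-2)*(x^3-6*x^2-x+6*y^2)*b := by
    linear_combination eC1
  clear eC1
  simp only [sC0, map_add, map_sub, map_neg, map_zero, Derivation.leibniz, Derivation.leibniz_pow, Derivation.map_one_eq_zero, derOfNat, hxx, hxy, hyx, hyy, hc, smul_eq_mul, nsmul_eq_mul, mul_one, mul_zero, zero_add, add_zero, sub_zero, zero_sub, neg_zero, zero_mul] at eC0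
  have sL1 : L1 = (-1)*(1-y^2)*(x^2-y^2)*y*(dy b) + (2*x^2*y^2-x^2-y^4)*b := by
    linear_combination eC0
  clear eC0
  simp only [sB0, sB1, sL2, sL3, map_add, map_sub, map_neg, map_zero, Derivation.leibniz, Derivation.leibniz_pow, Derivation.map_one_eq_zero, derOfNat, hxx, hxy, hyx, hyy, hc, smul_eq_mul, nsmul_eq_mul, mul_one, mul_zero, zero_add, add_zero, sub_zero, zero_sub, neg_zero, zero_mul] at eB2
  have sK3 : K3 = (x-1)*(x+1)*(x^2-y^2)*(dx b) + (-4)*(1-y^2)*al + 2*(x^3-4*x^2-2*x*y^2+x+6*y^2-2)*b := by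
    apply cancU h3
    linear_combination eB2
  clear eB2
  simp only [sB0, sB1, sL1, sL2, map_add, map_sub, map_neg, map_zero, Derivation.leibniz, Derivation.leibniz_pow, Derivation.map_one_eq_zero, derOfNat, hxx, hxy, hyx, hyy, hc, smul_eq_mul, nsmul_eq_mul, mul_one, mul_zero, zero_add, add_zero, sub_zero, zero_sub, neg_zero, zero_mul] at eB1
  have sK2 : K2 = (-2)*(x-1)*(x+1)*(x^2-y^2)*(dx al) + 3*(x-1)*(x+1)*(x^2-y^2)*y*(dy b) + (x-1)*(x+1)*(x^2-y^2)*(x-2)*(dx b) + 4*(2*x^2-x*y^2+x-2*y^2)*al + 2*(2*x^3+6*x^2-x*y^2-2*x-7*y^2)*(x-1)*b := by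
    apply cancU hY
    linear_combination eB1
  clear eB1
  simp only [sA0, sA1, sK2, map_add, map_sub, map_neg, map_zero, Derivation.leibniz, Derivation.leibniz_pow, Derivation.map_one_eq_zero, derOfNat, hxx, hxy, hyx, hyy, hc, smul_eq_mul, nsmul_eq_mul, mul_one, mul_zero, zero_add, add_zero, sub_zero, zero_sub, neg_zero, zero_mul] at eA1
  have sK1 : K1 = (x-1)*(x+1)*(1-y^2)*(x^2-y^2)*y*(dy al) + (x-1)*(x+1)*(1-y^2)*(x^2-y^2)*y*(x-2)*(dy b) + (3*x^4*y^2+x^4-12*x^3*y^2+12*x^3-x^2*y^4+12*x^2*y^2-19*x^2+12*x*y^4-12*x*y^2-17*y^4+21*y^2)*al + (-1)*(3*x^2*y^2-x^2-2*y^4)*(x-1)*(x+1)*(x-2)*b := by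
    apply cancU h2
    linear_combination eA1
  clear eA1
  simp only [sB0, sB1, sK1, sL1, map_add, map_sub, map_neg, map_zero, Derivation.leibniz, Derivation.leibniz_pow, Derivation.map_one_eq_zero, derOfNat, hxx, hxy, hyx, hyy, hc, smul_eq_mul, nsmul_eq_mul, mul_one, mul_zero, zero_add, add_zero, sub_zero, zero_sub, neg_zero, zero_mul] at eB0
  have sL0 : L0 = (-1)*(x-1)*(x+1)*(1-y^2)*(x^2-y^2)*y*(dy al) + (-1)*(x^2*y^2+x^2-4*x*y^2+4*x+5*y^2-7)*(x^2-y^2)*al + (2*x^3-4*x^2-3*x*y^2+x+4*y^2)*(x-1)*(x+1)*y^2*b := by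
    apply cancU h3
    linear_combination eB0
  clear eB0
  simp only [sA0, sA1, sK1, map_add, map_sub, map_neg, map_zero, Derivation.leibniz, Derivation.leibniz_pow, Derivation.map_one_eq_zero, derOfNat, hxx, hxy, hyx, hyy, hc, smul_eq_mul, nsmul_eq_mul, mul_one, mul_zero, zero_add, add_zero, sub_zero, zero_sub, neg_zero, zero_mul] at eA0
  have sK0 : K0 = (x-1)*(x+1)*(1-y^2)*(x^2-y^2)*y*(x-2)*(dy al) + (3*x^5*y^2+x^5-10*x^4*y^2+2*x^4-5*x^3*y^4+12*x^3*y^2-15*x^3+10*x^2*y^4-8*x^2*y^2+14*x^2-9*x*y^4+13*x*y^2+6*y^4-14*y^2)*al + (-1)*(2*x^3-4*x^2-3*x*y^2+x+4*y^2)*(x-1)*(x+1)*y^2*(x-2)*b := by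
    apply cancU h3
    linear_combination eA0
  clear eA0
  simp only [sA0, sA1, sK2, sK3, map_add, map_sub, map_neg, map_zero, Derivation.leibniz, Derivation.leibniz_pow, Derivation.map_one_eq_zero, derOfNat, hxx, hxy, hyx, hyy, hc, smul_eq_mul, nsmul_eq_mul, mul_one, mul_zero, zero_add, add_zero, sub_zero, zero_sub, neg_zero, zero_mul] at eA2
  have hE1 : (-2)*(x-1)*(x+1)*(dx al) + (x-1)*(x+1)*y*(dy b) + 8*(2*x-3)*b = 0 := by
    apply cancU (h3.mul hD)
    linear_combination eA2
  clear eA2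
  simp only [sL0, sL1, map_add, map_sub, map_neg, map_zero, Derivation.leibniz, Derivation.leibniz_pow, Derivation.map_one_eq_zero, derOfNat, hxx, hxy, hyx, hyy, hc, smul_eq_mul, nsmul_eq_mul, mul_one, mul_zero, zero_add, add_zero, sub_zero, zero_sub, neg_zero, zero_mul] at eL0
  have sJ1 : J1 = (-1)*(x-1)*(x+1)*(1-y^2)^2*(x^2-y^2)*y^2*(dy (dy al)) + (2*x^4*y^2-x^4+4*x^3*y^2-4*x^3-x^2*y^4-8*x^2*y^2+7*x^2-4*x*y^4+4*x*y^2+7*y^4-6*y^2)*(1-y^2)*y*(dy al) + (x^3-2*x^2+x*y^2-2*x+2*y^2)*(x-1)*(x+1)*(1-y^2)*y^3*(dy b) + (2*x^4*y^4-x^4*y^2+x^4-8*x^3*y^4+4*x^3*y^2+4*x^3-x^2*y^6+11*x^2*y^4-7*x^2*y^2-7*x^2+4*x*y^6+4*x*y^4-8*x*y^2-5*y^6-7*y^4+14*y^2)*al + (-1)*(2*x^3*y^2-x^3-4*x^2*y^2+2*x^2+x*y^4-4*x*y^2+2*x+2*y^4)*(x-1)*(x+1)*y^2*b := by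
    apply cancU hD
    linear_combination eL0
  clear eL0
  simp only [sL0, sL1, sL2, map_add, map_sub, map_neg, map_zero, Derivation.leibniz, Derivation.leibniz_pow, Derivation.map_one_eq_zero, derOfNat, hxx, hxy, hyx, hyy, hc, smul_eq_mul, nsmul_eq_mul, mul_one, mul_zero, zero_add, add_zero, sub_zero, zero_sub, neg_zero, zero_mul] at eL1
  have sJ2 : J2 = (-1)*(x-1)^2*(x+1)^2*(1-y^2)*(x^2-y^2)*y*(dx (dy al)) + (-1)*(x-1)^2*(x+1)^2*(1-y^2)*(x^2-y^2)*y^2*(dy (dy b)) + 4*(x^2-2*x*y^2+2*x-y^2)*(x-1)*(x+1)*(1-y^2)*y*(dy al) + (-1)*(x^2*y^2+x^2-4*x*y^2+4*x+5*y^2-7)*(x-1)*(x+1)*(x^2-y^2)*(dx al) + (5*x^2*y^2-2*x^2-6*y^4+3*y^2)*(x-1)^2*(x+1)^2*y*(dy b) + (x^3-2*x^2+x*y^2-2*x+2*y^2)*(x-1)^2*(x+1)^2*y^2*(dx b) + 4*(2*x^4-2*x^3*y^4-x^3*y^2+3*x^3+8*x^2*y^4-14*x^2*y^2+2*x^2-9*x*y^4+23*x*y^2-14*x-4*y^4+6*y^2)*al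 + (4*x^4+8*x^3+17*x^2*y^2-35*x^2-68*x*y^2+60*x+15*y^2-1)*(x-1)*(x+1)*y^2*b := by
    apply cancU hD
    linear_combination eL1
  clear eL1
  simp only [sL0, sL1, sL2, sL3, map_add, map_sub, map_neg, map_zero, Derivation.leibniz, Derivation.leibniz_pow, Derivation.map_one_eq_zero, derOfNat, hxx, hxy, hyx, hyy, hc, smul_eq_mul, nsmul_eq_mul, mul_one, mul_zero, zero_add, add_zero, sub_zero, zero_sub, neg_zero, zero_mul] at eL2
  have sJ3 : J3 = (-1)*(x-1)^2*(x+1)^2*(1-y^2)*(x^2-y^2)*y*(dx (dy b)) + (-6)*(x-1)*(x+1)*(1-y^2)^2*y*(dy al) + (-2)*(x^3-4*x^2+x*y^2-2*x+4*y^2)*(x-1)*(x+1)*(1-y^2)*y*(dy b) + (2*x^2*y^2-x^2-3*y^4+2*y^2)*(x-1)^2*(x+1)^2*(dx b) + (-6)*(x^2*y^2+x^2-4*x*y^2+4*x+5*y^2-7)*(1-y^2)*al + 2*(2*x^3*y^2-x^3-8*x^2*y^2+4*x^2-4*x*y^4+x*y^2+2*x+26*y^4-22*y^2)*(x-1)*(x+1)*b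 := by
    apply cancU (h3.mul hD)
    linear_combination eL2
  clear eL2
  simp only [sL1, sL2, sL3, map_add, map_sub, map_neg, map_zero, Derivation.leibniz, Derivation.leibniz_pow, Derivation.map_one_eq_zero, derOfNat, hxx, hxy, hyx, hyy, hc, smul_eq_mul, nsmul_eq_mul, mul_one, mul_zero, zero_add, add_zero, sub_zero, zero_sub, neg_zero, zero_mul] at eL3
  have sJ4 : J4 = (-1)*(x-1)^2*(x+1)^2*(x^2-y^2)*(dx (dx b)) + (-14)*(x-1)*(x+1)*(1-y^2)*y*(dy b) + (-2)*(3*x^3-10*x^2-x*y^2-2*x+10*y^2)*(x-1)*(x+1)*(dx b) + (-2)*(3*x^4-20*x^3-16*x^2*y^2+52*x^2+20*x-32*y^2-7)*b := by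
    apply cancU hD
    linear_combination eL3
  clear eL3
  simp only [sL2, sL3, map_add, map_sub, map_neg, map_zero, Derivation.leibniz, Derivation.leibniz_pow, Derivation.map_one_eq_zero, derOfNat, hxx, hxy, hyx, hyy, hc, smul_eq_mul, nsmul_eq_mul, mul_one, mul_zero, zero_add, add_zero, sub_zero, zero_sub, neg_zero, zero_mul] at eL4
  have sJ5 : J5 = (-5)*(x-1)*(x+1)*(dx b) + (-2)*(5*x-28)*b := by
    apply cancU hD
    linear_combination eL4
  clear eL4
  simp only [sJ1, sK0, sK1, map_add, map_sub, map_neg, map_zero, Derivation.leibniz, Derivation.leibniz_pow, Derivation.map_one_eq_zero, derOfNat, hxx, hxy, hyx, hyy, hc, smul_eq_mul, nsmul_eq_mul, mul_one, mul_zero, zero_add, add_zero, sub_zero, zero_sub, neg_zero, zero_mul] at eK0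
  have sJ0 : J0 = 5*(x^2-x-2*y^2)*(x-1)^2*(x+1)*(1-y^2)*y*(dy al) + (5*x^5*y^2+5*x^5-30*x^4*y^2+10*x^4-10*x^3*y^4+60*x^3*y^2-70*x^3+66*x^2*y^4-132*x^2*y^2+106*x^2-114*x*y^4+183*x*y^2-59*x+50*y^4-70*y^2)*al + (-5)*(x^2-x-2*y^2)*(x-1)^2*(x+1)*y^2*(x-2)*b := by
    apply cancU (hD.mul (hy.pow 2))
    linear_combination eK0
  clear eK0
  simp only [sJ1, sJ2, sK0, sK1, sK2, map_add, map_sub, map_neg, map_zero, Derivation.leibniz, Derivation.leibniz_pow, Derivation.map_one_eq_zero, derOfNat, hxx, hxy, hyx, hyy, hc, smul_eq_mul, nsmul_eq_mul, mul_one, mul_zero, zero_add, add_zero, sub_zero, zero_sub, neg_zero, zero_mul] at eK1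
  have hE21 : (-5)*(x-1)^2*(x+1)^2*(x^2-y^2)*y^2*(dy (dy al)) + (-5)*(x^2+8*x-13)*(x-1)*(x+1)*(x^2-y^2)*y*(dy al) + 4*(x-1)^2*(x+1)^2*y^2*x*(dx al) + (-17)*(x-1)^2*(x+1)^2*y^3*x*(dy b) + (5*x^6+8*x^5+15*x^4*y^2-70*x^4-56*x^3*y^2+136*x^3+38*x^2*y^2-91*x^2-88*x*y^2+103*y^2)*al + (-15)*(x^2+4*x-7)*(x-1)*(x+1)*y^2*x*b = 0 := by
    apply cancU ((hY.pow 2).mul hD)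
    linear_combination eK1
  clear eK1
  simp only [sJ3, sJ4, sK1, sK2, sK3, map_add, map_sub, map_neg, map_zero, Derivation.leibniz, Derivation.leibniz_pow, Derivation.map_one_eq_zero, derOfNat, hxx, hxy, hyx, hyy, hc, smul_eq_mul, nsmul_eq_mul, mul_one, mul_zero, zero_add, add_zero, sub_zero, zero_sub, neg_zero, zero_mul] at eK3
  have hE23 : 2*(x-1)^2*(x+1)^2*(x^2-y^2)*(dx (dx al)) + (-6)*(x-1)^2*(x+1)^2*(x^2-y^2)*y*(dx (dy b)) + (-20)*(x-1)*(x+1)*(1-y^2)*y*(dy al) + 4*(x^3-2*x^2+x*y^2-2*x+2*y^2)*(x-1)*(x+1)*(dx al) + (-2)*(6*x^3-12*x^2+x*y^2-7*x+12*y^2)*(x-1)*(x+1)*y*(dy b) + (-1)*(5*x^4+36*x^3-15*x^2*y^2-59*x^2-36*x*y^2+69*y^2)*(x-1)*(x+1)*(dx b) + (-4)*(15*x^2*y^2+3*x^2-44*x*y^2+44*x+59*y^2-77)*al + (-2)*(5*x^5+14*x^4-20*x^3*y^2-100*x^3+98*x^2*y^2+70*x^2+56*x*y^2+59*x-182*y^2)*b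 = 0 := by
    apply cancU (hY.mul hD)
    linear_combination eK3
  clear eK3
  simp only [sJ4, sJ5, sK2, sK3, map_add, map_sub, map_neg, map_zero, Derivation.leibniz, Derivation.leibniz_pow, Derivation.map_one_eq_zero, derOfNat, hxx, hxy, hyx, hyy, hc, smul_eq_mul, nsmul_eq_mul, mul_one, mul_zero, zero_add, add_zero, sub_zero, zero_sub, neg_zero, zero_mul] at eK4
  have hE24 : (-5)*(x-1)^2*(x+1)^2*(x^2-y^2)*(dx (dx b)) + 40*(x-1)*(x+1)*(1-y^2)*(dx al) + (-50)*(x-1)*(x+1)*(1-y^2)*y*(dy b) + (-30)*(x-1)*(x+1)*(x^2-y^2)*(x-2)*(dx b) + (-128)*(1-y^2)*al + (-2)*(15*x^4-60*x^3-40*x^2*y^2+92*x^2-136*x*y^2+196*x+236*y^2-303)*b = 0 := by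
    apply cancU hD
    linear_combination eK4
  clear eK4
  simp only [sJ0, sJ1, map_add, map_sub, map_neg, map_zero, Derivation.leibniz, Derivation.leibniz_pow, Derivation.map_one_eq_zero, derOfNat, hxx, hxy, hyx, hyy, hc, smul_eq_mul, nsmul_eq_mul, mul_one, mul_zero, zero_add, add_zero, sub_zero, zero_sub, neg_zero, zero_mul] at eJ0
  have hE30 : 5*(x-1)*(x+1)*(x^2-y^2)*y^2*(dy (dy al)) + (5*x^2+12*x-23)*(x^2-y^2)*y*(dy al) + 15*(x-1)*(x+1)*y^3*x*(dy b) + (-1)*(5*x^4+12*x^3-5*x^2*y^2-23*x^2+12*x*y^2-13*y^2)*al + 15*(x-1)*(x+1)*y^2*x*b = 0 := by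
    apply cancU ((h2.mul (hY.pow 3)).mul hx)
    linear_combination eJ0
  clear eJ0
  simp only [sJ4, sJ5, map_add, map_sub, map_neg, map_zero, Derivation.leibniz, Derivation.leibniz_pow, Derivation.map_one_eq_zero, derOfNat, hxx, hxy, hyx, hyy, hc, smul_eq_mul, nsmul_eq_mul, mul_one, mul_zero, zero_add, add_zero, sub_zero, zero_sub, neg_zero, zero_mul] at eJ6
  have hE36 : 35*(x-1)^2*(x+1)^2*(x^2-y^2)*(dx (dx b)) + 210*(x-1)*(x+1)*(1-y^2)*y*(dy b) + 14*(15*x-46)*(x-1)*(x+1)*(x^2-y^2)*(dx b) + 2*(105*x^4-644*x^3-360*x^2*y^2+1492*x^2+680*x*y^2-36*x-1132*y^2-105)*b = 0 := by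
    linear_combination eJ6
  clear eJ6
  obtain ⟨hal, hb⟩ := core2 dx dy x y hxx hxy hyx hyy hc h2 hDelta al b hE1 hE21 hE23 hE24 hE30 hE36
  clear hE1 hE21 hE23 hE24 hE30 hE36
  subst hal hb
  refine ⟨?_, ?_, ?_, ?_, ?_, ?_, ?_, ?_, ?_, ?_, ?_, ?_, ?_, ?_, ?_, ?_, ?_, ?_, ?_⟩
  · simp [sA0]
  · simp [sA1]
  · simp [sB0]
  · simp [sB1]
  · simp [sC0]
  · simp [sL0]
  · simp [sL1]
  · simp [sL2]
  · simp [sL3]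
  · simp [sK0]
  · simp [sK1]
  · simp [sK2]
  · simp [sK3]
  · simp [sJ0]
  · simp [sJ1]
  · simp [sJ2]
  · simp [sJ3]
  · simp [sJ4]
  · simp [sJ5]


open TopologicalSpace in
def SF (V : Opens (ℝ × ℝ)) : Subalgebra ℝ (V → ℝ) where
  carrier := {f | ∃ g : ℝ × ℝ → ℝ, ContDiffOn ℝ (⊤ : ℕ∞) g V ∧ ∀ v : V, f v = g v}
  mul_mem' := by
    rintro f1 f2 ⟨g1, h1, e1⟩ ⟨g2, h2, e2⟩
    exact ⟨fun v => g1 v * g2 v, h1.mul h2, fun v => by simp [e1, e2]⟩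
  add_mem' := by
    rintro f1 f2 ⟨g1, h1, e1⟩ ⟨g2, h2, e2⟩
    exact ⟨fun v => g1 v + g2 v, h1.add h2, fun v => by simp [e1, e2]⟩
  algebraMap_mem' := by
    intro r
    exact ⟨fun _ => r, contDiffOn_const, fun v => rfl⟩

open Classical in
/-- extension of a function on `V` by zero -/
def extV (V : TopologicalSpace.Opens (ℝ × ℝ)) (f : V → ℝ) (v : ℝ × ℝ) : ℝ :=
  if h : v ∈ V then f ⟨v, h⟩ else 0

theorem extV_apply {V : TopologicalSpace.Opens (ℝ × ℝ)} (f : V → ℝ) (v : V) : extV V f v = f v := by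
  simp [extV]

theorem extV_ev {V : TopologicalSpace.Opens (ℝ × ℝ)} (f : V → ℝ) (g : ℝ × ℝ → ℝ) (h : ∀ v : V, f v = g v) (v : V) :
    extV V f =ᶠ[nhds (v : ℝ × ℝ)] g := by
  filter_upwards [V.isOpen.mem_nhds v.2] with u hu
  rw [← h ⟨u, hu⟩]
  exact extV_apply f ⟨u, hu⟩

theorem extV_smooth {V : TopologicalSpace.Opens (ℝ × ℝ)} (f : SF V) : ContDiffOn ℝ (⊤ : ℕ∞) (extV V f.1) V := by
  obtain ⟨g, hg, e⟩ := f.2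
  refine hg.congr fun v hv => ?_
  rw [← e ⟨v, hv⟩]
  exact extV_apply f.1 ⟨v, hv⟩

theorem extV_smoothAt {V : TopologicalSpace.Opens (ℝ × ℝ)} (f : SF V) (v : V) : ContDiffAt ℝ (⊤ : ℕ∞) (extV V f.1) v :=
  (extV_smooth f).contDiffAt (V.isOpen.mem_nhds v.2)

theorem extV_diff {V : TopologicalSpace.Opens (ℝ × ℝ)} (f : SF V) (v : V) : DifferentiableAt ℝ (extV V f.1) v :=
  (extV_smoothAt f v).differentiableAt (by simp)

def SFmk {V : TopologicalSpace.Opens (ℝ × ℝ)} (g : ℝ × ℝ → ℝ) (hg : ContDiffOn ℝ (⊤ : ℕ∞) g V) : SF V :=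
  ⟨fun v => g v, g, hg, fun _ => rfl⟩

def dWfun {V : TopologicalSpace.Opens (ℝ × ℝ)} (w : ℝ × ℝ) (f : SF V) : SF V :=
  SFmk (fun v => fderiv ℝ (extV V f.1) v w) (by
    have h : ContDiffOn ℝ (⊤ : ℕ∞) (fderiv ℝ (extV V f.1)) V :=
      (extV_smooth f).fderiv_of_isOpen V.isOpen (by simp)
    exact h.clm_apply contDiffOn_const)

def dW {V : TopologicalSpace.Opens (ℝ × ℝ)} (w : ℝ × ℝ) : Derivation ℝ (SF V) (SF V) :=
  Derivation.mk'
    { toFun := dWfun w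
      map_add' := by
        intro f g
        ext v
        change fderiv ℝ (extV V (f + g).1) v w = fderiv ℝ (extV V f.1) v w + fderiv ℝ (extV V g.1) v w
        have : extV V (f + g).1 = extV V f.1 + extV V g.1 := by
          funext u
          by_cases hu : u ∈ V <;> simp [extV, hu]
        rw [this, fderiv_add (extV_diff f v) (extV_diff g v)]
        rfl
      map_smul' := by
        intro r f
        ext v
        change fderiv ℝ (extV V (r • f).1) v w = r * fderiv ℝ (extV V f.1) v w
        have : extV V (r • f).1 = r • extV V f.1 := by
          funext u
          by_cases hu : u ∈ V <;> simp [extV, hu]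
        rw [this, fderiv_const_smul (extV_diff f v)]
        rfl }
    (by
      intro f g
      ext v
      change fderiv ℝ (extV V (f * g).1) v w = f.1 v * fderiv ℝ (extV V g.1) v w + g.1 v * fderiv ℝ (extV V f.1) v w
      have : extV V (f * g).1 = extV V f.1 * extV V g.1 := by
        funext u
        by_cases hu : u ∈ V <;> simp [extV, hu]
      rw [this, fderiv_mul (extV_diff f v) (extV_diff g v)]
      simp [extV_apply])

/-- evaluation -/
def evv {V : TopologicalSpace.Opens (ℝ × ℝ)} (v : V) : SF V →+* ℝ where
  toFun f := f.1 v
  map_one' := rfl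
  map_mul' _ _ := rfl
  map_zero' := rfl
  map_add' _ _ := rfl

theorem SF_eq_zero {V : TopologicalSpace.Opens (ℝ × ℝ)} (f : SF V) (h : ∀ v : V, evv v f = 0) : f = 0 := by
  ext v
  exact h v

theorem evv_mk {V : TopologicalSpace.Opens (ℝ × ℝ)} (g : ℝ × ℝ → ℝ) (hg : ContDiffOn ℝ (⊤ : ℕ∞) g V) (v : V) :
    evv v (SFmk g hg) = g v := rfl

theorem evv_dW_mk {V : TopologicalSpace.Opens (ℝ × ℝ)} (w : ℝ × ℝ) (g : ℝ × ℝ → ℝ) (hg : ContDiffOn ℝ (⊤ : ℕ∞) g V) (v : V) :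
    evv v (dW w (SFmk g hg)) = fderiv ℝ g v w := by
  change fderiv ℝ (extV V (SFmk g hg).1) v w = _
  rw [(extV_ev (SFmk g hg).1 g (fun _ => rfl) v).fderiv_eq]

theorem dW_comm {V : TopologicalSpace.Opens (ℝ × ℝ)} (w1 w2 : ℝ × ℝ) (f : SF V) : dW w1 (dW w2 f) = dW w2 (dW w1 f) := by
  have key : ∀ w1 w2 : ℝ × ℝ, ∀ v : V, evv v (dW w1 (dW w2 f)) = fderiv ℝ (fderiv ℝ (extV V f.1)) v w1 w2 := by
    intro w1 w2 v
    have h1 : dW w2 f = SFmk (fun v => fderiv ℝ (extV V f.1) v w2) (by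
      have h : ContDiffOn ℝ (⊤ : ℕ∞) (fderiv ℝ (extV V f.1)) V :=
        (extV_smooth f).fderiv_of_isOpen V.isOpen (by simp)
      exact h.clm_apply contDiffOn_const) := rfl
    rw [h1, evv_dW_mk]
    have hd : DifferentiableAt ℝ (fderiv ℝ (extV V f.1)) v :=
      ((extV_smoothAt f v).fderiv_right (m := 1) (by exact WithTop.coe_le_coe.mpr le_top)).differentiableAt (by simp)
    rw [fderiv_clm_apply hd (by fun_prop)]
    simp
  ext v
  have hs : IsSymmSndFDerivAt ℝ (extV V f.1) v :=
    (extV_smoothAt f v).isSymmSndFDerivAt (by simp; exact WithTop.coe_le_coe.mpr le_top)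
  exact (key w1 w2 v).trans ((hs w1 w2).trans (key w2 w1 v).symm)

theorem SF_isUnit {V : TopologicalSpace.Opens (ℝ × ℝ)} (f : SF V) (h : ∀ v : V, evv v f ≠ 0) : IsUnit f := by
  refine IsUnit.of_mul_eq_one (SFmk (fun v => (extV V f.1 v)⁻¹) ?_) ?_
  · refine (extV_smooth f).inv fun v hv => ?_
    rw [extV_apply f.1 ⟨v, hv⟩]
    exact h ⟨v, hv⟩
  · ext v
    change f.1 v * (extV V f.1 v)⁻¹ = 1
    rw [extV_apply]
    exact mul_inv_cancel₀ (h v)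


theorem contDiffAt_zpow {f : ℝ × ℝ → ℝ} {v : ℝ × ℝ} (hf : ContDiffAt ℝ (⊤ : ℕ∞) f v) (h : f v ≠ 0) (n : ℤ) :
    ContDiffAt ℝ (⊤ : ℕ∞) (fun u => f u ^ n) v := by
  cases n with
  | ofNat n => simpa using hf.pow n
  | negSucc n =>
    simp only [zpow_negSucc]
    exact (hf.pow (n+1)).inv (pow_ne_zero _ h)

/-- rescaling monomials -/
def Wm (k : ℝ) (e0 e1 e2 e3 e4 : ℤ) (v : ℝ × ℝ) : ℝ :=
  k * (v.1 - 1) ^ e0 * (v.1 + 1) ^ e1 * (1 - v.2 ^ 2) ^ e2 * (v.1 ^ 2 - v.2 ^ 2) ^ e3 * v.2 ^ e4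

def Good (v : ℝ × ℝ) : Prop := v.1 - 1 ≠ 0 ∧ v.1 + 1 ≠ 0 ∧ 1 - v.2 ^ 2 ≠ 0 ∧ v.1 ^ 2 - v.2 ^ 2 ≠ 0 ∧ v.2 ≠ 0

theorem Wm_smooth (k : ℝ) (e0 e1 e2 e3 e4 : ℤ) (v : ℝ × ℝ) (hv : Good v) :
    ContDiffAt ℝ (⊤ : ℕ∞) (Wm k e0 e1 e2 e3 e4) v := by
  obtain ⟨h0, h1, h2, h3, h4⟩ := hv
  unfold Wm
  have a0 := contDiffAt_zpow (f := fun v : ℝ × ℝ => v.1 - 1) (v := v) (by fun_prop) h0 e0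
  have a1 := contDiffAt_zpow (f := fun v : ℝ × ℝ => v.1 + 1) (v := v) (by fun_prop) h1 e1
  have a2 := contDiffAt_zpow (f := fun v : ℝ × ℝ => 1 - v.2 ^ 2) (v := v) (by fun_prop) h2 e2
  have a3 := contDiffAt_zpow (f := fun v : ℝ × ℝ => v.1 ^ 2 - v.2 ^ 2) (v := v) (by fun_prop) h3 e3
  have a4 := contDiffAt_zpow (f := fun v : ℝ × ℝ => v.2) (v := v) (by fun_prop) h4 e4
  exact ((((contDiffAt_const.mul a0).mul a1).mul a2).mul a3).mul a4

theorem Wm_ne (k : ℝ) (hk : k ≠ 0) (e0 e1 e2 e3 e4 : ℤ) (v : ℝ × ℝ) (hv : Good v) : Wm k e0 e1 e2 e3 e4 v ≠ 0 := by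
  obtain ⟨h0, h1, h2, h3, h4⟩ := hv
  unfold Wm
  have := zpow_ne_zero e0 h0
  have := zpow_ne_zero e1 h1
  have := zpow_ne_zero e2 h2
  have := zpow_ne_zero e3 h3
  have := zpow_ne_zero e4 h4
  positivity

theorem fderiv_line1 (g : ℝ × ℝ → ℝ) (v : ℝ × ℝ) (hg : DifferentiableAt ℝ g v) (d : ℝ)
    (h : HasDerivAt (fun s => g (s, v.2)) d v.1) : fderiv ℝ g v (1, 0) = d := by
  have h1 : HasDerivAt (fun s : ℝ => (s, v.2)) ((1 : ℝ), (0 : ℝ)) v.1 :=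
    (hasDerivAt_id v.1).prodMk (hasDerivAt_const v.1 v.2)
  have h2 := HasFDerivAt.comp_hasDerivAt (f := fun s : ℝ => (s, v.2)) v.1 (l := g) (l' := fderiv ℝ g v) hg.hasFDerivAt h1
  exact h2.unique h

theorem fderiv_line2 (g : ℝ × ℝ → ℝ) (v : ℝ × ℝ) (hg : DifferentiableAt ℝ g v) (d : ℝ)
    (h : HasDerivAt (fun s => g (v.1, s)) d v.2) : fderiv ℝ g v (0, 1) = d := by
  have h1 : HasDerivAt (fun s : ℝ => (v.1, s)) ((0 : ℝ), (1 : ℝ)) v.2 :=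
    (hasDerivAt_const v.2 v.1).prodMk (hasDerivAt_id v.2)
  have h2 := HasFDerivAt.comp_hasDerivAt (f := fun s : ℝ => (v.1, s)) v.2 (l := g) (l' := fderiv ℝ g v) hg.hasFDerivAt h1
  exact h2.unique h

theorem hasDerivAt_zpow' {f : ℝ → ℝ} {f' x : ℝ} (hf : HasDerivAt f f' x) (h : f x ≠ 0) (n : ℤ) :
    HasDerivAt (fun s => f s ^ n) (f x ^ n * (n * f' / f x)) x := by
  have := (hasDerivAt_zpow n (f x) (Or.inl h)).comp x hf
  refine this.congr_deriv ?_
  rw [zpow_sub_one₀ h]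
  field_simp

theorem Wm_dx (k : ℝ) (e0 e1 e2 e3 e4 : ℤ) (v : ℝ × ℝ) (hv : Good v) :
    fderiv ℝ (Wm k e0 e1 e2 e3 e4) v (1, 0) =
      Wm k e0 e1 e2 e3 e4 v * (e0 / (v.1 - 1) + e1 / (v.1 + 1) + 2 * v.1 * e3 / (v.1 ^ 2 - v.2 ^ 2)) := by
  apply fderiv_line1 _ _ ((Wm_smooth k e0 e1 e2 e3 e4 v hv).differentiableAt (by simp))
  obtain ⟨h0, h1, h2, h3, h4⟩ := hv
  unfold Wm
  have a0 := hasDerivAt_zpow' (f := fun s : ℝ => s - 1) (x := v.1) ((hasDerivAt_id _).sub_const 1) h0 e0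
  have a1 := hasDerivAt_zpow' (f := fun s : ℝ => s + 1) (x := v.1) ((hasDerivAt_id _).add_const 1) h1 e1
  have a3 := hasDerivAt_zpow' (f := fun s : ℝ => s ^ 2 - v.2 ^ 2) (x := v.1) ((hasDerivAt_pow 2 _).sub_const _) h3 e3
  have := (((((a0.const_mul k).mul a1).mul_const ((1 - v.2 ^ 2) ^ e2)).mul a3).mul_const (v.2 ^ e4))
  refine this.congr_deriv ?_
  simp only [Pi.mul_apply]
  push_cast
  ring

theorem Wm_dy (k : ℝ) (e0 e1 e2 e3 e4 : ℤ) (v : ℝ × ℝ) (hv : Good v) :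
    fderiv ℝ (Wm k e0 e1 e2 e3 e4) v (0, 1) =
      Wm k e0 e1 e2 e3 e4 v * (-(2 * v.2 * e2 / (1 - v.2 ^ 2)) - 2 * v.2 * e3 / (v.1 ^ 2 - v.2 ^ 2) + e4 / v.2) := by
  apply fderiv_line2 _ _ ((Wm_smooth k e0 e1 e2 e3 e4 v hv).differentiableAt (by simp))
  obtain ⟨h0, h1, h2, h3, h4⟩ := hv
  unfold Wm
  have a2 := hasDerivAt_zpow' (f := fun s : ℝ => 1 - s ^ 2) (x := v.2) ((hasDerivAt_pow 2 _).const_sub 1) h2 e2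
  have a3 := hasDerivAt_zpow' (f := fun s : ℝ => v.1 ^ 2 - s ^ 2) (x := v.2) ((hasDerivAt_pow 2 _).const_sub _) h3 e3
  have a4 := hasDerivAt_zpow' (f := fun s : ℝ => s) (x := v.2) (hasDerivAt_id _) h4 e4
  have := (((a2.const_mul (k * (v.1 - 1) ^ e0 * (v.1 + 1) ^ e1)).mul a3).mul a4)
  refine this.congr_deriv ?_
  simp only [Pi.mul_apply]
  push_cast
  ring

theorem gaugeLem {V : TopologicalSpace.Opens (ℝ × ℝ)} (hV : ∀ v : V, Good v)
    (U : ℝ × ℝ → ℝ) (hU : ContDiffOn ℝ (⊤ : ℕ∞) U V) (k : ℝ) (hk : k ≠ 0) (e0 e1 e2 e3 e4 : ℤ) :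
    ∃ t : SF V, ∀ v : V, U v = Wm k e0 e1 e2 e3 e4 v * evv v t ∧
      fderiv ℝ U v (1, 0) = Wm k e0 e1 e2 e3 e4 v *
        ((e0 / ((v : ℝ × ℝ).1 - 1) + e1 / ((v : ℝ × ℝ).1 + 1) + 2 * (v : ℝ × ℝ).1 * e3 / ((v : ℝ × ℝ).1 ^ 2 - (v : ℝ × ℝ).2 ^ 2)) * evv v t
          + evv v (dW (1, 0) t)) ∧
      fderiv ℝ U v (0, 1) = Wm k e0 e1 e2 e3 e4 v *
        ((-(2 * (v : ℝ × ℝ).2 * e2 / (1 - (v : ℝ × ℝ).2 ^ 2)) - 2 * (v : ℝ × ℝ).2 * e3 / ((v : ℝ × ℝ).1 ^ 2 - (v : ℝ × ℝ).2 ^ 2) + e4 / (v : ℝ × ℝ).2) * evv v t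
          + evv v (dW (0, 1) t)) := by
  have hW : ContDiffOn ℝ (⊤ : ℕ∞) (Wm k e0 e1 e2 e3 e4) V := fun v hv =>
    (Wm_smooth k e0 e1 e2 e3 e4 v (hV ⟨v, hv⟩)).contDiffWithinAt
  have hn : ∀ v : V, Wm k e0 e1 e2 e3 e4 v ≠ 0 := fun v => Wm_ne k hk e0 e1 e2 e3 e4 v (hV v)
  have hT : ContDiffOn ℝ (⊤ : ℕ∞) (fun v => U v / Wm k e0 e1 e2 e3 e4 v) V := hU.div hW (fun v hv => hn ⟨v, hv⟩)
  have hd : ∀ (v : V) (w : ℝ × ℝ), fderiv ℝ U v w = Wm k e0 e1 e2 e3 e4 v * fderiv ℝ (fun v => U v / Wm k e0 e1 e2 e3 e4 v) v w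
      + (U v / Wm k e0 e1 e2 e3 e4 v) * fderiv ℝ (Wm k e0 e1 e2 e3 e4) v w := by
    intro v w
    have hm := V.isOpen.mem_nhds v.2
    have he : U =ᶠ[nhds (v : ℝ × ℝ)] fun u => Wm k e0 e1 e2 e3 e4 u * (U u / Wm k e0 e1 e2 e3 e4 u) := by
      filter_upwards [hm] with u hu
      have := hn ⟨u, hu⟩
      simp only at this
      field_simp
    rw [he.fderiv_eq, fderiv_fun_mul ((hW.contDiffAt hm).differentiableAt (by simp)) ((hT.contDiffAt hm).differentiableAt (by simp))]
    rfl
  refine ⟨SFmk _ hT, fun v => ⟨?_, ?_, ?_⟩⟩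
  · rw [evv_mk]
    have := hn v
    field_simp
  · rw [hd, Wm_dx _ _ _ _ _ _ _ (hV v), evv_dW_mk, evv_mk]
    ring
  · rw [hd, Wm_dy _ _ _ _ _ _ _ (hV v), evv_dW_mk, evv_mk]
    ring


/-- coefficient equations of the bracket for one parity family -/
structure EqsP (h1 h1x h1y h2 h2x h2y fx fy tx : ℝ) (J Jx Jy K Kx Ky L Lx Ly A Ax Ay B Bx By C Cx Cy : ℕ → ℝ) : Prop where
  fD0 : tx*C 1 = 0
  fA0 : fx*A 1 + fy*A 0 = 0
  fB0 : fx*B 1 + fy*B 0 + tx*A 1 = 0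
  fC0 : fx*C 1 + fy*C 0 + tx*B 1 = 0
  eC2 : h1x*C 1 + h1y*C 0 - 2*h1*Cx 1 + 3*tx*L 3 = 0
  eC1 : -2*h1*Cx 0 - 2*h2*Cy 1 + 2*tx*L 2 = 0
  eC0 : h2x*C 1 + h2y*C 0 - 2*h2*Cy 0 + tx*L 1 = 0
  eB2 : h1x*B 1 + h1y*B 0 - 2*h1*Bx 1 + 3*fx*L 3 + fy*L 2 + 3*tx*K 3 = 0
  eB1 : -2*h1*Bx 0 - 2*h2*By 1 + 2*fx*L 2 + 2*fy*L 1 + 2*tx*K 2 = 0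
  eA1 : -2*h1*Ax 0 - 2*h2*Ay 1 + 2*fx*K 2 + 2*fy*K 1 = 0
  eB0 : h2x*B 1 + h2y*B 0 - 2*h2*By 0 + fx*L 1 + 3*fy*L 0 + tx*K 1 = 0
  eA0 : h2x*A 1 + h2y*A 0 - 2*h2*Ay 0 + fx*K 1 + 3*fy*K 0 = 0
  eA2 : h1x*A 1 + h1y*A 0 - 2*h1*Ax 1 + 3*fx*K 3 + fy*K 2 = 0
  eL0 : h2x*L 1 + 3*h2y*L 0 - 2*h2*Ly 0 + tx*J 1 = 0
  eL1 : 2*h2x*L 2 + 2*h2y*L 1 - 2*h1*Lx 0 - 2*h2*Ly 1 + 2*tx*J 2 = 0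
  eL2 : h1x*L 1 + 3*h2x*L 3 + 3*h1y*L 0 + h2y*L 2 - 2*h1*Lx 1 - 2*h2*Ly 2 + 3*tx*J 3 = 0
  eL3 : 2*h1x*L 2 + 2*h1y*L 1 - 2*h1*Lx 2 - 2*h2*Ly 3 + 4*tx*J 4 = 0
  eL4 : 3*h1x*L 3 + h1y*L 2 - 2*h1*Lx 3 + 5*tx*J 5 = 0
  eK0 : h2x*K 1 + 3*h2y*K 0 - 2*h2*Ky 0 + fx*J 1 + 5*fy*J 0 = 0
  eK1 : 2*h2x*K 2 + 2*h2y*K 1 - 2*h1*Kx 0 - 2*h2*Ky 1 + 2*fx*J 2 + 4*fy*J 1 = 0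
  eK3 : 2*h1x*K 2 + 2*h1y*K 1 - 2*h1*Kx 2 - 2*h2*Ky 3 + 4*fx*J 4 + 2*fy*J 3 = 0
  eK4 : 3*h1x*K 3 + h1y*K 2 - 2*h1*Kx 3 + 5*fx*J 5 + fy*J 4 = 0
  eJ0 : h2x*J 1 + 5*h2y*J 0 - 2*h2*Jy 0 = 0
  eJ6 : 5*h1x*J 5 + h1y*J 4 - 2*h1*Jx 5 = 0

def gh1 (x y : ℝ) : ℝ := (1/2*(x^2-y^2)^3/((x-1)*(x+1)^5))

def gh1x (x y : ℝ) : ℝ := ((1/2*(x^2-y^2)^3/((x-1)*(x+1)^5))*(-1/(x-1)-5/(x+1)+6*x/(x^2-y^2)))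

def gh1y (x y : ℝ) : ℝ := ((1/2*(x^2-y^2)^3/((x-1)*(x+1)^5))*(-6*y/(x^2-y^2)))

def gh2 (x y : ℝ) : ℝ := (1/2*(1-y^2)*(x^2-y^2)^3/((x-1)^2*(x+1)^6))

def gh2x (x y : ℝ) : ℝ := ((1/2*(1-y^2)*(x^2-y^2)^3/((x-1)^2*(x+1)^6))*(-2/(x-1)-6/(x+1)+6*x/(x^2-y^2)))

def gh2y (x y : ℝ) : ℝ := ((1/2*(1-y^2)*(x^2-y^2)^3/((x-1)^2*(x+1)^6))*(-2*y/(1-y^2)-6*y/(x^2-y^2)))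

def gfx (x y : ℝ) : ℝ := ((1/2*(x-1)/((x+1)^3*(1-y^2)))*(1/(x-1)-3/(x+1)))

def gfy (x y : ℝ) : ℝ := ((1/2*(x-1)/((x+1)^3*(1-y^2)))*(2*y/(1-y^2)))

def gtx (x y : ℝ) : ℝ := ((-1/2*(x+1)^2/(x-1)^2)*(2/(x+1)-2/(x-1)))

theorem cv_fA0 (x y a p Y D : ℝ) (ha' : a = x-1) (hp' : p = x+1) (hY' : Y = 1-y^2) (hD' : D = x^2-y^2)
    (ha : a ≠ 0) (hp : p ≠ 0) (hY : Y ≠ 0) (hD : D ≠ 0) (hy : y ≠ 0)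
    (A0 A0x A0y A1 A1x A1y : ℝ)
    (e : ((1/2*a/(p^3*Y))*(1/a-3/p))*(((1/2 : ℝ)*a^(1:ℤ)*p^(-3:ℤ)*Y^(-2:ℤ)*D^(1:ℤ)*y^(2:ℤ))*A1) + ((1/2*a/(p^3*Y))*(2*y/Y))*(((1/2 : ℝ)*a^(0:ℤ)*p^(-4:ℤ)*Y^(-1:ℤ)*D^(1:ℤ)*y^(1:ℤ))*A0) = 0) :
    A0 + (-1)*(x-2)*A1 = 0 := by
  have hM : ((1/2 : ℝ)*a^(1:ℤ)*p^(-7:ℤ)*Y^(-3:ℤ)*D^(1:ℤ)*y^(2:ℤ)) ≠ 0 := by positivity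
  apply (mul_eq_zero.mp (?_ : ((1/2 : ℝ)*a^(1:ℤ)*p^(-7:ℤ)*Y^(-3:ℤ)*D^(1:ℤ)*y^(2:ℤ)) * (A0 + (-1)*(x-2)*A1) = 0)).resolve_left hM
  rw [← e]
  push_cast
  field_simp
  subst ha' hp' hY' hD'
  ring

theorem cv_fB0 (x y a p Y D : ℝ) (ha' : a = x-1) (hp' : p = x+1) (hY' : Y = 1-y^2) (hD' : D = x^2-y^2)
    (ha : a ≠ 0) (hp : p ≠ 0) (hY : Y ≠ 0) (hD : D ≠ 0) (hy : y ≠ 0)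
    (A1 A1x A1y B0 B0x B0y B1 B1x B1y : ℝ)
    (e : ((1/2*a/(p^3*Y))*(1/a-3/p))*(((1 : ℝ)*a^(-2:ℤ)*p^(2:ℤ)*Y^(-1:ℤ)*D^(1:ℤ)*y^(2:ℤ))*B1) + ((1/2*a/(p^3*Y))*(2*y/Y))*(((2 : ℝ)*a^(-3:ℤ)*p^(1:ℤ)*Y^(0:ℤ)*D^(1:ℤ)*y^(1:ℤ))*B0) + ((-1/2*p^2/a^2)*(2/p-2/a))*(((1/2 : ℝ)*a^(1:ℤ)*p^(-3:ℤ)*Y^(-2:ℤ)*D^(1:ℤ)*y^(2:ℤ))*A1) = 0) :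
    A1 + 2*B0 + (-1)*(x-2)*B1 = 0 := by
  have hM : ((1 : ℝ)*a^(-2:ℤ)*p^(-2:ℤ)*Y^(-2:ℤ)*D^(1:ℤ)*y^(2:ℤ)) ≠ 0 := by positivity
  apply (mul_eq_zero.mp (?_ : ((1 : ℝ)*a^(-2:ℤ)*p^(-2:ℤ)*Y^(-2:ℤ)*D^(1:ℤ)*y^(2:ℤ)) * (A1 + 2*B0 + (-1)*(x-2)*B1) = 0)).resolve_left hM
  rw [← e]
  push_cast
  field_simp
  subst ha' hp' hY' hD'
  ring

theorem cv_fC0 (x y a p Y D : ℝ) (ha' : a = x-1) (hp' : p = x+1) (hY' : Y = 1-y^2) (hD' : D = x^2-y^2)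
    (ha : a ≠ 0) (hp : p ≠ 0) (hY : Y ≠ 0) (hD : D ≠ 0) (hy : y ≠ 0)
    (B1 B1x B1y C0 C0x C0y : ℝ)
    (e : ((1/2*a/(p^3*Y))*(1/a-3/p))*(0:ℝ) + ((1/2*a/(p^3*Y))*(2*y/Y))*(((2 : ℝ)*a^(-6:ℤ)*p^(6:ℤ)*Y^(1:ℤ)*D^(1:ℤ)*y^(1:ℤ))*C0) + ((-1/2*p^2/a^2)*(2/p-2/a))*(((1 : ℝ)*a^(-2:ℤ)*p^(2:ℤ)*Y^(-1:ℤ)*D^(1:ℤ)*y^(2:ℤ))*B1) = 0) :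
    B1 + C0 = 0 := by
  have hM : ((2 : ℝ)*a^(-5:ℤ)*p^(3:ℤ)*Y^(-1:ℤ)*D^(1:ℤ)*y^(2:ℤ)) ≠ 0 := by positivity
  apply (mul_eq_zero.mp (?_ : ((2 : ℝ)*a^(-5:ℤ)*p^(3:ℤ)*Y^(-1:ℤ)*D^(1:ℤ)*y^(2:ℤ)) * (B1 + C0) = 0)).resolve_left hM
  rw [← e]
  push_cast
  field_simp
  subst ha' hp' hY' hD'
  ring

theorem cv_eC2 (x y a p Y D : ℝ) (ha' : a = x-1) (hp' : p = x+1) (hY' : Y = 1-y^2) (hD' : D = x^2-y^2)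
    (ha : a ≠ 0) (hp : p ≠ 0) (hY : Y ≠ 0) (hD : D ≠ 0) (hy : y ≠ 0)
    (C0 C0x C0y L3 L3x L3y : ℝ)
    (e : ((1/2*D^3/(a*p^5))*(-1/a-5/p+6*x/D))*(0:ℝ) + ((1/2*D^3/(a*p^5))*(-6*y/D))*(((2 : ℝ)*a^(-6:ℤ)*p^(6:ℤ)*Y^(1:ℤ)*D^(1:ℤ)*y^(1:ℤ))*C0) - 2*(1/2*D^3/(a*p^5))*(0:ℝ) + 3*((-1/2*p^2/a^2)*(2/p-2/a))*(((1 : ℝ)*a^(-4:ℤ)*p^(0:ℤ)*Y^(1:ℤ)*D^(3:ℤ)*y^(2:ℤ))*L3) = 0) :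
    (-1)*C0 + L3 = 0 := by
  have hM : ((6 : ℝ)*a^(-7:ℤ)*p^(1:ℤ)*Y^(1:ℤ)*D^(3:ℤ)*y^(2:ℤ)) ≠ 0 := by positivity
  apply (mul_eq_zero.mp (?_ : ((6 : ℝ)*a^(-7:ℤ)*p^(1:ℤ)*Y^(1:ℤ)*D^(3:ℤ)*y^(2:ℤ)) * ((-1)*C0 + L3) = 0)).resolve_left hM
  rw [← e]
  push_cast
  field_simp
  subst ha' hp' hY' hD'
  ring

theorem cv_eC1 (x y a p Y D : ℝ) (ha' : a = x-1) (hp' : p = x+1) (hY' : Y = 1-y^2) (hD' : D = x^2-y^2)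
    (ha : a ≠ 0) (hp : p ≠ 0) (hY : Y ≠ 0) (hD : D ≠ 0) (hy : y ≠ 0)
    (C0 C0x C0y L2 L2x L2y : ℝ)
    (e : -2*(1/2*D^3/(a*p^5))*(((2 : ℝ)*a^(-6:ℤ)*p^(6:ℤ)*Y^(1:ℤ)*D^(1:ℤ)*y^(1:ℤ))*((((-6:ℤ):ℝ)/a+((6:ℤ):ℝ)/p+2*x*((1:ℤ):ℝ)/D)*C0+C0x)) - 2*(1/2*Y*D^3/(a^2*p^6))*(0:ℝ) + 2*((-1/2*p^2/a^2)*(2/p-2/a))*(((1/2 : ℝ)*a^(-5:ℤ)*p^(-1:ℤ)*Y^(1:ℤ)*D^(3:ℤ)*y^(1:ℤ))*L2) = 0) :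
    (-1)*(x-1)*(x+1)*(x^2-y^2)*C0x + (-2)*(x^3-6*x^2-x+6*y^2)*C0 + L2 = 0 := by
  have hM : ((2 : ℝ)*a^(-8:ℤ)*p^(0:ℤ)*Y^(1:ℤ)*D^(3:ℤ)*y^(1:ℤ)) ≠ 0 := by positivity
  apply (mul_eq_zero.mp (?_ : ((2 : ℝ)*a^(-8:ℤ)*p^(0:ℤ)*Y^(1:ℤ)*D^(3:ℤ)*y^(1:ℤ)) * ((-1)*(x-1)*(x+1)*(x^2-y^2)*C0x + (-2)*(x^3-6*x^2-x+6*y^2)*C0 + L2) = 0)).resolve_left hM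
  rw [← e]
  push_cast
  field_simp
  subst ha' hp' hY' hD'
  ring

theorem cv_eC0 (x y a p Y D : ℝ) (ha' : a = x-1) (hp' : p = x+1) (hY' : Y = 1-y^2) (hD' : D = x^2-y^2)
    (ha : a ≠ 0) (hp : p ≠ 0) (hY : Y ≠ 0) (hD : D ≠ 0) (hy : y ≠ 0)
    (C0 C0x C0y L1 L1x L1y : ℝ)
    (e : ((1/2*Y*D^3/(a^2*p^6))*(-2/a-6/p+6*x/D))*(0:ℝ) + ((1/2*Y*D^3/(a^2*p^6))*(-2*y/Y-6*y/D))*(((2 : ℝ)*a^(-6:ℤ)*p^(6:ℤ)*Y^(1:ℤ)*D^(1:ℤ)*y^(1:ℤ))*C0) - 2*(1/2*Y*D^3/(a^2*p^6))*(((2 : ℝ)*a^(-6:ℤ)*p^(6:ℤ)*Y^(1:ℤ)*D^(1:ℤ)*y^(1:ℤ))*((-(2*y*((1:ℤ):ℝ)/Y)-2*y*((1:ℤ):ℝ)/D+((1:ℤ):ℝ)/y)*C0+C0y)) + ((-1/2*p^2/a^2)*(2/p-2/a))*(((1 : ℝ)*a^(-5:ℤ)*p^(-1:ℤ)*Y^(1:ℤ)*D^(3:ℤ)*y^(0:ℤ))*L1)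 = 0) :
    (-1)*(1-y^2)*(x^2-y^2)*y*C0y + (2*x^2*y^2-x^2-y^4)*C0 + L1 = 0 := by
  have hM : ((2 : ℝ)*a^(-8:ℤ)*p^(0:ℤ)*Y^(1:ℤ)*D^(3:ℤ)*y^(0:ℤ)) ≠ 0 := by positivity
  apply (mul_eq_zero.mp (?_ : ((2 : ℝ)*a^(-8:ℤ)*p^(0:ℤ)*Y^(1:ℤ)*D^(3:ℤ)*y^(0:ℤ)) * ((-1)*(1-y^2)*(x^2-y^2)*y*C0y + (2*x^2*y^2-x^2-y^4)*C0 + L1) = 0)).resolve_left hM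
  rw [← e]
  push_cast
  field_simp
  subst ha' hp' hY' hD'
  ring

theorem cv_eB2 (x y a p Y D : ℝ) (ha' : a = x-1) (hp' : p = x+1) (hY' : Y = 1-y^2) (hD' : D = x^2-y^2)
    (ha : a ≠ 0) (hp : p ≠ 0) (hY : Y ≠ 0) (hD : D ≠ 0) (hy : y ≠ 0)
    (B0 B0x B0y B1 B1x B1y K3 K3x K3y L2 L2x L2y L3 L3x L3y : ℝ)
    (e : ((1/2*D^3/(a*p^5))*(-1/a-5/p+6*x/D))*(((1 : ℝ)*a^(-2:ℤ)*p^(2:ℤ)*Y^(-1:ℤ)*D^(1:ℤ)*y^(2:ℤ))*B1) + ((1/2*D^3/(a*p^5))*(-6*y/D))*(((2 : ℝ)*a^(-3:ℤ)*p^(1:ℤ)*Y^(0:ℤ)*D^(1:ℤ)*y^(1:ℤ))*B0) - 2*(1/2*D^3/(a*p^5))*(((1 : ℝ)*a^(-2:ℤ)*p^(2:ℤ)*Y^(-1:ℤ)*D^(1:ℤ)*y^(2:ℤ))*((((-2:ℤ):ℝ)/a+((2:ℤ):ℝ)/p+2*x*((1:ℤ):ℝ)/D)*B1+B1x)) + 3*((1/2*a/(p^3*Y))*(1/a-3/p))*(((1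 : ℝ)*a^(-4:ℤ)*p^(0:ℤ)*Y^(1:ℤ)*D^(3:ℤ)*y^(2:ℤ))*L3) + ((1/2*a/(p^3*Y))*(2*y/Y))*(((1/2 : ℝ)*a^(-5:ℤ)*p^(-1:ℤ)*Y^(1:ℤ)*D^(3:ℤ)*y^(1:ℤ))*L2) + 3*((-1/2*p^2/a^2)*(2/p-2/a))*(((1/4 : ℝ)*a^(-1:ℤ)*p^(-5:ℤ)*Y^(-1:ℤ)*D^(3:ℤ)*y^(2:ℤ))*K3) = 0) :
    (-2)*(x-1)*(x+1)*(x^2-y^2)*B1x + (-12)*(1-y^2)*B0 + (-2)*(2*x^3-6*x^2-3*x*y^2+x+6*y^2)*B1 + 3*K3 + L2 + (-6)*(1-y^2)*(x-2)*L3 = 0 := by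
  have hM : ((1/2 : ℝ)*a^(-4:ℤ)*p^(-4:ℤ)*Y^(-1:ℤ)*D^(3:ℤ)*y^(2:ℤ)) ≠ 0 := by positivity
  apply (mul_eq_zero.mp (?_ : ((1/2 : ℝ)*a^(-4:ℤ)*p^(-4:ℤ)*Y^(-1:ℤ)*D^(3:ℤ)*y^(2:ℤ)) * ((-2)*(x-1)*(x+1)*(x^2-y^2)*B1x + (-12)*(1-y^2)*B0 + (-2)*(2*x^3-6*x^2-3*x*y^2+x+6*y^2)*B1 + 3*K3 + L2 + (-6)*(1-y^2)*(x-2)*L3) = 0)).resolve_left hM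
  rw [← e]
  push_cast
  field_simp
  subst ha' hp' hY' hD'
  ring

theorem cv_eB1 (x y a p Y D : ℝ) (ha' : a = x-1) (hp' : p = x+1) (hY' : Y = 1-y^2) (hD' : D = x^2-y^2)
    (ha : a ≠ 0) (hp : p ≠ 0) (hY : Y ≠ 0) (hD : D ≠ 0) (hy : y ≠ 0)
    (B0 B0x B0y B1 B1x B1y K2 K2x K2y L1 L1x L1y L2 L2x L2y : ℝ)
    (e : -2*(1/2*D^3/(a*p^5))*(((2 : ℝ)*a^(-3:ℤ)*p^(1:ℤ)*Y^(0:ℤ)*D^(1:ℤ)*y^(1:ℤ))*((((-3:ℤ):ℝ)/a+((1:ℤ):ℝ)/p+2*x*((1:ℤ):ℝ)/D)*B0+B0x)) - 2*(1/2*Y*D^3/(a^2*p^6))*(((1 : ℝ)*a^(-2:ℤ)*p^(2:ℤ)*Y^(-1:ℤ)*D^(1:ℤ)*y^(2:ℤ))*((-(2*y*((-1:ℤ):ℝ)/Y)-2*y*((1:ℤ):ℝ)/D+((2:ℤ):ℝ)/y)*B1+B1y)) + 2*((1/2*a/(p^3*Y))*(1/a-3/p))*(((1/2 : ℝ)*a^(-5:ℤ)*p^(-1:ℤ)*Y^(1:ℤ)*D^(3:ℤ)*y^(1:ℤ))*L2)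 + 2*((1/2*a/(p^3*Y))*(2*y/Y))*(((1 : ℝ)*a^(-5:ℤ)*p^(-1:ℤ)*Y^(1:ℤ)*D^(3:ℤ)*y^(0:ℤ))*L1) + 2*((-1/2*p^2/a^2)*(2/p-2/a))*(((1/4 : ℝ)*a^(-2:ℤ)*p^(-6:ℤ)*Y^(0:ℤ)*D^(3:ℤ)*y^(1:ℤ))*K2) = 0) :
    (-2)*(x-1)*(x+1)*(1-y^2)*(x^2-y^2)*B0x + (-1)*(x-1)*(x+1)*(1-y^2)*(x^2-y^2)*y*B1y + 4*(2*x^2-x*y^2+x-2*y^2)*(1-y^2)*B0 + (-2)*(x^2+y^4-2*y^2)*(x-1)*(x+1)*B1 + (1-y^2)*K2 + 2*(x-1)*(x+1)*L1 + (-1)*(1-y^2)*(x-2)*L2 = 0 := by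
  have hM : ((1 : ℝ)*a^(-5:ℤ)*p^(-5:ℤ)*Y^(-1:ℤ)*D^(3:ℤ)*y^(1:ℤ)) ≠ 0 := by positivity
  apply (mul_eq_zero.mp (?_ : ((1 : ℝ)*a^(-5:ℤ)*p^(-5:ℤ)*Y^(-1:ℤ)*D^(3:ℤ)*y^(1:ℤ)) * ((-2)*(x-1)*(x+1)*(1-y^2)*(x^2-y^2)*B0x + (-1)*(x-1)*(x+1)*(1-y^2)*(x^2-y^2)*y*B1y + 4*(2*x^2-x*y^2+x-2*y^2)*(1-y^2)*B0 + (-2)*(x^2+y^4-2*y^2)*(x-1)*(x+1)*B1 + (1-y^2)*K2 + 2*(x-1)*(x+1)*L1 + (-1)*(1-y^2)*(x-2)*L2) = 0)).resolve_left hM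
  rw [← e]
  push_cast
  field_simp
  subst ha' hp' hY' hD'
  ring

theorem cv_eA1 (x y a p Y D : ℝ) (ha' : a = x-1) (hp' : p = x+1) (hY' : Y = 1-y^2) (hD' : D = x^2-y^2)
    (ha : a ≠ 0) (hp : p ≠ 0) (hY : Y ≠ 0) (hD : D ≠ 0) (hy : y ≠ 0)
    (A0 A0x A0y A1 A1x A1y K1 K1x K1y K2 K2x K2y : ℝ)
    (e : -2*(1/2*D^3/(a*p^5))*(((1/2 : ℝ)*a^(0:ℤ)*p^(-4:ℤ)*Y^(-1:ℤ)*D^(1:ℤ)*y^(1:ℤ))*((((0:ℤ):ℝ)/a+((-4:ℤ):ℝ)/p+2*x*((1:ℤ):ℝ)/D)*A0+A0x)) - 2*(1/2*Y*D^3/(a^2*p^6))*(((1/2 : ℝ)*a^(1:ℤ)*p^(-3:ℤ)*Y^(-2:ℤ)*D^(1:ℤ)*y^(2:ℤ))*((-(2*y*((-2:ℤ):ℝ)/Y)-2*y*((1:ℤ):ℝ)/D+((2:ℤ):ℝ)/y)*A1+A1y)) + 2*((1/2*a/(p^3*Y))*(1/a-3/p))*(((1/4 : ℝ)*a^(-2:ℤ)*p^(-6:ℤ)*Y^(0:ℤ)*D^(3:ℤ)*y^(1:ℤ))*K2)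 + 2*((1/2*a/(p^3*Y))*(2*y/Y))*(((1/2 : ℝ)*a^(-3:ℤ)*p^(-7:ℤ)*Y^(0:ℤ)*D^(3:ℤ)*y^(0:ℤ))*K1) = 0) :
    (-1)*(x-1)*(x+1)*(1-y^2)*(x^2-y^2)*A0x + (-1)*(x-1)*(x+1)*(1-y^2)*(x^2-y^2)*y*A1y + 2*(x^2-x-2*y^2)*(x-1)*(1-y^2)*A0 + (-2)*(x^2*y^2+x^2-2*y^2)*(x-1)*(x+1)*A1 + 2*K1 + (-1)*(1-y^2)*(x-2)*K2 = 0 := by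
  have hM : ((1/2 : ℝ)*a^(-2:ℤ)*p^(-10:ℤ)*Y^(-2:ℤ)*D^(3:ℤ)*y^(1:ℤ)) ≠ 0 := by positivity
  apply (mul_eq_zero.mp (?_ : ((1/2 : ℝ)*a^(-2:ℤ)*p^(-10:ℤ)*Y^(-2:ℤ)*D^(3:ℤ)*y^(1:ℤ)) * ((-1)*(x-1)*(x+1)*(1-y^2)*(x^2-y^2)*A0x + (-1)*(x-1)*(x+1)*(1-y^2)*(x^2-y^2)*y*A1y + 2*(x^2-x-2*y^2)*(x-1)*(1-y^2)*A0 + (-2)*(x^2*y^2+x^2-2*y^2)*(x-1)*(x+1)*A1 + 2*K1 + (-1)*(1-y^2)*(x-2)*K2) = 0)).resolve_left hM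
  rw [← e]
  push_cast
  field_simp
  subst ha' hp' hY' hD'
  ring

theorem cv_eB0 (x y a p Y D : ℝ) (ha' : a = x-1) (hp' : p = x+1) (hY' : Y = 1-y^2) (hD' : D = x^2-y^2)
    (ha : a ≠ 0) (hp : p ≠ 0) (hY : Y ≠ 0) (hD : D ≠ 0) (hy : y ≠ 0)
    (B0 B0x B0y B1 B1x B1y K1 K1x K1y L0 L0x L0y L1 L1x L1y : ℝ)
    (e : ((1/2*Y*D^3/(a^2*p^6))*(-2/a-6/p+6*x/D))*(((1 : ℝ)*a^(-2:ℤ)*p^(2:ℤ)*Y^(-1:ℤ)*D^(1:ℤ)*y^(2:ℤ))*B1) + ((1/2*Y*D^3/(a^2*p^6))*(-2*y/Y-6*y/D))*(((2 : ℝ)*a^(-3:ℤ)*p^(1:ℤ)*Y^(0:ℤ)*D^(1:ℤ)*y^(1:ℤ))*B0) - 2*(1/2*Y*D^3/(a^2*p^6))*(((2 : ℝ)*a^(-3:ℤ)*p^(1:ℤ)*Y^(0:ℤ)*D^(1:ℤ)*y^(1:ℤ))*((-(2*y*((0:ℤ):ℝ)/Y)-2*y*((1:ℤ):ℝ)/D+((1:ℤ):ℝ)/y)*B0+B0y))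 + ((1/2*a/(p^3*Y))*(1/a-3/p))*(((1 : ℝ)*a^(-5:ℤ)*p^(-1:ℤ)*Y^(1:ℤ)*D^(3:ℤ)*y^(0:ℤ))*L1) + 3*((1/2*a/(p^3*Y))*(2*y/Y))*(((1 : ℝ)*a^(-7:ℤ)*p^(-3:ℤ)*Y^(2:ℤ)*D^(3:ℤ)*y^(-1:ℤ))*L0) + ((-1/2*p^2/a^2)*(2/p-2/a))*(((1/2 : ℝ)*a^(-3:ℤ)*p^(-7:ℤ)*Y^(0:ℤ)*D^(3:ℤ)*y^(0:ℤ))*K1) = 0) :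
    (-2)*(x-1)*(x+1)*(1-y^2)*(x^2-y^2)*y*B0y + (-2)*(x^2-y^4)*(x-1)*(x+1)*B0 + (-1)*(x^3-2*x^2-4*x*y^2+3*x+2*y^2)*(x-1)*(x+1)*y^2*B1 + K1 + 3*L0 + (-1)*(x-1)*(x+1)*(x-2)*L1 = 0 := by
  have hM : ((1 : ℝ)*a^(-6:ℤ)*p^(-6:ℤ)*Y^(0:ℤ)*D^(3:ℤ)*y^(0:ℤ)) ≠ 0 := by positivity
  apply (mul_eq_zero.mp (?_ : ((1 : ℝ)*a^(-6:ℤ)*p^(-6:ℤ)*Y^(0:ℤ)*D^(3:ℤ)*y^(0:ℤ)) * ((-2)*(x-1)*(x+1)*(1-y^2)*(x^2-y^2)*y*B0y + (-2)*(x^2-y^4)*(x-1)*(x+1)*B0 + (-1)*(x^3-2*x^2-4*x*y^2+3*x+2*y^2)*(x-1)*(x+1)*y^2*B1 + K1 + 3*L0 + (-1)*(x-1)*(x+1)*(x-2)*L1) = 0)).resolve_left hM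
  rw [← e]
  push_cast
  field_simp
  subst ha' hp' hY' hD'
  ring

theorem cv_eA0 (x y a p Y D : ℝ) (ha' : a = x-1) (hp' : p = x+1) (hY' : Y = 1-y^2) (hD' : D = x^2-y^2)
    (ha : a ≠ 0) (hp : p ≠ 0) (hY : Y ≠ 0) (hD : D ≠ 0) (hy : y ≠ 0)
    (A0 A0x A0y A1 A1x A1y K0 K0x K0y K1 K1x K1y : ℝ)
    (e : ((1/2*Y*D^3/(a^2*p^6))*(-2/a-6/p+6*x/D))*(((1/2 : ℝ)*a^(1:ℤ)*p^(-3:ℤ)*Y^(-2:ℤ)*D^(1:ℤ)*y^(2:ℤ))*A1) + ((1/2*Y*D^3/(a^2*p^6))*(-2*y/Y-6*y/D))*(((1/2 : ℝ)*a^(0:ℤ)*p^(-4:ℤ)*Y^(-1:ℤ)*D^(1:ℤ)*y^(1:ℤ))*A0) - 2*(1/2*Y*D^3/(a^2*p^6))*(((1/2 : ℝ)*a^(0:ℤ)*p^(-4:ℤ)*Y^(-1:ℤ)*D^(1:ℤ)*y^(1:ℤ))*((-(2*y*((-1:ℤ):ℝ)/Y)-2*y*((1:ℤ):ℝ)/D+((1:ℤ):ℝ)/y)*A0+A0y))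 + ((1/2*a/(p^3*Y))*(1/a-3/p))*(((1/2 : ℝ)*a^(-3:ℤ)*p^(-7:ℤ)*Y^(0:ℤ)*D^(3:ℤ)*y^(0:ℤ))*K1) + 3*((1/2*a/(p^3*Y))*(2*y/Y))*(((1/2 : ℝ)*a^(-4:ℤ)*p^(-8:ℤ)*Y^(1:ℤ)*D^(3:ℤ)*y^(-1:ℤ))*K0) = 0) :
    (-1)*(x-1)*(x+1)*(1-y^2)*(x^2-y^2)*y*A0y + (-1)*(2*x^2*y^2+x^2-3*y^4)*(x-1)*(x+1)*A0 + (-1)*(x^3-2*x^2-4*x*y^2+3*x+2*y^2)*(x-1)*(x+1)*y^2*A1 + 3*K0 + (-1)*(x-2)*K1 = 0 := by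
  have hM : ((1/2 : ℝ)*a^(-3:ℤ)*p^(-11:ℤ)*Y^(-1:ℤ)*D^(3:ℤ)*y^(0:ℤ)) ≠ 0 := by positivity
  apply (mul_eq_zero.mp (?_ : ((1/2 : ℝ)*a^(-3:ℤ)*p^(-11:ℤ)*Y^(-1:ℤ)*D^(3:ℤ)*y^(0:ℤ)) * ((-1)*(x-1)*(x+1)*(1-y^2)*(x^2-y^2)*y*A0y + (-1)*(2*x^2*y^2+x^2-3*y^4)*(x-1)*(x+1)*A0 + (-1)*(x^3-2*x^2-4*x*y^2+3*x+2*y^2)*(x-1)*(x+1)*y^2*A1 + 3*K0 + (-1)*(x-2)*K1) = 0)).resolve_left hM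
  rw [← e]
  push_cast
  field_simp
  subst ha' hp' hY' hD'
  ring

theorem cv_eA2 (x y a p Y D : ℝ) (ha' : a = x-1) (hp' : p = x+1) (hY' : Y = 1-y^2) (hD' : D = x^2-y^2)
    (ha : a ≠ 0) (hp : p ≠ 0) (hY : Y ≠ 0) (hD : D ≠ 0) (hy : y ≠ 0)
    (A0 A0x A0y A1 A1x A1y K2 K2x K2y K3 K3x K3y : ℝ)
    (e : ((1/2*D^3/(a*p^5))*(-1/a-5/p+6*x/D))*(((1/2 : ℝ)*a^(1:ℤ)*p^(-3:ℤ)*Y^(-2:ℤ)*D^(1:ℤ)*y^(2:ℤ))*A1) + ((1/2*D^3/(a*p^5))*(-6*y/D))*(((1/2 : ℝ)*a^(0:ℤ)*p^(-4:ℤ)*Y^(-1:ℤ)*D^(1:ℤ)*y^(1:ℤ))*A0) - 2*(1/2*D^3/(a*p^5))*(((1/2 : ℝ)*a^(1:ℤ)*p^(-3:ℤ)*Y^(-2:ℤ)*D^(1:ℤ)*y^(2:ℤ))*((((1:ℤ):ℝ)/a+((-3:ℤ):ℝ)/p+2*x*((1:ℤ):ℝ)/D)*A1+A1x)) + 3*((1/2*a/(p^3*Y))*(1/a-3/p))*(((1/4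 : ℝ)*a^(-1:ℤ)*p^(-5:ℤ)*Y^(-1:ℤ)*D^(3:ℤ)*y^(2:ℤ))*K3) + ((1/2*a/(p^3*Y))*(2*y/Y))*(((1/4 : ℝ)*a^(-2:ℤ)*p^(-6:ℤ)*Y^(0:ℤ)*D^(3:ℤ)*y^(1:ℤ))*K2) = 0) :
    (-2)*(x-1)*(x+1)*(x^2-y^2)*A1x + (-6)*(1-y^2)*A0 + (-2)*(2*x^2-x*y^2+x-2*y^2)*A1 + K2 + (-3)*(x-2)*K3 = 0 := by
  have hM : ((1/4 : ℝ)*a^(-1:ℤ)*p^(-9:ℤ)*Y^(-2:ℤ)*D^(3:ℤ)*y^(2:ℤ)) ≠ 0 := by positivity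
  apply (mul_eq_zero.mp (?_ : ((1/4 : ℝ)*a^(-1:ℤ)*p^(-9:ℤ)*Y^(-2:ℤ)*D^(3:ℤ)*y^(2:ℤ)) * ((-2)*(x-1)*(x+1)*(x^2-y^2)*A1x + (-6)*(1-y^2)*A0 + (-2)*(2*x^2-x*y^2+x-2*y^2)*A1 + K2 + (-3)*(x-2)*K3) = 0)).resolve_left hM
  rw [← e]
  push_cast
  field_simp
  subst ha' hp' hY' hD'
  ring

theorem cv_eL0 (x y a p Y D : ℝ) (ha' : a = x-1) (hp' : p = x+1) (hY' : Y = 1-y^2) (hD' : D = x^2-y^2)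
    (ha : a ≠ 0) (hp : p ≠ 0) (hY : Y ≠ 0) (hD : D ≠ 0) (hy : y ≠ 0)
    (J1 J1x J1y L0 L0x L0y L1 L1x L1y : ℝ)
    (e : ((1/2*Y*D^3/(a^2*p^6))*(-2/a-6/p+6*x/D))*(((1 : ℝ)*a^(-5:ℤ)*p^(-1:ℤ)*Y^(1:ℤ)*D^(3:ℤ)*y^(0:ℤ))*L1) + 3*((1/2*Y*D^3/(a^2*p^6))*(-2*y/Y-6*y/D))*(((1 : ℝ)*a^(-7:ℤ)*p^(-3:ℤ)*Y^(2:ℤ)*D^(3:ℤ)*y^(-1:ℤ))*L0) - 2*(1/2*Y*D^3/(a^2*p^6))*(((1 : ℝ)*a^(-7:ℤ)*p^(-3:ℤ)*Y^(2:ℤ)*D^(3:ℤ)*y^(-1:ℤ))*((-(2*y*((2:ℤ):ℝ)/Y)-2*y*((3:ℤ):ℝ)/D+((-1:ℤ):ℝ)/y)*L0+L0y)) + ((-1/2*p^2/a^2)*(2/p-2/a))*(((1/2 : ℝ)*a^(-6:ℤ)*p^(-10:ℤ)*Y^(2:ℤ)*D^(6:ℤ)*y^(-2:ℤ))*J1)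 = 0) :
    (-1)*(1-y^2)*(x^2-y^2)*y*L0y + (x^2-y^2)*J1 + (x^2+3*y^4-4*y^2)*L0 + (-1)*(x^3-2*x^2-4*x*y^2+3*x+2*y^2)*(x-1)*(x+1)*y^2*L1 = 0 := by
  have hM : ((1 : ℝ)*a^(-9:ℤ)*p^(-9:ℤ)*Y^(2:ℤ)*D^(5:ℤ)*y^(-2:ℤ)) ≠ 0 := by positivity
  apply (mul_eq_zero.mp (?_ : ((1 : ℝ)*a^(-9:ℤ)*p^(-9:ℤ)*Y^(2:ℤ)*D^(5:ℤ)*y^(-2:ℤ)) * ((-1)*(1-y^2)*(x^2-y^2)*y*L0y + (x^2-y^2)*J1 + (x^2+3*y^4-4*y^2)*L0 + (-1)*(x^3-2*x^2-4*x*y^2+3*x+2*y^2)*(x-1)*(x+1)*y^2*L1) = 0)).resolve_left hM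
  rw [← e]
  push_cast
  field_simp
  subst ha' hp' hY' hD'
  ring

theorem cv_eL1 (x y a p Y D : ℝ) (ha' : a = x-1) (hp' : p = x+1) (hY' : Y = 1-y^2) (hD' : D = x^2-y^2)
    (ha : a ≠ 0) (hp : p ≠ 0) (hY : Y ≠ 0) (hD : D ≠ 0) (hy : y ≠ 0)
    (J2 J2x J2y L0 L0x L0y L1 L1x L1y L2 L2x L2y : ℝ)
    (e : 2*((1/2*Y*D^3/(a^2*p^6))*(-2/a-6/p+6*x/D))*(((1/2 : ℝ)*a^(-5:ℤ)*p^(-1:ℤ)*Y^(1:ℤ)*D^(3:ℤ)*y^(1:ℤ))*L2) + 2*((1/2*Y*D^3/(a^2*p^6))*(-2*y/Y-6*y/D))*(((1 : ℝ)*a^(-5:ℤ)*p^(-1:ℤ)*Y^(1:ℤ)*D^(3:ℤ)*y^(0:ℤ))*L1) - 2*(1/2*D^3/(a*p^5))*(((1 : ℝ)*a^(-7:ℤ)*p^(-3:ℤ)*Y^(2:ℤ)*D^(3:ℤ)*y^(-1:ℤ))*((((-7:ℤ):ℝ)/a+((-3:ℤ):ℝ)/p+2*x*((3:ℤ):ℝ)/D)*L0+L0x))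 - 2*(1/2*Y*D^3/(a^2*p^6))*(((1 : ℝ)*a^(-5:ℤ)*p^(-1:ℤ)*Y^(1:ℤ)*D^(3:ℤ)*y^(0:ℤ))*((-(2*y*((1:ℤ):ℝ)/Y)-2*y*((3:ℤ):ℝ)/D+((0:ℤ):ℝ)/y)*L1+L1y)) + 2*((-1/2*p^2/a^2)*(2/p-2/a))*(((1/4 : ℝ)*a^(-6:ℤ)*p^(-10:ℤ)*Y^(2:ℤ)*D^(6:ℤ)*y^(-1:ℤ))*J2) = 0) :
    (-1)*(x-1)*(x+1)*(x^2-y^2)*L0x + (-1)*(x-1)^2*(x+1)^2*(x^2-y^2)*y*L1y + (x^2-y^2)*J2 + 2*(2*x^3+2*x^2-5*x*y^2+3*x-2*y^2)*L0 + (-1)*(x^3-2*x^2-4*x*y^2+3*x+2*y^2)*(x-1)*(x+1)*y^2*L2 = 0 := by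
  have hM : ((1 : ℝ)*a^(-9:ℤ)*p^(-9:ℤ)*Y^(2:ℤ)*D^(5:ℤ)*y^(-1:ℤ)) ≠ 0 := by positivity
  apply (mul_eq_zero.mp (?_ : ((1 : ℝ)*a^(-9:ℤ)*p^(-9:ℤ)*Y^(2:ℤ)*D^(5:ℤ)*y^(-1:ℤ)) * ((-1)*(x-1)*(x+1)*(x^2-y^2)*L0x + (-1)*(x-1)^2*(x+1)^2*(x^2-y^2)*y*L1y + (x^2-y^2)*J2 + 2*(2*x^3+2*x^2-5*x*y^2+3*x-2*y^2)*L0 + (-1)*(x^3-2*x^2-4*x*y^2+3*x+2*y^2)*(x-1)*(x+1)*y^2*L2) = 0)).resolve_left hM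
  rw [← e]
  push_cast
  field_simp
  subst ha' hp' hY' hD'
  ring

theorem cv_eL2 (x y a p Y D : ℝ) (ha' : a = x-1) (hp' : p = x+1) (hY' : Y = 1-y^2) (hD' : D = x^2-y^2)
    (ha : a ≠ 0) (hp : p ≠ 0) (hY : Y ≠ 0) (hD : D ≠ 0) (hy : y ≠ 0)
    (J3 J3x J3y L0 L0x L0y L1 L1x L1y L2 L2x L2y L3 L3x L3y : ℝ)
    (e : ((1/2*D^3/(a*p^5))*(-1/a-5/p+6*x/D))*(((1 : ℝ)*a^(-5:ℤ)*p^(-1:ℤ)*Y^(1:ℤ)*D^(3:ℤ)*y^(0:ℤ))*L1) + 3*((1/2*Y*D^3/(a^2*p^6))*(-2/a-6/p+6*x/D))*(((1 : ℝ)*a^(-4:ℤ)*p^(0:ℤ)*Y^(1:ℤ)*D^(3:ℤ)*y^(2:ℤ))*L3) + 3*((1/2*D^3/(a*p^5))*(-6*y/D))*(((1 : ℝ)*a^(-7:ℤ)*p^(-3:ℤ)*Y^(2:ℤ)*D^(3:ℤ)*y^(-1:ℤ))*L0) + ((1/2*Y*D^3/(a^2*p^6))*(-2*y/Y-6*y/D))*(((1/2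 : ℝ)*a^(-5:ℤ)*p^(-1:ℤ)*Y^(1:ℤ)*D^(3:ℤ)*y^(1:ℤ))*L2) - 2*(1/2*D^3/(a*p^5))*(((1 : ℝ)*a^(-5:ℤ)*p^(-1:ℤ)*Y^(1:ℤ)*D^(3:ℤ)*y^(0:ℤ))*((((-5:ℤ):ℝ)/a+((-1:ℤ):ℝ)/p+2*x*((3:ℤ):ℝ)/D)*L1+L1x)) - 2*(1/2*Y*D^3/(a^2*p^6))*(((1/2 : ℝ)*a^(-5:ℤ)*p^(-1:ℤ)*Y^(1:ℤ)*D^(3:ℤ)*y^(1:ℤ))*((-(2*y*((1:ℤ):ℝ)/Y)-2*y*((3:ℤ):ℝ)/D+((1:ℤ):ℝ)/y)*L2+L2y)) + 3*((-1/2*p^2/a^2)*(2/p-2/a))*(((1/4 : ℝ)*a^(-5:ℤ)*p^(-9:ℤ)*Y^(1:ℤ)*D^(6:ℤ)*y^(0:ℤ))*J3) = 0) :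
    (-2)*(x-1)^2*(x+1)^2*(x^2-y^2)*L1x + (-1)*(x-1)*(x+1)*(1-y^2)*(x^2-y^2)*y*L2y + 3*(x^2-y^2)*J3 + (-18)*(1-y^2)*L0 + 6*(2*x^2-x*y^2+x-2*y^2)*(x-1)*(x+1)*L1 + (2*x^2*y^2-x^2-5*y^4+4*y^2)*(x-1)*(x+1)*L2 + (-6)*(x^3-2*x^2-4*x*y^2+3*x+2*y^2)*(x-1)*(x+1)*(1-y^2)*y^2*L3 = 0 := by
  have hM : ((1/2 : ℝ)*a^(-8:ℤ)*p^(-8:ℤ)*Y^(1:ℤ)*D^(5:ℤ)*y^(0:ℤ)) ≠ 0 := by positivity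
  apply (mul_eq_zero.mp (?_ : ((1/2 : ℝ)*a^(-8:ℤ)*p^(-8:ℤ)*Y^(1:ℤ)*D^(5:ℤ)*y^(0:ℤ)) * ((-2)*(x-1)^2*(x+1)^2*(x^2-y^2)*L1x + (-1)*(x-1)*(x+1)*(1-y^2)*(x^2-y^2)*y*L2y + 3*(x^2-y^2)*J3 + (-18)*(1-y^2)*L0 + 6*(2*x^2-x*y^2+x-2*y^2)*(x-1)*(x+1)*L1 + (2*x^2*y^2-x^2-5*y^4+4*y^2)*(x-1)*(x+1)*L2 + (-6)*(x^3-2*x^2-4*x*y^2+3*x+2*y^2)*(x-1)*(x+1)*(1-y^2)*y^2*L3) = 0)).resolve_left hM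
  rw [← e]
  push_cast
  field_simp
  subst ha' hp' hY' hD'
  ring

theorem cv_eL3 (x y a p Y D : ℝ) (ha' : a = x-1) (hp' : p = x+1) (hY' : Y = 1-y^2) (hD' : D = x^2-y^2)
    (ha : a ≠ 0) (hp : p ≠ 0) (hY : Y ≠ 0) (hD : D ≠ 0) (hy : y ≠ 0)
    (J4 J4x J4y L1 L1x L1y L2 L2x L2y L3 L3x L3y : ℝ)
    (e : 2*((1/2*D^3/(a*p^5))*(-1/a-5/p+6*x/D))*(((1/2 : ℝ)*a^(-5:ℤ)*p^(-1:ℤ)*Y^(1:ℤ)*D^(3:ℤ)*y^(1:ℤ))*L2) + 2*((1/2*D^3/(a*p^5))*(-6*y/D))*(((1 : ℝ)*a^(-5:ℤ)*p^(-1:ℤ)*Y^(1:ℤ)*D^(3:ℤ)*y^(0:ℤ))*L1) - 2*(1/2*D^3/(a*p^5))*(((1/2 : ℝ)*a^(-5:ℤ)*p^(-1:ℤ)*Y^(1:ℤ)*D^(3:ℤ)*y^(1:ℤ))*((((-5:ℤ):ℝ)/a+((-1:ℤ):ℝ)/p+2*x*((3:ℤ):ℝ)/D)*L2+L2x)) -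 2*(1/2*Y*D^3/(a^2*p^6))*(((1 : ℝ)*a^(-4:ℤ)*p^(0:ℤ)*Y^(1:ℤ)*D^(3:ℤ)*y^(2:ℤ))*((-(2*y*((1:ℤ):ℝ)/Y)-2*y*((3:ℤ):ℝ)/D+((2:ℤ):ℝ)/y)*L3+L3y)) + 4*((-1/2*p^2/a^2)*(2/p-2/a))*(((1/16 : ℝ)*a^(-4:ℤ)*p^(-8:ℤ)*Y^(1:ℤ)*D^(6:ℤ)*y^(1:ℤ))*J4) = 0) :
    (-1)*(x-1)*(x+1)*(x^2-y^2)*L2x + (-2)*(x-1)*(x+1)*(1-y^2)*(x^2-y^2)*y*L3y + (x^2-y^2)*J4 + (-12)*(x-1)*(x+1)*L1 + 8*(x^2-y^2)*L2 + 4*(2*x^2*y^2-x^2-5*y^4+4*y^2)*(x-1)*(x+1)*L3 = 0 := by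
  have hM : ((1/2 : ℝ)*a^(-7:ℤ)*p^(-7:ℤ)*Y^(1:ℤ)*D^(5:ℤ)*y^(1:ℤ)) ≠ 0 := by positivity
  apply (mul_eq_zero.mp (?_ : ((1/2 : ℝ)*a^(-7:ℤ)*p^(-7:ℤ)*Y^(1:ℤ)*D^(5:ℤ)*y^(1:ℤ)) * ((-1)*(x-1)*(x+1)*(x^2-y^2)*L2x + (-2)*(x-1)*(x+1)*(1-y^2)*(x^2-y^2)*y*L3y + (x^2-y^2)*J4 + (-12)*(x-1)*(x+1)*L1 + 8*(x^2-y^2)*L2 + 4*(2*x^2*y^2-x^2-5*y^4+4*y^2)*(x-1)*(x+1)*L3) = 0)).resolve_left hM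
  rw [← e]
  push_cast
  field_simp
  subst ha' hp' hY' hD'
  ring

theorem cv_eL4 (x y a p Y D : ℝ) (ha' : a = x-1) (hp' : p = x+1) (hY' : Y = 1-y^2) (hD' : D = x^2-y^2)
    (ha : a ≠ 0) (hp : p ≠ 0) (hY : Y ≠ 0) (hD : D ≠ 0) (hy : y ≠ 0)
    (J5 J5x J5y L2 L2x L2y L3 L3x L3y : ℝ)
    (e : 3*((1/2*D^3/(a*p^5))*(-1/a-5/p+6*x/D))*(((1 : ℝ)*a^(-4:ℤ)*p^(0:ℤ)*Y^(1:ℤ)*D^(3:ℤ)*y^(2:ℤ))*L3) + ((1/2*D^3/(a*p^5))*(-6*y/D))*(((1/2 : ℝ)*a^(-5:ℤ)*p^(-1:ℤ)*Y^(1:ℤ)*D^(3:ℤ)*y^(1:ℤ))*L2) - 2*(1/2*D^3/(a*p^5))*(((1 : ℝ)*a^(-4:ℤ)*p^(0:ℤ)*Y^(1:ℤ)*D^(3:ℤ)*y^(2:ℤ))*((((-4:ℤ):ℝ)/a+((0:ℤ):ℝ)/p+2*x*((3:ℤ):ℝ)/D)*L3+L3x)) + 5*((-1/2*p^2/a^2)*(2/p-2/a))*(((1/20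 : ℝ)*a^(-3:ℤ)*p^(-7:ℤ)*Y^(1:ℤ)*D^(6:ℤ)*y^(2:ℤ))*J5) = 0) :
    (-2)*(x-1)*(x+1)*(x^2-y^2)*L3x + (x^2-y^2)*J5 + (-3)*L2 + (-2)*(2*x^3-10*x^2-5*x*y^2+3*x+10*y^2)*L3 = 0 := by
  have hM : ((1/2 : ℝ)*a^(-6:ℤ)*p^(-6:ℤ)*Y^(1:ℤ)*D^(5:ℤ)*y^(2:ℤ)) ≠ 0 := by positivity
  apply (mul_eq_zero.mp (?_ : ((1/2 : ℝ)*a^(-6:ℤ)*p^(-6:ℤ)*Y^(1:ℤ)*D^(5:ℤ)*y^(2:ℤ)) * ((-2)*(x-1)*(x+1)*(x^2-y^2)*L3x + (x^2-y^2)*J5 + (-3)*L2 + (-2)*(2*x^3-10*x^2-5*x*y^2+3*x+10*y^2)*L3) = 0)).resolve_left hM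
  rw [← e]
  push_cast
  field_simp
  subst ha' hp' hY' hD'
  ring

theorem cv_eK0 (x y a p Y D : ℝ) (ha' : a = x-1) (hp' : p = x+1) (hY' : Y = 1-y^2) (hD' : D = x^2-y^2)
    (ha : a ≠ 0) (hp : p ≠ 0) (hY : Y ≠ 0) (hD : D ≠ 0) (hy : y ≠ 0)
    (J0 J0x J0y J1 J1x J1y K0 K0x K0y K1 K1x K1y : ℝ)
    (e : ((1/2*Y*D^3/(a^2*p^6))*(-2/a-6/p+6*x/D))*(((1/2 : ℝ)*a^(-3:ℤ)*p^(-7:ℤ)*Y^(0:ℤ)*D^(3:ℤ)*y^(0:ℤ))*K1) + 3*((1/2*Y*D^3/(a^2*p^6))*(-2*y/Y-6*y/D))*(((1/2 : ℝ)*a^(-4:ℤ)*p^(-8:ℤ)*Y^(1:ℤ)*D^(3:ℤ)*y^(-1:ℤ))*K0) - 2*(1/2*Y*D^3/(a^2*p^6))*(((1/2 : ℝ)*a^(-4:ℤ)*p^(-8:ℤ)*Y^(1:ℤ)*D^(3:ℤ)*y^(-1:ℤ))*((-(2*y*((1:ℤ):ℝ)/Y)-2*y*((3:ℤ):ℝ)/D+((-1:ℤ):ℝ)/y)*K0+K0y))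 + ((1/2*a/(p^3*Y))*(1/a-3/p))*(((1/2 : ℝ)*a^(-6:ℤ)*p^(-10:ℤ)*Y^(2:ℤ)*D^(6:ℤ)*y^(-2:ℤ))*J1) + 5*((1/2*a/(p^3*Y))*(2*y/Y))*(((1/10 : ℝ)*a^(-7:ℤ)*p^(-11:ℤ)*Y^(3:ℤ)*D^(6:ℤ)*y^(-1:ℤ))*J0) = 0) :
    (-1)*(1-y^2)*(x^2-y^2)*y*K0y + (x^2-y^2)*y^2*J0 + (-1)*(x^2-y^2)*(x-2)*J1 + (-1)*(2*x^2*y^2-x^2-5*y^4+4*y^2)*K0 + (-1)*(x^3-2*x^2-4*x*y^2+3*x+2*y^2)*y^2*K1 = 0 := by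
  have hM : ((1/2 : ℝ)*a^(-6:ℤ)*p^(-14:ℤ)*Y^(1:ℤ)*D^(5:ℤ)*y^(-2:ℤ)) ≠ 0 := by positivity
  apply (mul_eq_zero.mp (?_ : ((1/2 : ℝ)*a^(-6:ℤ)*p^(-14:ℤ)*Y^(1:ℤ)*D^(5:ℤ)*y^(-2:ℤ)) * ((-1)*(1-y^2)*(x^2-y^2)*y*K0y + (x^2-y^2)*y^2*J0 + (-1)*(x^2-y^2)*(x-2)*J1 + (-1)*(2*x^2*y^2-x^2-5*y^4+4*y^2)*K0 + (-1)*(x^3-2*x^2-4*x*y^2+3*x+2*y^2)*y^2*K1) = 0)).resolve_left hM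
  rw [← e]
  push_cast
  field_simp
  subst ha' hp' hY' hD'
  ring

theorem cv_eK1 (x y a p Y D : ℝ) (ha' : a = x-1) (hp' : p = x+1) (hY' : Y = 1-y^2) (hD' : D = x^2-y^2)
    (ha : a ≠ 0) (hp : p ≠ 0) (hY : Y ≠ 0) (hD : D ≠ 0) (hy : y ≠ 0)
    (J1 J1x J1y J2 J2x J2y K0 K0x K0y K1 K1x K1y K2 K2x K2y : ℝ)
    (e : 2*((1/2*Y*D^3/(a^2*p^6))*(-2/a-6/p+6*x/D))*(((1/4 : ℝ)*a^(-2:ℤ)*p^(-6:ℤ)*Y^(0:ℤ)*D^(3:ℤ)*y^(1:ℤ))*K2) + 2*((1/2*Y*D^3/(a^2*p^6))*(-2*y/Y-6*y/D))*(((1/2 : ℝ)*a^(-3:ℤ)*p^(-7:ℤ)*Y^(0:ℤ)*D^(3:ℤ)*y^(0:ℤ))*K1) - 2*(1/2*D^3/(a*p^5))*(((1/2 : ℝ)*a^(-4:ℤ)*p^(-8:ℤ)*Y^(1:ℤ)*D^(3:ℤ)*y^(-1:ℤ))*((((-4:ℤ):ℝ)/a+((-8:ℤ):ℝ)/p+2*x*((3:ℤ):ℝ)/D)*K0+K0x))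 - 2*(1/2*Y*D^3/(a^2*p^6))*(((1/2 : ℝ)*a^(-3:ℤ)*p^(-7:ℤ)*Y^(0:ℤ)*D^(3:ℤ)*y^(0:ℤ))*((-(2*y*((0:ℤ):ℝ)/Y)-2*y*((3:ℤ):ℝ)/D+((0:ℤ):ℝ)/y)*K1+K1y)) + 2*((1/2*a/(p^3*Y))*(1/a-3/p))*(((1/4 : ℝ)*a^(-6:ℤ)*p^(-10:ℤ)*Y^(2:ℤ)*D^(6:ℤ)*y^(-1:ℤ))*J2) + 4*((1/2*a/(p^3*Y))*(2*y/Y))*(((1/2 : ℝ)*a^(-6:ℤ)*p^(-10:ℤ)*Y^(2:ℤ)*D^(6:ℤ)*y^(-2:ℤ))*J1) = 0) :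
    (-1)*(x-1)*(x+1)*(1-y^2)*(x^2-y^2)*K0x + (-1)*(x-1)*(x+1)*(1-y^2)*(x^2-y^2)*y*K1y + 4*(x-1)*(x+1)*(x^2-y^2)*J1 + (-1)*(1-y^2)*(x^2-y^2)*(x-2)*J2 + 2*(3*x^3-2*x^2-6*x*y^2+3*x+2*y^2)*(1-y^2)*K0 + (-2)*(x-1)*(x+1)*(x^2-y^2)*y^2*K1 + (-1)*(x^3-2*x^2-4*x*y^2+3*x+2*y^2)*(x-1)*(x+1)*(1-y^2)*y^2*K2 = 0 := by
  have hM : ((1/2 : ℝ)*a^(-6:ℤ)*p^(-14:ℤ)*Y^(0:ℤ)*D^(5:ℤ)*y^(-1:ℤ)) ≠ 0 := by positivity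
  apply (mul_eq_zero.mp (?_ : ((1/2 : ℝ)*a^(-6:ℤ)*p^(-14:ℤ)*Y^(0:ℤ)*D^(5:ℤ)*y^(-1:ℤ)) * ((-1)*(x-1)*(x+1)*(1-y^2)*(x^2-y^2)*K0x + (-1)*(x-1)*(x+1)*(1-y^2)*(x^2-y^2)*y*K1y + 4*(x-1)*(x+1)*(x^2-y^2)*J1 + (-1)*(1-y^2)*(x^2-y^2)*(x-2)*J2 + 2*(3*x^3-2*x^2-6*x*y^2+3*x+2*y^2)*(1-y^2)*K0 + (-2)*(x-1)*(x+1)*(x^2-y^2)*y^2*K1 + (-1)*(x^3-2*x^2-4*x*y^2+3*x+2*y^2)*(x-1)*(x+1)*(1-y^2)*y^2*K2) = 0)).resolve_left hM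
  rw [← e]
  push_cast
  field_simp
  subst ha' hp' hY' hD'
  ring

theorem cv_eK3 (x y a p Y D : ℝ) (ha' : a = x-1) (hp' : p = x+1) (hY' : Y = 1-y^2) (hD' : D = x^2-y^2)
    (ha : a ≠ 0) (hp : p ≠ 0) (hY : Y ≠ 0) (hD : D ≠ 0) (hy : y ≠ 0)
    (J3 J3x J3y J4 J4x J4y K1 K1x K1y K2 K2x K2y K3 K3x K3y : ℝ)
    (e : 2*((1/2*D^3/(a*p^5))*(-1/a-5/p+6*x/D))*(((1/4 : ℝ)*a^(-2:ℤ)*p^(-6:ℤ)*Y^(0:ℤ)*D^(3:ℤ)*y^(1:ℤ))*K2) + 2*((1/2*D^3/(a*p^5))*(-6*y/D))*(((1/2 : ℝ)*a^(-3:ℤ)*p^(-7:ℤ)*Y^(0:ℤ)*D^(3:ℤ)*y^(0:ℤ))*K1) - 2*(1/2*D^3/(a*p^5))*(((1/4 : ℝ)*a^(-2:ℤ)*p^(-6:ℤ)*Y^(0:ℤ)*D^(3:ℤ)*y^(1:ℤ))*((((-2:ℤ):ℝ)/a+((-6:ℤ):ℝ)/p+2*x*((3:ℤ):ℝ)/D)*K2+K2x))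 - 2*(1/2*Y*D^3/(a^2*p^6))*(((1/4 : ℝ)*a^(-1:ℤ)*p^(-5:ℤ)*Y^(-1:ℤ)*D^(3:ℤ)*y^(2:ℤ))*((-(2*y*((-1:ℤ):ℝ)/Y)-2*y*((3:ℤ):ℝ)/D+((2:ℤ):ℝ)/y)*K3+K3y)) + 4*((1/2*a/(p^3*Y))*(1/a-3/p))*(((1/16 : ℝ)*a^(-4:ℤ)*p^(-8:ℤ)*Y^(1:ℤ)*D^(6:ℤ)*y^(1:ℤ))*J4) + 2*((1/2*a/(p^3*Y))*(2*y/Y))*(((1/4 : ℝ)*a^(-5:ℤ)*p^(-9:ℤ)*Y^(1:ℤ)*D^(6:ℤ)*y^(0:ℤ))*J3) = 0) :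
    (-1)*(x-1)*(x+1)*(1-y^2)*(x^2-y^2)*K2x + (-1)*(x-1)*(x+1)*(1-y^2)*(x^2-y^2)*y*K3y + 2*(x^2-y^2)*J3 + (-1)*(1-y^2)*(x^2-y^2)*(x-2)*J4 + (-12)*(1-y^2)*K1 + 2*(1-y^2)*(x^2-y^2)*x*K2 + (-2)*(x^2+3*y^4-4*y^2)*(x-1)*(x+1)*K3 = 0 := by
  have hM : ((1/4 : ℝ)*a^(-4:ℤ)*p^(-12:ℤ)*Y^(-1:ℤ)*D^(5:ℤ)*y^(1:ℤ)) ≠ 0 := by positivity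
  apply (mul_eq_zero.mp (?_ : ((1/4 : ℝ)*a^(-4:ℤ)*p^(-12:ℤ)*Y^(-1:ℤ)*D^(5:ℤ)*y^(1:ℤ)) * ((-1)*(x-1)*(x+1)*(1-y^2)*(x^2-y^2)*K2x + (-1)*(x-1)*(x+1)*(1-y^2)*(x^2-y^2)*y*K3y + 2*(x^2-y^2)*J3 + (-1)*(1-y^2)*(x^2-y^2)*(x-2)*J4 + (-12)*(1-y^2)*K1 + 2*(1-y^2)*(x^2-y^2)*x*K2 + (-2)*(x^2+3*y^4-4*y^2)*(x-1)*(x+1)*K3) = 0)).resolve_left hM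
  rw [← e]
  push_cast
  field_simp
  subst ha' hp' hY' hD'
  ring

theorem cv_eK4 (x y a p Y D : ℝ) (ha' : a = x-1) (hp' : p = x+1) (hY' : Y = 1-y^2) (hD' : D = x^2-y^2)
    (ha : a ≠ 0) (hp : p ≠ 0) (hY : Y ≠ 0) (hD : D ≠ 0) (hy : y ≠ 0)
    (J4 J4x J4y J5 J5x J5y K2 K2x K2y K3 K3x K3y : ℝ)
    (e : 3*((1/2*D^3/(a*p^5))*(-1/a-5/p+6*x/D))*(((1/4 : ℝ)*a^(-1:ℤ)*p^(-5:ℤ)*Y^(-1:ℤ)*D^(3:ℤ)*y^(2:ℤ))*K3) + ((1/2*D^3/(a*p^5))*(-6*y/D))*(((1/4 : ℝ)*a^(-2:ℤ)*p^(-6:ℤ)*Y^(0:ℤ)*D^(3:ℤ)*y^(1:ℤ))*K2) - 2*(1/2*D^3/(a*p^5))*(((1/4 : ℝ)*a^(-1:ℤ)*p^(-5:ℤ)*Y^(-1:ℤ)*D^(3:ℤ)*y^(2:ℤ))*((((-1:ℤ):ℝ)/a+((-5:ℤ):ℝ)/p+2*x*((3:ℤ):ℝ)/D)*K3+K3x))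 + 5*((1/2*a/(p^3*Y))*(1/a-3/p))*(((1/20 : ℝ)*a^(-3:ℤ)*p^(-7:ℤ)*Y^(1:ℤ)*D^(6:ℤ)*y^(2:ℤ))*J5) + ((1/2*a/(p^3*Y))*(2*y/Y))*(((1/16 : ℝ)*a^(-4:ℤ)*p^(-8:ℤ)*Y^(1:ℤ)*D^(6:ℤ)*y^(1:ℤ))*J4) = 0) :
    (-4)*(x-1)*(x+1)*(x^2-y^2)*K3x + (x^2-y^2)*J4 + (-4)*(1-y^2)*(x^2-y^2)*(x-2)*J5 + (-12)*(1-y^2)*K2 + 4*(2*x^2+3*x*y^2-3*x-2*y^2)*K3 = 0 := by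
  have hM : ((1/16 : ℝ)*a^(-3:ℤ)*p^(-11:ℤ)*Y^(-1:ℤ)*D^(5:ℤ)*y^(2:ℤ)) ≠ 0 := by positivity
  apply (mul_eq_zero.mp (?_ : ((1/16 : ℝ)*a^(-3:ℤ)*p^(-11:ℤ)*Y^(-1:ℤ)*D^(5:ℤ)*y^(2:ℤ)) * ((-4)*(x-1)*(x+1)*(x^2-y^2)*K3x + (x^2-y^2)*J4 + (-4)*(1-y^2)*(x^2-y^2)*(x-2)*J5 + (-12)*(1-y^2)*K2 + 4*(2*x^2+3*x*y^2-3*x-2*y^2)*K3) = 0)).resolve_left hM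
  rw [← e]
  push_cast
  field_simp
  subst ha' hp' hY' hD'
  ring

theorem cv_eJ0 (x y a p Y D : ℝ) (ha' : a = x-1) (hp' : p = x+1) (hY' : Y = 1-y^2) (hD' : D = x^2-y^2)
    (ha : a ≠ 0) (hp : p ≠ 0) (hY : Y ≠ 0) (hD : D ≠ 0) (hy : y ≠ 0)
    (J0 J0x J0y J1 J1x J1y : ℝ)
    (e : ((1/2*Y*D^3/(a^2*p^6))*(-2/a-6/p+6*x/D))*(((1/2 : ℝ)*a^(-6:ℤ)*p^(-10:ℤ)*Y^(2:ℤ)*D^(6:ℤ)*y^(-2:ℤ))*J1) + 5*((1/2*Y*D^3/(a^2*p^6))*(-2*y/Y-6*y/D))*(((1/10 : ℝ)*a^(-7:ℤ)*p^(-11:ℤ)*Y^(3:ℤ)*D^(6:ℤ)*y^(-1:ℤ))*J0) - 2*(1/2*Y*D^3/(a^2*p^6))*(((1/10 : ℝ)*a^(-7:ℤ)*p^(-11:ℤ)*Y^(3:ℤ)*D^(6:ℤ)*y^(-1:ℤ))*((-(2*y*((3:ℤ):ℝ)/Y)-2*y*((6:ℤ):ℝ)/D+((-1:ℤ):ℝ)/y)*J0+J0y))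 = 0) :
    (-1)*(1-y^2)*(x^2-y^2)*y*J0y + (x^2+3*y^4-4*y^2)*J0 + (-5)*(x^3-2*x^2-4*x*y^2+3*x+2*y^2)*J1 = 0 := by
  have hM : ((1/10 : ℝ)*a^(-9:ℤ)*p^(-17:ℤ)*Y^(3:ℤ)*D^(8:ℤ)*y^(-2:ℤ)) ≠ 0 := by positivity
  apply (mul_eq_zero.mp (?_ : ((1/10 : ℝ)*a^(-9:ℤ)*p^(-17:ℤ)*Y^(3:ℤ)*D^(8:ℤ)*y^(-2:ℤ)) * ((-1)*(1-y^2)*(x^2-y^2)*y*J0y + (x^2+3*y^4-4*y^2)*J0 + (-5)*(x^3-2*x^2-4*x*y^2+3*x+2*y^2)*J1) = 0)).resolve_left hM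
  rw [← e]
  push_cast
  field_simp
  subst ha' hp' hY' hD'
  ring

theorem cv_eJ6 (x y a p Y D : ℝ) (ha' : a = x-1) (hp' : p = x+1) (hY' : Y = 1-y^2) (hD' : D = x^2-y^2)
    (ha : a ≠ 0) (hp : p ≠ 0) (hY : Y ≠ 0) (hD : D ≠ 0) (hy : y ≠ 0)
    (J4 J4x J4y J5 J5x J5y : ℝ)
    (e : 5*((1/2*D^3/(a*p^5))*(-1/a-5/p+6*x/D))*(((1/20 : ℝ)*a^(-3:ℤ)*p^(-7:ℤ)*Y^(1:ℤ)*D^(6:ℤ)*y^(2:ℤ))*J5) + ((1/2*D^3/(a*p^5))*(-6*y/D))*(((1/16 : ℝ)*a^(-4:ℤ)*p^(-8:ℤ)*Y^(1:ℤ)*D^(6:ℤ)*y^(1:ℤ))*J4) - 2*(1/2*D^3/(a*p^5))*(((1/20 : ℝ)*a^(-3:ℤ)*p^(-7:ℤ)*Y^(1:ℤ)*D^(6:ℤ)*y^(2:ℤ))*((((-3:ℤ):ℝ)/a+((-7:ℤ):ℝ)/p+2*x*((6:ℤ):ℝ)/D)*J5+J5x)) = 0) :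
    (-4)*(x-1)*(x+1)*(x^2-y^2)*J5x + (-15)*J4 + (-4)*(2*x^3-6*x^2-5*x*y^2+3*x+6*y^2)*J5 = 0 := by
  have hM : ((1/80 : ℝ)*a^(-5:ℤ)*p^(-13:ℤ)*Y^(1:ℤ)*D^(8:ℤ)*y^(2:ℤ)) ≠ 0 := by positivity
  apply (mul_eq_zero.mp (?_ : ((1/80 : ℝ)*a^(-5:ℤ)*p^(-13:ℤ)*Y^(1:ℤ)*D^(8:ℤ)*y^(2:ℤ)) * ((-4)*(x-1)*(x+1)*(x^2-y^2)*J5x + (-15)*J4 + (-4)*(2*x^3-6*x^2-5*x*y^2+3*x+6*y^2)*J5) = 0)).resolve_left hM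
  rw [← e]
  push_cast
  field_simp
  subst ha' hp' hY' hD'
  ring


set_option maxRecDepth 10000 in
theorem DeltaP_map {R S : Type*} [CommRing R] [CommRing S] (f : R →+* S) (x y : R) : f (DeltaP x y) = DeltaP (f x) (f y) := by
  simp only [DeltaP, m11, m12, m13, m21, m22, m23, m31, m32, m33, map_add, map_mul, map_sub, map_pow, map_neg, map_ofNat, map_one]

set_option maxHeartbeats 4000000 in
theorem familyLem {V : TopologicalSpace.Opens (ℝ × ℝ)} (hV : ∀ v : V, Good v) (hx : ∀ v : V, (v : ℝ × ℝ).1 ≠ 0)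
    (hDel : ∀ v : V, DeltaP (v : ℝ × ℝ).1 (v : ℝ × ℝ).2 ≠ 0)
    (cJ cK cL cA cB cC : ℕ → ℝ × ℝ → ℝ)
    (sJ : ∀ i, ContDiffOn ℝ (⊤ : ℕ∞) (cJ i) V)
    (sK : ∀ i, ContDiffOn ℝ (⊤ : ℕ∞) (cK i) V)
    (sL : ∀ i, ContDiffOn ℝ (⊤ : ℕ∞) (cL i) V)
    (sA : ∀ i, ContDiffOn ℝ (⊤ : ℕ∞) (cA i) V)
    (sB : ∀ i, ContDiffOn ℝ (⊤ : ℕ∞) (cB i) V)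
    (sC : ∀ i, ContDiffOn ℝ (⊤ : ℕ∞) (cC i) V)
    (hE : ∀ v ∈ V, EqsP (gh1 v.1 v.2) (gh1x v.1 v.2) (gh1y v.1 v.2) (gh2 v.1 v.2) (gh2x v.1 v.2) (gh2y v.1 v.2) (gfx v.1 v.2) (gfy v.1 v.2) (gtx v.1 v.2)
      (fun i => cJ i v) (fun i => fderiv ℝ (cJ i) v (1, 0)) (fun i => fderiv ℝ (cJ i) v (0, 1))
      (fun i => cK i v) (fun i => fderiv ℝ (cK i) v (1, 0)) (fun i => fderiv ℝ (cK i) v (0, 1))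
      (fun i => cL i v) (fun i => fderiv ℝ (cL i) v (1, 0)) (fun i => fderiv ℝ (cL i) v (0, 1))
      (fun i => cA i v) (fun i => fderiv ℝ (cA i) v (1, 0)) (fun i => fderiv ℝ (cA i) v (0, 1))
      (fun i => cB i v) (fun i => fderiv ℝ (cB i) v (1, 0)) (fun i => fderiv ℝ (cB i) v (0, 1))
      (fun i => cC i v) (fun i => fderiv ℝ (cC i) v (1, 0)) (fun i => fderiv ℝ (cC i) v (0, 1))) :
    ∀ v ∈ V, cA 0 v = 0 ∧ cA 1 v = 0 ∧ cB 0 v = 0 ∧ cB 1 v = 0 ∧ cC 0 v = 0 ∧ cL 0 v = 0 ∧ cL 1 v = 0 ∧ cL 2 v = 0 ∧ cL 3 v = 0 ∧ cK 0 v = 0 ∧ cK 1 v = 0 ∧ cK 2 v = 0 ∧ cK 3 v = 0 ∧ cJ 0 v = 0 ∧ cJ 1 v = 0 ∧ cJ 2 v = 0 ∧ cJ 3 v = 0 ∧ cJ 4 v = 0 ∧ cJ 5 v = 0 ∧ cC 1 v = 0 := by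
  have hC1 : ∀ v ∈ V, cC 1 v = 0 := by
    intro v hv
    obtain ⟨h0, h1, h2, h3, h4⟩ := hV ⟨v, hv⟩
    simp only at h0 h1 h2 h3 h4
    have e := (hE v hv).fD0
    simp only [gtx] at e
    rcases mul_eq_zero.mp e with h | h
    · exfalso
      have h5 : -1 / 2 * (v.1 + 1) ^ 2 / (v.1 - 1) ^ 2 * (2 / (v.1 + 1) - 2 / (v.1 - 1)) = 2 * (v.1 + 1) / (v.1 - 1) ^ 3 := by
        field_simp
        ring
      rw [h5] at h
      have : 2 * (v.1 + 1) / (v.1 - 1) ^ 3 ≠ 0 := by positivity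
      exact this h
    · exact h
  have hC1d : ∀ v ∈ V, ∀ w, fderiv ℝ (cC 1) v w = 0 := by
    intro v hv w
    have : cC 1 =ᶠ[nhds v] fun _ => 0 := by
      filter_upwards [V.isOpen.mem_nhds hv] with u hu using hC1 u hu
    rw [this.fderiv_eq]
    simp
  obtain ⟨A0, qA0⟩ := gaugeLem hV (cA 0) (sA 0) (1/2) (by norm_num) (0) (-4) (-1) (1) (1)
  obtain ⟨A1, qA1⟩ := gaugeLem hV (cA 1) (sA 1) (1/2) (by norm_num) (1) (-3) (-2) (1) (2)
  obtain ⟨B0, qB0⟩ := gaugeLem hV (cB 0) (sB 0) (2) (by norm_num) (-3) (1) (0) (1) (1)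
  obtain ⟨B1, qB1⟩ := gaugeLem hV (cB 1) (sB 1) (1) (by norm_num) (-2) (2) (-1) (1) (2)
  obtain ⟨C0, qC0⟩ := gaugeLem hV (cC 0) (sC 0) (2) (by norm_num) (-6) (6) (1) (1) (1)
  obtain ⟨L0, qL0⟩ := gaugeLem hV (cL 0) (sL 0) (1) (by norm_num) (-7) (-3) (2) (3) (-1)
  obtain ⟨L1, qL1⟩ := gaugeLem hV (cL 1) (sL 1) (1) (by norm_num) (-5) (-1) (1) (3) (0)
  obtain ⟨L2, qL2⟩ := gaugeLem hV (cL 2) (sL 2) (1/2) (by norm_num) (-5) (-1) (1) (3) (1)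
  obtain ⟨L3, qL3⟩ := gaugeLem hV (cL 3) (sL 3) (1) (by norm_num) (-4) (0) (1) (3) (2)
  obtain ⟨K0, qK0⟩ := gaugeLem hV (cK 0) (sK 0) (1/2) (by norm_num) (-4) (-8) (1) (3) (-1)
  obtain ⟨K1, qK1⟩ := gaugeLem hV (cK 1) (sK 1) (1/2) (by norm_num) (-3) (-7) (0) (3) (0)
  obtain ⟨K2, qK2⟩ := gaugeLem hV (cK 2) (sK 2) (1/4) (by norm_num) (-2) (-6) (0) (3) (1)
  obtain ⟨K3, qK3⟩ := gaugeLem hV (cK 3) (sK 3) (1/4) (by norm_num) (-1) (-5) (-1) (3) (2)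
  obtain ⟨J0, qJ0⟩ := gaugeLem hV (cJ 0) (sJ 0) (1/10) (by norm_num) (-7) (-11) (3) (6) (-1)
  obtain ⟨J1, qJ1⟩ := gaugeLem hV (cJ 1) (sJ 1) (1/2) (by norm_num) (-6) (-10) (2) (6) (-2)
  obtain ⟨J2, qJ2⟩ := gaugeLem hV (cJ 2) (sJ 2) (1/4) (by norm_num) (-6) (-10) (2) (6) (-1)
  obtain ⟨J3, qJ3⟩ := gaugeLem hV (cJ 3) (sJ 3) (1/4) (by norm_num) (-5) (-9) (1) (6) (0)
  obtain ⟨J4, qJ4⟩ := gaugeLem hV (cJ 4) (sJ 4) (1/16) (by norm_num) (-4) (-8) (1) (6) (1)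
  obtain ⟨J5, qJ5⟩ := gaugeLem hV (cJ 5) (sJ 5) (1/20) (by norm_num) (-3) (-7) (1) (6) (2)
  let X : SF V := SFmk (fun v => v.1) contDiffOn_fst
  let Yc : SF V := SFmk (fun v => v.2) contDiffOn_snd
  have eX : ∀ v : V, evv v X = (v : ℝ × ℝ).1 := fun v => rfl
  have eY : ∀ v : V, evv v Yc = (v : ℝ × ℝ).2 := fun v => rfl
  have hz := core1 (dW (V := V) (1, 0)) (dW (0, 1)) X Yc ?hxx ?hxy ?hyx ?hyy (fun f => dW_comm _ _ f) ?ux ?uY ?uD ?uy ?uDel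
    A0 A1 B0 B1 C0 L0 L1 L2 L3 K0 K1 K2 K3 J0 J1 J2 J3 J4 J5
    ?fA0 ?fB0 ?fC0 ?eC2 ?eC1 ?eC0 ?eB2 ?eB1 ?eA1 ?eB0 ?eA0 ?eA2 ?eL0 ?eL1 ?eL2 ?eL3 ?eL4 ?eK0 ?eK1 ?eK3 ?eK4 ?eJ0 ?eJ6
  case hxx => 
    apply sub_eq_zero.mp; apply SF_eq_zero; intro v; rw [map_sub, map_one, evv_dW_mk, fderiv_fst]; simp
  case hxy => 
    apply SF_eq_zero; intro v; rw [evv_dW_mk, fderiv_snd]; simp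
  case hyx => 
    apply SF_eq_zero; intro v; rw [evv_dW_mk, fderiv_fst]; simp
  case hyy => 
    apply sub_eq_zero.mp; apply SF_eq_zero; intro v; rw [map_sub, map_one, evv_dW_mk, fderiv_snd]; simp
  case ux => 
    apply SF_isUnit; intro v; rw [eX]; exact hx v
  case uy => 
    apply SF_isUnit; intro v; rw [eY]; exact (hV v).2.2.2.2
  case uY => 
    apply SF_isUnit; intro v; rw [map_sub, map_pow, map_one, eY]; exact (hV v).2.2.1
  case uD => 
    apply SF_isUnit; intro v; rw [map_sub, map_pow, map_pow, eX, eY]; exact (hV v).2.2.2.1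
  case uDel => 
    apply SF_isUnit; intro v
    have h := hDel v
    rw [← eX, ← eY] at h
    rwa [DeltaP_map]
  case fA0 =>
    apply SF_eq_zero
    intro v
    obtain ⟨h0, h1, h2, h3, h4⟩ := hV v
    have e := (hE v v.2).fA0
    simp only [(qA0 v).1, (qA0 v).2.1, (qA0 v).2.2, (qA1 v).1, (qA1 v).2.1, (qA1 v).2.2, hC1 v v.2, hC1d v v.2] at e
    simp only [map_add, map_mul, map_sub, map_pow, map_neg, map_ofNat, map_one, eX, eY]
    exact cv_fA0 v.1.1 v.1.2 _ _ _ _ rfl rfl rfl rfl h0 h1 h2 h3 h4 (evv v A0) (evv v (dW (1, 0) A0)) (evv v (dW (0, 1) A0)) (evv v A1) (evv v (dW (1, 0) A1)) (evv v (dW (0, 1) A1)) e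
  case fB0 =>
    apply SF_eq_zero
    intro v
    obtain ⟨h0, h1, h2, h3, h4⟩ := hV v
    have e := (hE v v.2).fB0
    simp only [(qA1 v).1, (qA1 v).2.1, (qA1 v).2.2, (qB0 v).1, (qB0 v).2.1, (qB0 v).2.2, (qB1 v).1, (qB1 v).2.1, (qB1 v).2.2, hC1 v v.2, hC1d v v.2] at e
    simp only [map_add, map_mul, map_sub, map_pow, map_neg, map_ofNat, map_one, eX, eY]
    exact cv_fB0 v.1.1 v.1.2 _ _ _ _ rfl rfl rfl rfl h0 h1 h2 h3 h4 (evv v A1) (evv v (dW (1, 0) A1)) (evv v (dW (0, 1) A1)) (evv v B0) (evv v (dW (1, 0) B0)) (evv v (dW (0, 1) B0)) (evv v B1) (evv v (dW (1, 0) B1)) (evv v (dW (0, 1) B1)) e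
  case fC0 =>
    apply SF_eq_zero
    intro v
    obtain ⟨h0, h1, h2, h3, h4⟩ := hV v
    have e := (hE v v.2).fC0
    simp only [(qB1 v).1, (qB1 v).2.1, (qB1 v).2.2, (qC0 v).1, (qC0 v).2.1, (qC0 v).2.2, hC1 v v.2, hC1d v v.2] at e
    simp only [map_add, map_mul, map_sub, map_pow, map_neg, map_ofNat, map_one, eX, eY]
    exact cv_fC0 v.1.1 v.1.2 _ _ _ _ rfl rfl rfl rfl h0 h1 h2 h3 h4 (evv v B1) (evv v (dW (1, 0) B1)) (evv v (dW (0, 1) B1)) (evv v C0) (evv v (dW (1, 0) C0)) (evv v (dW (0, 1) C0)) e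
  case eC2 =>
    apply SF_eq_zero
    intro v
    obtain ⟨h0, h1, h2, h3, h4⟩ := hV v
    have e := (hE v v.2).eC2
    simp only [(qC0 v).1, (qC0 v).2.1, (qC0 v).2.2, (qL3 v).1, (qL3 v).2.1, (qL3 v).2.2, hC1 v v.2, hC1d v v.2] at e
    simp only [map_add, map_mul, map_sub, map_pow, map_neg, map_ofNat, map_one, eX, eY]
    exact cv_eC2 v.1.1 v.1.2 _ _ _ _ rfl rfl rfl rfl h0 h1 h2 h3 h4 (evv v C0) (evv v (dW (1, 0) C0)) (evv v (dW (0, 1) C0)) (evv v L3) (evv v (dW (1, 0) L3)) (evv v (dW (0, 1) L3)) e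
  case eC1 =>
    apply SF_eq_zero
    intro v
    obtain ⟨h0, h1, h2, h3, h4⟩ := hV v
    have e := (hE v v.2).eC1
    simp only [(qC0 v).1, (qC0 v).2.1, (qC0 v).2.2, (qL2 v).1, (qL2 v).2.1, (qL2 v).2.2, hC1 v v.2, hC1d v v.2] at e
    simp only [map_add, map_mul, map_sub, map_pow, map_neg, map_ofNat, map_one, eX, eY]
    exact cv_eC1 v.1.1 v.1.2 _ _ _ _ rfl rfl rfl rfl h0 h1 h2 h3 h4 (evv v C0) (evv v (dW (1, 0) C0)) (evv v (dW (0, 1) C0)) (evv v L2) (evv v (dW (1, 0) L2)) (evv v (dW (0, 1) L2)) e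
  case eC0 =>
    apply SF_eq_zero
    intro v
    obtain ⟨h0, h1, h2, h3, h4⟩ := hV v
    have e := (hE v v.2).eC0
    simp only [(qC0 v).1, (qC0 v).2.1, (qC0 v).2.2, (qL1 v).1, (qL1 v).2.1, (qL1 v).2.2, hC1 v v.2, hC1d v v.2] at e
    simp only [map_add, map_mul, map_sub, map_pow, map_neg, map_ofNat, map_one, eX, eY]
    exact cv_eC0 v.1.1 v.1.2 _ _ _ _ rfl rfl rfl rfl h0 h1 h2 h3 h4 (evv v C0) (evv v (dW (1, 0) C0)) (evv v (dW (0, 1) C0)) (evv v L1) (evv v (dW (1, 0) L1)) (evv v (dW (0, 1) L1)) e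
  case eB2 =>
    apply SF_eq_zero
    intro v
    obtain ⟨h0, h1, h2, h3, h4⟩ := hV v
    have e := (hE v v.2).eB2
    simp only [(qB0 v).1, (qB0 v).2.1, (qB0 v).2.2, (qB1 v).1, (qB1 v).2.1, (qB1 v).2.2, (qK3 v).1, (qK3 v).2.1, (qK3 v).2.2, (qL2 v).1, (qL2 v).2.1, (qL2 v).2.2, (qL3 v).1, (qL3 v).2.1, (qL3 v).2.2, hC1 v v.2, hC1d v v.2] at e
    simp only [map_add, map_mul, map_sub, map_pow, map_neg, map_ofNat, map_one, eX, eY]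
    exact cv_eB2 v.1.1 v.1.2 _ _ _ _ rfl rfl rfl rfl h0 h1 h2 h3 h4 (evv v B0) (evv v (dW (1, 0) B0)) (evv v (dW (0, 1) B0)) (evv v B1) (evv v (dW (1, 0) B1)) (evv v (dW (0, 1) B1)) (evv v K3) (evv v (dW (1, 0) K3)) (evv v (dW (0, 1) K3)) (evv v L2) (evv v (dW (1, 0) L2)) (evv v (dW (0, 1) L2)) (evv v L3) (evv v (dW (1, 0) L3)) (evv v (dW (0, 1) L3)) e
  case eB1 =>
    apply SF_eq_zero
    intro v
    obtain ⟨h0, h1, h2, h3, h4⟩ := hV v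
    have e := (hE v v.2).eB1
    simp only [(qB0 v).1, (qB0 v).2.1, (qB0 v).2.2, (qB1 v).1, (qB1 v).2.1, (qB1 v).2.2, (qK2 v).1, (qK2 v).2.1, (qK2 v).2.2, (qL1 v).1, (qL1 v).2.1, (qL1 v).2.2, (qL2 v).1, (qL2 v).2.1, (qL2 v).2.2, hC1 v v.2, hC1d v v.2] at e
    simp only [map_add, map_mul, map_sub, map_pow, map_neg, map_ofNat, map_one, eX, eY]
    exact cv_eB1 v.1.1 v.1.2 _ _ _ _ rfl rfl rfl rfl h0 h1 h2 h3 h4 (evv v B0) (evv v (dW (1, 0) B0)) (evv v (dW (0, 1) B0)) (evv v B1) (evv v (dW (1, 0) B1)) (evv v (dW (0, 1) B1)) (evv v K2) (evv v (dW (1, 0) K2)) (evv v (dW (0, 1) K2)) (evv v L1) (evv v (dW (1, 0) L1)) (evv v (dW (0, 1) L1)) (evv v L2) (evv v (dW (1, 0) L2)) (evv v (dW (0, 1) L2)) e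
  case eA1 =>
    apply SF_eq_zero
    intro v
    obtain ⟨h0, h1, h2, h3, h4⟩ := hV v
    have e := (hE v v.2).eA1
    simp only [(qA0 v).1, (qA0 v).2.1, (qA0 v).2.2, (qA1 v).1, (qA1 v).2.1, (qA1 v).2.2, (qK1 v).1, (qK1 v).2.1, (qK1 v).2.2, (qK2 v).1, (qK2 v).2.1, (qK2 v).2.2, hC1 v v.2, hC1d v v.2] at e
    simp only [map_add, map_mul, map_sub, map_pow, map_neg, map_ofNat, map_one, eX, eY]
    exact cv_eA1 v.1.1 v.1.2 _ _ _ _ rfl rfl rfl rfl h0 h1 h2 h3 h4 (evv v A0) (evv v (dW (1, 0) A0)) (evv v (dW (0, 1) A0)) (evv v A1) (evv v (dW (1, 0) A1)) (evv v (dW (0, 1) A1)) (evv v K1) (evv v (dW (1, 0) K1)) (evv v (dW (0, 1) K1)) (evv v K2) (evv v (dW (1, 0) K2)) (evv v (dW (0, 1) K2)) e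
  case eB0 =>
    apply SF_eq_zero
    intro v
    obtain ⟨h0, h1, h2, h3, h4⟩ := hV v
    have e := (hE v v.2).eB0
    simp only [(qB0 v).1, (qB0 v).2.1, (qB0 v).2.2, (qB1 v).1, (qB1 v).2.1, (qB1 v).2.2, (qK1 v).1, (qK1 v).2.1, (qK1 v).2.2, (qL0 v).1, (qL0 v).2.1, (qL0 v).2.2, (qL1 v).1, (qL1 v).2.1, (qL1 v).2.2, hC1 v v.2, hC1d v v.2] at e
    simp only [map_add, map_mul, map_sub, map_pow, map_neg, map_ofNat, map_one, eX, eY]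
    exact cv_eB0 v.1.1 v.1.2 _ _ _ _ rfl rfl rfl rfl h0 h1 h2 h3 h4 (evv v B0) (evv v (dW (1, 0) B0)) (evv v (dW (0, 1) B0)) (evv v B1) (evv v (dW (1, 0) B1)) (evv v (dW (0, 1) B1)) (evv v K1) (evv v (dW (1, 0) K1)) (evv v (dW (0, 1) K1)) (evv v L0) (evv v (dW (1, 0) L0)) (evv v (dW (0, 1) L0)) (evv v L1) (evv v (dW (1, 0) L1)) (evv v (dW (0, 1) L1)) e
  case eA0 =>
    apply SF_eq_zero
    intro v
    obtain ⟨h0, h1, h2, h3, h4⟩ := hV v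
    have e := (hE v v.2).eA0
    simp only [(qA0 v).1, (qA0 v).2.1, (qA0 v).2.2, (qA1 v).1, (qA1 v).2.1, (qA1 v).2.2, (qK0 v).1, (qK0 v).2.1, (qK0 v).2.2, (qK1 v).1, (qK1 v).2.1, (qK1 v).2.2, hC1 v v.2, hC1d v v.2] at e
    simp only [map_add, map_mul, map_sub, map_pow, map_neg, map_ofNat, map_one, eX, eY]
    exact cv_eA0 v.1.1 v.1.2 _ _ _ _ rfl rfl rfl rfl h0 h1 h2 h3 h4 (evv v A0) (evv v (dW (1, 0) A0)) (evv v (dW (0, 1) A0)) (evv v A1) (evv v (dW (1, 0) A1)) (evv v (dW (0, 1) A1)) (evv v K0) (evv v (dW (1, 0) K0)) (evv v (dW (0, 1) K0)) (evv v K1) (evv v (dW (1, 0) K1)) (evv v (dW (0, 1) K1)) e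
  case eA2 =>
    apply SF_eq_zero
    intro v
    obtain ⟨h0, h1, h2, h3, h4⟩ := hV v
    have e := (hE v v.2).eA2
    simp only [(qA0 v).1, (qA0 v).2.1, (qA0 v).2.2, (qA1 v).1, (qA1 v).2.1, (qA1 v).2.2, (qK2 v).1, (qK2 v).2.1, (qK2 v).2.2, (qK3 v).1, (qK3 v).2.1, (qK3 v).2.2, hC1 v v.2, hC1d v v.2] at e
    simp only [map_add, map_mul, map_sub, map_pow, map_neg, map_ofNat, map_one, eX, eY]
    exact cv_eA2 v.1.1 v.1.2 _ _ _ _ rfl rfl rfl rfl h0 h1 h2 h3 h4 (evv v A0) (evv v (dW (1, 0) A0)) (evv v (dW (0, 1) A0)) (evv v A1) (evv v (dW (1, 0) A1)) (evv v (dW (0, 1) A1)) (evv v K2) (evv v (dW (1, 0) K2)) (evv v (dW (0, 1) K2)) (evv v K3) (evv v (dW (1, 0) K3)) (evv v (dW (0, 1) K3)) e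
  case eL0 =>
    apply SF_eq_zero
    intro v
    obtain ⟨h0, h1, h2, h3, h4⟩ := hV v
    have e := (hE v v.2).eL0
    simp only [(qJ1 v).1, (qJ1 v).2.1, (qJ1 v).2.2, (qL0 v).1, (qL0 v).2.1, (qL0 v).2.2, (qL1 v).1, (qL1 v).2.1, (qL1 v).2.2, hC1 v v.2, hC1d v v.2] at e
    simp only [map_add, map_mul, map_sub, map_pow, map_neg, map_ofNat, map_one, eX, eY]
    exact cv_eL0 v.1.1 v.1.2 _ _ _ _ rfl rfl rfl rfl h0 h1 h2 h3 h4 (evv v J1) (evv v (dW (1, 0) J1)) (evv v (dW (0, 1) J1)) (evv v L0) (evv v (dW (1, 0) L0)) (evv v (dW (0, 1) L0)) (evv v L1) (evv v (dW (1, 0) L1)) (evv v (dW (0, 1) L1)) e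
  case eL1 =>
    apply SF_eq_zero
    intro v
    obtain ⟨h0, h1, h2, h3, h4⟩ := hV v
    have e := (hE v v.2).eL1
    simp only [(qJ2 v).1, (qJ2 v).2.1, (qJ2 v).2.2, (qL0 v).1, (qL0 v).2.1, (qL0 v).2.2, (qL1 v).1, (qL1 v).2.1, (qL1 v).2.2, (qL2 v).1, (qL2 v).2.1, (qL2 v).2.2, hC1 v v.2, hC1d v v.2] at e
    simp only [map_add, map_mul, map_sub, map_pow, map_neg, map_ofNat, map_one, eX, eY]
    exact cv_eL1 v.1.1 v.1.2 _ _ _ _ rfl rfl rfl rfl h0 h1 h2 h3 h4 (evv v J2) (evv v (dW (1, 0) J2)) (evv v (dW (0, 1) J2)) (evv v L0) (evv v (dW (1, 0) L0)) (evv v (dW (0, 1) L0)) (evv v L1) (evv v (dW (1, 0) L1)) (evv v (dW (0, 1) L1)) (evv v L2) (evv v (dW (1, 0) L2)) (evv v (dW (0, 1) L2)) e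
  case eL2 =>
    apply SF_eq_zero
    intro v
    obtain ⟨h0, h1, h2, h3, h4⟩ := hV v
    have e := (hE v v.2).eL2
    simp only [(qJ3 v).1, (qJ3 v).2.1, (qJ3 v).2.2, (qL0 v).1, (qL0 v).2.1, (qL0 v).2.2, (qL1 v).1, (qL1 v).2.1, (qL1 v).2.2, (qL2 v).1, (qL2 v).2.1, (qL2 v).2.2, (qL3 v).1, (qL3 v).2.1, (qL3 v).2.2, hC1 v v.2, hC1d v v.2] at e
    simp only [map_add, map_mul, map_sub, map_pow, map_neg, map_ofNat, map_one, eX, eY]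
    exact cv_eL2 v.1.1 v.1.2 _ _ _ _ rfl rfl rfl rfl h0 h1 h2 h3 h4 (evv v J3) (evv v (dW (1, 0) J3)) (evv v (dW (0, 1) J3)) (evv v L0) (evv v (dW (1, 0) L0)) (evv v (dW (0, 1) L0)) (evv v L1) (evv v (dW (1, 0) L1)) (evv v (dW (0, 1) L1)) (evv v L2) (evv v (dW (1, 0) L2)) (evv v (dW (0, 1) L2)) (evv v L3) (evv v (dW (1, 0) L3)) (evv v (dW (0, 1) L3)) e
  case eL3 =>
    apply SF_eq_zero
    intro v
    obtain ⟨h0, h1, h2, h3, h4⟩ := hV v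
    have e := (hE v v.2).eL3
    simp only [(qJ4 v).1, (qJ4 v).2.1, (qJ4 v).2.2, (qL1 v).1, (qL1 v).2.1, (qL1 v).2.2, (qL2 v).1, (qL2 v).2.1, (qL2 v).2.2, (qL3 v).1, (qL3 v).2.1, (qL3 v).2.2, hC1 v v.2, hC1d v v.2] at e
    simp only [map_add, map_mul, map_sub, map_pow, map_neg, map_ofNat, map_one, eX, eY]
    exact cv_eL3 v.1.1 v.1.2 _ _ _ _ rfl rfl rfl rfl h0 h1 h2 h3 h4 (evv v J4) (evv v (dW (1, 0) J4)) (evv v (dW (0, 1) J4)) (evv v L1) (evv v (dW (1, 0) L1)) (evv v (dW (0, 1) L1)) (evv v L2) (evv v (dW (1, 0) L2)) (evv v (dW (0, 1) L2)) (evv v L3) (evv v (dW (1, 0) L3)) (evv v (dW (0, 1) L3)) e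
  case eL4 =>
    apply SF_eq_zero
    intro v
    obtain ⟨h0, h1, h2, h3, h4⟩ := hV v
    have e := (hE v v.2).eL4
    simp only [(qJ5 v).1, (qJ5 v).2.1, (qJ5 v).2.2, (qL2 v).1, (qL2 v).2.1, (qL2 v).2.2, (qL3 v).1, (qL3 v).2.1, (qL3 v).2.2, hC1 v v.2, hC1d v v.2] at e
    simp only [map_add, map_mul, map_sub, map_pow, map_neg, map_ofNat, map_one, eX, eY]
    exact cv_eL4 v.1.1 v.1.2 _ _ _ _ rfl rfl rfl rfl h0 h1 h2 h3 h4 (evv v J5) (evv v (dW (1, 0) J5)) (evv v (dW (0, 1) J5)) (evv v L2) (evv v (dW (1, 0) L2)) (evv v (dW (0, 1) L2)) (evv v L3) (evv v (dW (1, 0) L3)) (evv v (dW (0, 1) L3)) e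
  case eK0 =>
    apply SF_eq_zero
    intro v
    obtain ⟨h0, h1, h2, h3, h4⟩ := hV v
    have e := (hE v v.2).eK0
    simp only [(qJ0 v).1, (qJ0 v).2.1, (qJ0 v).2.2, (qJ1 v).1, (qJ1 v).2.1, (qJ1 v).2.2, (qK0 v).1, (qK0 v).2.1, (qK0 v).2.2, (qK1 v).1, (qK1 v).2.1, (qK1 v).2.2, hC1 v v.2, hC1d v v.2] at e
    simp only [map_add, map_mul, map_sub, map_pow, map_neg, map_ofNat, map_one, eX, eY]
    exact cv_eK0 v.1.1 v.1.2 _ _ _ _ rfl rfl rfl rfl h0 h1 h2 h3 h4 (evv v J0) (evv v (dW (1, 0) J0)) (evv v (dW (0, 1) J0)) (evv v J1) (evv v (dW (1, 0) J1)) (evv v (dW (0, 1) J1)) (evv v K0) (evv v (dW (1, 0) K0)) (evv v (dW (0, 1) K0)) (evv v K1) (evv v (dW (1, 0) K1)) (evv v (dW (0, 1) K1)) e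
  case eK1 =>
    apply SF_eq_zero
    intro v
    obtain ⟨h0, h1, h2, h3, h4⟩ := hV v
    have e := (hE v v.2).eK1
    simp only [(qJ1 v).1, (qJ1 v).2.1, (qJ1 v).2.2, (qJ2 v).1, (qJ2 v).2.1, (qJ2 v).2.2, (qK0 v).1, (qK0 v).2.1, (qK0 v).2.2, (qK1 v).1, (qK1 v).2.1, (qK1 v).2.2, (qK2 v).1, (qK2 v).2.1, (qK2 v).2.2, hC1 v v.2, hC1d v v.2] at e
    simp only [map_add, map_mul, map_sub, map_pow, map_neg, map_ofNat, map_one, eX, eY]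
    exact cv_eK1 v.1.1 v.1.2 _ _ _ _ rfl rfl rfl rfl h0 h1 h2 h3 h4 (evv v J1) (evv v (dW (1, 0) J1)) (evv v (dW (0, 1) J1)) (evv v J2) (evv v (dW (1, 0) J2)) (evv v (dW (0, 1) J2)) (evv v K0) (evv v (dW (1, 0) K0)) (evv v (dW (0, 1) K0)) (evv v K1) (evv v (dW (1, 0) K1)) (evv v (dW (0, 1) K1)) (evv v K2) (evv v (dW (1, 0) K2)) (evv v (dW (0, 1) K2)) e
  case eK3 =>
    apply SF_eq_zero
    intro v
    obtain ⟨h0, h1, h2, h3, h4⟩ := hV v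
    have e := (hE v v.2).eK3
    simp only [(qJ3 v).1, (qJ3 v).2.1, (qJ3 v).2.2, (qJ4 v).1, (qJ4 v).2.1, (qJ4 v).2.2, (qK1 v).1, (qK1 v).2.1, (qK1 v).2.2, (qK2 v).1, (qK2 v).2.1, (qK2 v).2.2, (qK3 v).1, (qK3 v).2.1, (qK3 v).2.2, hC1 v v.2, hC1d v v.2] at e
    simp only [map_add, map_mul, map_sub, map_pow, map_neg, map_ofNat, map_one, eX, eY]
    exact cv_eK3 v.1.1 v.1.2 _ _ _ _ rfl rfl rfl rfl h0 h1 h2 h3 h4 (evv v J3) (evv v (dW (1, 0) J3)) (evv v (dW (0, 1) J3)) (evv v J4) (evv v (dW (1, 0) J4)) (evv v (dW (0, 1) J4)) (evv v K1) (evv v (dW (1, 0) K1)) (evv v (dW (0, 1) K1)) (evv v K2) (evv v (dW (1, 0) K2)) (evv v (dW (0, 1) K2)) (evv v K3) (evv v (dW (1, 0) K3)) (evv v (dW (0, 1) K3)) e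
  case eK4 =>
    apply SF_eq_zero
    intro v
    obtain ⟨h0, h1, h2, h3, h4⟩ := hV v
    have e := (hE v v.2).eK4
    simp only [(qJ4 v).1, (qJ4 v).2.1, (qJ4 v).2.2, (qJ5 v).1, (qJ5 v).2.1, (qJ5 v).2.2, (qK2 v).1, (qK2 v).2.1, (qK2 v).2.2, (qK3 v).1, (qK3 v).2.1, (qK3 v).2.2, hC1 v v.2, hC1d v v.2] at e
    simp only [map_add, map_mul, map_sub, map_pow, map_neg, map_ofNat, map_one, eX, eY]
    exact cv_eK4 v.1.1 v.1.2 _ _ _ _ rfl rfl rfl rfl h0 h1 h2 h3 h4 (evv v J4) (evv v (dW (1, 0) J4)) (evv v (dW (0, 1) J4)) (evv v J5) (evv v (dW (1, 0) J5)) (evv v (dW (0, 1) J5)) (evv v K2) (evv v (dW (1, 0) K2)) (evv v (dW (0, 1) K2)) (evv v K3) (evv v (dW (1, 0) K3)) (evv v (dW (0, 1) K3)) e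
  case eJ0 =>
    apply SF_eq_zero
    intro v
    obtain ⟨h0, h1, h2, h3, h4⟩ := hV v
    have e := (hE v v.2).eJ0
    simp only [(qJ0 v).1, (qJ0 v).2.1, (qJ0 v).2.2, (qJ1 v).1, (qJ1 v).2.1, (qJ1 v).2.2, hC1 v v.2, hC1d v v.2] at e
    simp only [map_add, map_mul, map_sub, map_pow, map_neg, map_ofNat, map_one, eX, eY]
    exact cv_eJ0 v.1.1 v.1.2 _ _ _ _ rfl rfl rfl rfl h0 h1 h2 h3 h4 (evv v J0) (evv v (dW (1, 0) J0)) (evv v (dW (0, 1) J0)) (evv v J1) (evv v (dW (1, 0) J1)) (evv v (dW (0, 1) J1)) e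
  case eJ6 =>
    apply SF_eq_zero
    intro v
    obtain ⟨h0, h1, h2, h3, h4⟩ := hV v
    have e := (hE v v.2).eJ6
    simp only [(qJ4 v).1, (qJ4 v).2.1, (qJ4 v).2.2, (qJ5 v).1, (qJ5 v).2.1, (qJ5 v).2.2, hC1 v v.2, hC1d v v.2] at e
    simp only [map_add, map_mul, map_sub, map_pow, map_neg, map_ofNat, map_one, eX, eY]
    exact cv_eJ6 v.1.1 v.1.2 _ _ _ _ rfl rfl rfl rfl h0 h1 h2 h3 h4 (evv v J4) (evv v (dW (1, 0) J4)) (evv v (dW (0, 1) J4)) (evv v J5) (evv v (dW (1, 0) J5)) (evv v (dW (0, 1) J5)) e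
  intro v hv
  obtain ⟨zA0, zA1, zB0, zB1, zC0, zL0, zL1, zL2, zL3, zK0, zK1, zK2, zK3, zJ0, zJ1, zJ2, zJ3, zJ4, zJ5⟩ := hz
  refine ⟨?_, ?_, ?_, ?_, ?_, ?_, ?_, ?_, ?_, ?_, ?_, ?_, ?_, ?_, ?_, ?_, ?_, ?_, ?_, hC1 v hv⟩
  · have h := (qA0 ⟨v, hv⟩).1
    rw [zA0, map_zero, mul_zero] at h
    exact h
  · have h := (qA1 ⟨v, hv⟩).1
    rw [zA1, map_zero, mul_zero] at h
    exact h
  · have h := (qB0 ⟨v, hv⟩).1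
    rw [zB0, map_zero, mul_zero] at h
    exact h
  · have h := (qB1 ⟨v, hv⟩).1
    rw [zB1, map_zero, mul_zero] at h
    exact h
  · have h := (qC0 ⟨v, hv⟩).1
    rw [zC0, map_zero, mul_zero] at h
    exact h
  · have h := (qL0 ⟨v, hv⟩).1
    rw [zL0, map_zero, mul_zero] at h
    exact h
  · have h := (qL1 ⟨v, hv⟩).1
    rw [zL1, map_zero, mul_zero] at h
    exact h
  · have h := (qL2 ⟨v, hv⟩).1
    rw [zL2, map_zero, mul_zero] at h
    exact h
  · have h := (qL3 ⟨v, hv⟩).1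
    rw [zL3, map_zero, mul_zero] at h
    exact h
  · have h := (qK0 ⟨v, hv⟩).1
    rw [zK0, map_zero, mul_zero] at h
    exact h
  · have h := (qK1 ⟨v, hv⟩).1
    rw [zK1, map_zero, mul_zero] at h
    exact h
  · have h := (qK2 ⟨v, hv⟩).1
    rw [zK2, map_zero, mul_zero] at h
    exact h
  · have h := (qK3 ⟨v, hv⟩).1
    rw [zK3, map_zero, mul_zero] at h
    exact h
  · have h := (qJ0 ⟨v, hv⟩).1
    rw [zJ0, map_zero, mul_zero] at h
    exact h
  · have h := (qJ1 ⟨v, hv⟩).1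
    rw [zJ1, map_zero, mul_zero] at h
    exact h
  · have h := (qJ2 ⟨v, hv⟩).1
    rw [zJ2, map_zero, mul_zero] at h
    exact h
  · have h := (qJ3 ⟨v, hv⟩).1
    rw [zJ3, map_zero, mul_zero] at h
    exact h
  · have h := (qJ4 ⟨v, hv⟩).1
    rw [zJ4, map_zero, mul_zero] at h
    exact h
  · have h := (qJ5 ⟨v, hv⟩).1
    rw [zJ5, map_zero, mul_zero] at h
    exact h


theorem vanish8 (c0 c1 c2 c3 c4 c5 c6 c7 : ℝ)
    (h : ∀ r : ℝ, c0 + c1*r + c2*r^2 + c3*r^3 + c4*r^4 + c5*r^5 + c6*r^6 + c7*r^7 = 0) :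
    c0 = 0 ∧ c1 = 0 ∧ c2 = 0 ∧ c3 = 0 ∧ c4 = 0 ∧ c5 = 0 ∧ c6 = 0 ∧ c7 = 0 := by
  have h0 := h 0
  have h1 := h 1
  have h2 := h (-1)
  have h3 := h 2
  have h4 := h (-2)
  have h5 := h 3
  have h6 := h (-3)
  have h7 := h 4
  norm_num at h0 h1 h2 h3 h4 h5 h6 h7
  refine ⟨?_, ?_, ?_, ?_, ?_, ?_, ?_, ?_⟩ <;> linarith

/-- sum over all monomials of degree six -/
def Sum6 (g : ℕ → ℕ → ℕ → ℕ → ℝ) : ℝ :=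
  ∑ i ∈ Finset.range 7, ∑ j ∈ Finset.range 7, ∑ k ∈ Finset.range 7, ∑ m ∈ Finset.range 7,
    if i + j + k + m = 6 then g i j k m else 0

theorem Sum6_eq (g : ℕ → ℕ → ℕ → ℕ → ℝ) (hg : ∀ i j k m, ¬ Odd (k + m) → g i j k m = 0) :
    Sum6 g = g 0 5 0 1 + g 1 4 0 1 + g 2 3 0 1 + g 3 2 0 1 + g 4 1 0 1 + g 5 0 0 1 + g 0 3 0 3 + g 1 2 0 3 + g 2 1 0 3 + g 3 0 0 3 + g 0 1 0 5 + g 1 0 0 5 + g 0 5 1 0 + g 1 4 1 0 + g 2 3 1 0 + g 3 2 1 0 + g 4 1 1 0 + g 5 0 1 0 + g 0 3 1 2 + g 1 2 1 2 + g 2 1 1 2 + g 3 0 1 2 + g 0 1 1 4 + g 1 0 1 4 + g 0 3 2 1 + g 1 2 2 1 + g 2 1 2 1 + g 3 0 2 1 + g 0 1 2 3 + g 1 0 2 3 + g 0 3 3 0 + g 1 2 3 0 + g 2 1 3 0 + g 3 0 3 0 + g 0 1 3 2 + g 1 0 3 2 + g 0 1 4 1 + g 1 0 4 1 + g 0 1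 5 0 + g 1 0 5 0 := by
  have hin : ∀ i j k : ℕ, (∑ m ∈ Finset.range 7, if i + j + k + m = 6 then g i j k m else 0)
      = if i + j + k ≤ 6 then g i j k (6 - (i + j + k)) else 0 := by
    intro i j k
    split_ifs with h
    · rw [Finset.sum_eq_single (6 - (i + j + k))]
      · rw [if_pos (by omega)]
      · intro b _ hb
        rw [if_neg (by omega)]
      · intro hb
        simp only [Finset.mem_range] at hb
        omega
    · apply Finset.sum_eq_zero
      intro m _
      rw [if_neg (by omega)]
  have hg0 : ∀ i j, g i j 0 0 = 0 ∧ g i j 0 2 = 0 ∧ g i j 0 4 = 0 ∧ g i j 0 6 = 0 ∧ g i j 1 1 = 0 ∧ g i j 1 3 = 0 ∧ g i j 1 5 = 0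
      ∧ g i j 2 0 = 0 ∧ g i j 2 2 = 0 ∧ g i j 2 4 = 0 ∧ g i j 3 1 = 0 ∧ g i j 3 3 = 0 ∧ g i j 4 0 = 0 ∧ g i j 4 2 = 0
      ∧ g i j 5 1 = 0 ∧ g i j 6 0 = 0 := by
    intro i j
    refine ⟨?_, ?_, ?_, ?_, ?_, ?_, ?_, ?_, ?_, ?_, ?_, ?_, ?_, ?_, ?_, ?_⟩ <;> exact hg _ _ _ _ (by decide)
  simp only [Sum6, hin]
  simp [Finset.sum_range_succ, hg0]
  ring

set_option maxHeartbeats 4000000 in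
set_option maxRecDepth 20000 in
theorem extractLem (h1 h1x h1y h2 h2x h2y fx fy tx : ℝ) (f fX fY : ℕ → ℕ → ℕ → ℕ → ℝ)
    (hf : ∀ i j k m, ¬ Odd (k + m) → f i j k m = 0)
    (hfX : ∀ i j k m, ¬ Odd (k + m) → fX i j k m = 0)
    (hfY : ∀ i j k m, ¬ Odd (k + m) → fY i j k m = 0)
    (H : ∀ p q r : ℝ, (h1x*p^2 + h2x + fx*q^2 + tx*r^2) * Sum6 (fun i j k m => f i j k m * (i * p^(i-1)) * q^k * r^m)
      - 2*h1*p * Sum6 (fun i j k m => fX i j k m * p^i * q^k * r^m)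
      + (h1y*p^2 + h2y + fy*q^2) * Sum6 (fun i j k m => f i j k m * p^i * j * q^k * r^m)
      - 2*h2 * Sum6 (fun i j k m => fY i j k m * p^i * q^k * r^m) = 0) :
    EqsP h1 h1x h1y h2 h2x h2y fx fy tx
      (fun i => f i (5 - i) 1 0) (fun i => fX i (5 - i) 1 0) (fun i => fY i (5 - i) 1 0) (fun i => f i (3 - i) 3 0) (fun i => fX i (3 - i) 3 0) (fun i => fY i (3 - i) 3 0) (fun i => f i (3 - i) 1 2) (fun i => fX i (3 - i) 1 2) (fun i => fY i (3 - i) 1 2) (fun i => f i (1 - i) 5 0) (fun i => fX i (1 - i) 5 0) (fun i => fY i (1 - i) 5 0) (fun i => f i (1 - i) 3 2) (fun i => fX i (1 - i) 3 2) (fun i => fY i (1 - i) 3 2) (fun i => f i (1 - i) 1 4) (fun i => fX i (1 - i) 1 4) (fun i => fY i (1 - i) 1 4) ∧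
    EqsP h1 h1x h1y h2 h2x h2y fx fy tx
      (fun i => f i (5 - i) 0 1) (fun i => fX i (5 - i) 0 1) (fun i => fY i (5 - i) 0 1) (fun i => f i (3 - i) 2 1) (fun i => fX i (3 - i) 2 1) (fun i => fY i (3 - i) 2 1) (fun i => f i (3 - i) 0 3) (fun i => fX i (3 - i) 0 3) (fun i => fY i (3 - i) 0 3) (fun i => f i (1 - i) 4 1) (fun i => fX i (1 - i) 4 1) (fun i => fY i (1 - i) 4 1) (fun i => f i (1 - i) 2 3) (fun i => fX i (1 - i) 2 3) (fun i => fY i (1 - i) 2 3) (fun i => f i (1 - i) 0 5) (fun i => fX i (1 - i) 0 5) (fun i => fY i (1 - i) 0 5) := by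
  have key : ∀ p q r : ℝ, ((0) + ((h2x*f 1 4 1 0 + 5*h2y*f 0 5 1 0 - 2*h2*fY 0 5 1 0) + (2*h2x*f 2 3 1 0 + 4*h2y*f 1 4 1 0 - 2*h1*fX 0 5 1 0 - 2*h2*fY 1 4 1 0)*p + (h1x*f 1 4 1 0 + 3*h2x*f 3 2 1 0 + 5*h1y*f 0 5 1 0 + 3*h2y*f 2 3 1 0 - 2*h1*fX 1 4 1 0 - 2*h2*fY 2 3 1 0)*p^2 + (2*h1x*f 2 3 1 0 + 4*h2x*f 4 1 1 0 + 4*h1y*f 1 4 1 0 + 2*h2y*f 3 2 1 0 - 2*h1*fX 2 3 1 0 - 2*h2*fY 3 2 1 0)*p^3 + (3*h1x*f 3 2 1 0 + 5*h2x*f 5 0 1 0 + 3*h1y*f 2 3 1 0 + h2y*f 4 1 1 0 - 2*h1*fX 3 2 1 0 - 2*h2*fY 4 1 1 0)*p^4 + (4*h1x*f 4 1 1 0 + 2*h1y*f 3 2 1 0 - 2*h1*fX 4 1 1 0 - 2*h2*fY 5 0 1 0)*p^5 + (5*h1x*f 5 0 1 0 + h1y*f 4 1 1 0 - 2*h1*fX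 5 0 1 0)*p^6 + (0)*p^7)*q + (0)*q^2 + ((h2x*f 1 2 3 0 + 3*h2y*f 0 3 3 0 - 2*h2*fY 0 3 3 0 + fx*f 1 4 1 0 + 5*fy*f 0 5 1 0) + (2*h2x*f 2 1 3 0 + 2*h2y*f 1 2 3 0 - 2*h1*fX 0 3 3 0 - 2*h2*fY 1 2 3 0 + 2*fx*f 2 3 1 0 + 4*fy*f 1 4 1 0)*p + (h1x*f 1 2 3 0 + 3*h2x*f 3 0 3 0 + 3*h1y*f 0 3 3 0 + h2y*f 2 1 3 0 - 2*h1*fX 1 2 3 0 - 2*h2*fY 2 1 3 0 + 3*fx*f 3 2 1 0 + 3*fy*f 2 3 1 0)*p^2 + (2*h1x*f 2 1 3 0 + 2*h1y*f 1 2 3 0 - 2*h1*fX 2 1 3 0 - 2*h2*fY 3 0 3 0 + 4*fx*f 4 1 1 0 + 2*fy*f 3 2 1 0)*p^3 + (3*h1x*f 3 0 3 0 + h1y*f 2 1 3 0 - 2*h1*fX 3 0 3 0 + 5*fx*f 5 0 1 0 + fy*f 4 1 1 0)*p^4 + (0)*p^5 + (0)*p^6 + (0)*p^7)*q^3 + (0)*q^4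 + ((h2x*f 1 0 5 0 + h2y*f 0 1 5 0 - 2*h2*fY 0 1 5 0 + fx*f 1 2 3 0 + 3*fy*f 0 3 3 0) + (-2*h1*fX 0 1 5 0 - 2*h2*fY 1 0 5 0 + 2*fx*f 2 1 3 0 + 2*fy*f 1 2 3 0)*p + (h1x*f 1 0 5 0 + h1y*f 0 1 5 0 - 2*h1*fX 1 0 5 0 + 3*fx*f 3 0 3 0 + fy*f 2 1 3 0)*p^2 + (0)*p^3 + (0)*p^4 + (0)*p^5 + (0)*p^6 + (0)*p^7)*q^5 + (0)*q^6 + ((fx*f 1 0 5 0 + fy*f 0 1 5 0) + (0)*p + (0)*p^2 + (0)*p^3 + (0)*p^4 + (0)*p^5 + (0)*p^6 + (0)*p^7)*q^7) + (((h2x*f 1 4 0 1 + 5*h2y*f 0 5 0 1 - 2*h2*fY 0 5 0 1) + (2*h2x*f 2 3 0 1 + 4*h2y*f 1 4 0 1 - 2*h1*fX 0 5 0 1 - 2*h2*fY 1 4 0 1)*p + (h1x*f 1 4 0 1 + 3*h2x*f 3 2 0 1 + 5*h1y*f 0 5 0 1 + 3*h2y*f 2 3 0 1 - 2*h1*fX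 1 4 0 1 - 2*h2*fY 2 3 0 1)*p^2 + (2*h1x*f 2 3 0 1 + 4*h2x*f 4 1 0 1 + 4*h1y*f 1 4 0 1 + 2*h2y*f 3 2 0 1 - 2*h1*fX 2 3 0 1 - 2*h2*fY 3 2 0 1)*p^3 + (3*h1x*f 3 2 0 1 + 5*h2x*f 5 0 0 1 + 3*h1y*f 2 3 0 1 + h2y*f 4 1 0 1 - 2*h1*fX 3 2 0 1 - 2*h2*fY 4 1 0 1)*p^4 + (4*h1x*f 4 1 0 1 + 2*h1y*f 3 2 0 1 - 2*h1*fX 4 1 0 1 - 2*h2*fY 5 0 0 1)*p^5 + (5*h1x*f 5 0 0 1 + h1y*f 4 1 0 1 - 2*h1*fX 5 0 0 1)*p^6 + (0)*p^7) + (0)*q + ((h2x*f 1 2 2 1 + 3*h2y*f 0 3 2 1 - 2*h2*fY 0 3 2 1 + fx*f 1 4 0 1 + 5*fy*f 0 5 0 1) + (2*h2x*f 2 1 2 1 + 2*h2y*f 1 2 2 1 - 2*h1*fX 0 3 2 1 - 2*h2*fY 1 2 2 1 + 2*fx*f 2 3 0 1 + 4*fy*f 1 4 0 1)*p + (h1x*f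 1 2 2 1 + 3*h2x*f 3 0 2 1 + 3*h1y*f 0 3 2 1 + h2y*f 2 1 2 1 - 2*h1*fX 1 2 2 1 - 2*h2*fY 2 1 2 1 + 3*fx*f 3 2 0 1 + 3*fy*f 2 3 0 1)*p^2 + (2*h1x*f 2 1 2 1 + 2*h1y*f 1 2 2 1 - 2*h1*fX 2 1 2 1 - 2*h2*fY 3 0 2 1 + 4*fx*f 4 1 0 1 + 2*fy*f 3 2 0 1)*p^3 + (3*h1x*f 3 0 2 1 + h1y*f 2 1 2 1 - 2*h1*fX 3 0 2 1 + 5*fx*f 5 0 0 1 + fy*f 4 1 0 1)*p^4 + (0)*p^5 + (0)*p^6 + (0)*p^7)*q^2 + (0)*q^3 + ((h2x*f 1 0 4 1 + h2y*f 0 1 4 1 - 2*h2*fY 0 1 4 1 + fx*f 1 2 2 1 + 3*fy*f 0 3 2 1) + (-2*h1*fX 0 1 4 1 - 2*h2*fY 1 0 4 1 + 2*fx*f 2 1 2 1 + 2*fy*f 1 2 2 1)*p + (h1x*f 1 0 4 1 + h1y*f 0 1 4 1 - 2*h1*fX 1 0 4 1 + 3*fx*f 3 0 2 1 + fy*f 2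 1 2 1)*p^2 + (0)*p^3 + (0)*p^4 + (0)*p^5 + (0)*p^6 + (0)*p^7)*q^4 + (0)*q^5 + ((fx*f 1 0 4 1 + fy*f 0 1 4 1) + (0)*p + (0)*p^2 + (0)*p^3 + (0)*p^4 + (0)*p^5 + (0)*p^6 + (0)*p^7)*q^6 + (0)*q^7)*r + ((0) + ((h2x*f 1 2 1 2 + 3*h2y*f 0 3 1 2 - 2*h2*fY 0 3 1 2 + tx*f 1 4 1 0) + (2*h2x*f 2 1 1 2 + 2*h2y*f 1 2 1 2 - 2*h1*fX 0 3 1 2 - 2*h2*fY 1 2 1 2 + 2*tx*f 2 3 1 0)*p + (h1x*f 1 2 1 2 + 3*h2x*f 3 0 1 2 + 3*h1y*f 0 3 1 2 + h2y*f 2 1 1 2 - 2*h1*fX 1 2 1 2 - 2*h2*fY 2 1 1 2 + 3*tx*f 3 2 1 0)*p^2 + (2*h1x*f 2 1 1 2 + 2*h1y*f 1 2 1 2 - 2*h1*fX 2 1 1 2 - 2*h2*fY 3 0 1 2 + 4*tx*f 4 1 1 0)*p^3 + (3*h1x*f 3 0 1 2 + h1y*f 2 1 1 2 - 2*h1*fX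 3 0 1 2 + 5*tx*f 5 0 1 0)*p^4 + (0)*p^5 + (0)*p^6 + (0)*p^7)*q + (0)*q^2 + ((h2x*f 1 0 3 2 + h2y*f 0 1 3 2 - 2*h2*fY 0 1 3 2 + fx*f 1 2 1 2 + 3*fy*f 0 3 1 2 + tx*f 1 2 3 0) + (-2*h1*fX 0 1 3 2 - 2*h2*fY 1 0 3 2 + 2*fx*f 2 1 1 2 + 2*fy*f 1 2 1 2 + 2*tx*f 2 1 3 0)*p + (h1x*f 1 0 3 2 + h1y*f 0 1 3 2 - 2*h1*fX 1 0 3 2 + 3*fx*f 3 0 1 2 + fy*f 2 1 1 2 + 3*tx*f 3 0 3 0)*p^2 + (0)*p^3 + (0)*p^4 + (0)*p^5 + (0)*p^6 + (0)*p^7)*q^3 + (0)*q^4 + ((fx*f 1 0 3 2 + fy*f 0 1 3 2 + tx*f 1 0 5 0) + (0)*p + (0)*p^2 + (0)*p^3 + (0)*p^4 + (0)*p^5 + (0)*p^6 + (0)*p^7)*q^5 + (0)*q^6 + (0)*q^7)*r^2 + (((h2x*f 1 2 0 3 + 3*h2y*f 0 3 0 3 - 2*h2*fY 0 3 0 3 +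 tx*f 1 4 0 1) + (2*h2x*f 2 1 0 3 + 2*h2y*f 1 2 0 3 - 2*h1*fX 0 3 0 3 - 2*h2*fY 1 2 0 3 + 2*tx*f 2 3 0 1)*p + (h1x*f 1 2 0 3 + 3*h2x*f 3 0 0 3 + 3*h1y*f 0 3 0 3 + h2y*f 2 1 0 3 - 2*h1*fX 1 2 0 3 - 2*h2*fY 2 1 0 3 + 3*tx*f 3 2 0 1)*p^2 + (2*h1x*f 2 1 0 3 + 2*h1y*f 1 2 0 3 - 2*h1*fX 2 1 0 3 - 2*h2*fY 3 0 0 3 + 4*tx*f 4 1 0 1)*p^3 + (3*h1x*f 3 0 0 3 + h1y*f 2 1 0 3 - 2*h1*fX 3 0 0 3 + 5*tx*f 5 0 0 1)*p^4 + (0)*p^5 + (0)*p^6 + (0)*p^7) + (0)*q + ((h2x*f 1 0 2 3 + h2y*f 0 1 2 3 - 2*h2*fY 0 1 2 3 + fx*f 1 2 0 3 + 3*fy*f 0 3 0 3 + tx*f 1 2 2 1) + (-2*h1*fX 0 1 2 3 - 2*h2*fY 1 0 2 3 + 2*fx*f 2 1 0 3 + 2*fy*f 1 2 0 3 + 2*tx*f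 2 1 2 1)*p + (h1x*f 1 0 2 3 + h1y*f 0 1 2 3 - 2*h1*fX 1 0 2 3 + 3*fx*f 3 0 0 3 + fy*f 2 1 0 3 + 3*tx*f 3 0 2 1)*p^2 + (0)*p^3 + (0)*p^4 + (0)*p^5 + (0)*p^6 + (0)*p^7)*q^2 + (0)*q^3 + ((fx*f 1 0 2 3 + fy*f 0 1 2 3 + tx*f 1 0 4 1) + (0)*p + (0)*p^2 + (0)*p^3 + (0)*p^4 + (0)*p^5 + (0)*p^6 + (0)*p^7)*q^4 + (0)*q^5 + (0)*q^6 + (0)*q^7)*r^3 + ((0) + ((h2x*f 1 0 1 4 + h2y*f 0 1 1 4 - 2*h2*fY 0 1 1 4 + tx*f 1 2 1 2) + (-2*h1*fX 0 1 1 4 - 2*h2*fY 1 0 1 4 + 2*tx*f 2 1 1 2)*p + (h1x*f 1 0 1 4 + h1y*f 0 1 1 4 - 2*h1*fX 1 0 1 4 + 3*tx*f 3 0 1 2)*p^2 + (0)*p^3 + (0)*p^4 + (0)*p^5 + (0)*p^6 + (0)*p^7)*q + (0)*q^2 + ((fx*f 1 0 1 4 + fy*f 0 1 1 4 + tx*f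 1 0 3 2) + (0)*p + (0)*p^2 + (0)*p^3 + (0)*p^4 + (0)*p^5 + (0)*p^6 + (0)*p^7)*q^3 + (0)*q^4 + (0)*q^5 + (0)*q^6 + (0)*q^7)*r^4 + (((h2x*f 1 0 0 5 + h2y*f 0 1 0 5 - 2*h2*fY 0 1 0 5 + tx*f 1 2 0 3) + (-2*h1*fX 0 1 0 5 - 2*h2*fY 1 0 0 5 + 2*tx*f 2 1 0 3)*p + (h1x*f 1 0 0 5 + h1y*f 0 1 0 5 - 2*h1*fX 1 0 0 5 + 3*tx*f 3 0 0 3)*p^2 + (0)*p^3 + (0)*p^4 + (0)*p^5 + (0)*p^6 + (0)*p^7) + (0)*q + ((fx*f 1 0 0 5 + fy*f 0 1 0 5 + tx*f 1 0 2 3) + (0)*p + (0)*p^2 + (0)*p^3 + (0)*p^4 + (0)*p^5 + (0)*p^6 + (0)*p^7)*q^2 + (0)*q^3 + (0)*q^4 + (0)*q^5 + (0)*q^6 + (0)*q^7)*r^5 + ((0) + ((tx*f 1 0 1 4) + (0)*p + (0)*p^2 + (0)*p^3 + (0)*p^4 + (0)*p^5 + (0)*p^6 + (0)*p^7)*q +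 (0)*q^2 + (0)*q^3 + (0)*q^4 + (0)*q^5 + (0)*q^6 + (0)*q^7)*r^6 + (((tx*f 1 0 0 5) + (0)*p + (0)*p^2 + (0)*p^3 + (0)*p^4 + (0)*p^5 + (0)*p^6 + (0)*p^7) + (0)*q + (0)*q^2 + (0)*q^3 + (0)*q^4 + (0)*q^5 + (0)*q^6 + (0)*q^7)*r^7 = 0 := by
    intro p q r
    have h := H p q r
    rw [Sum6_eq _ (by intro i j k m hk; simp [hf i j k m hk]), Sum6_eq _ (by intro i j k m hk; simp [hfX i j k m hk]),
      Sum6_eq _ (by intro i j k m hk; simp [hf i j k m hk]), Sum6_eq _ (by intro i j k m hk; simp [hfY i j k m hk])] at h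
    norm_num only at h
    linear_combination h
  have v10 := vanish8 _ _ _ _ _ _ _ _ (fun p => (vanish8 _ _ _ _ _ _ _ _ (fun q => (vanish8 _ _ _ _ _ _ _ _ (key p q)).1)).2.1)
  have v30 := vanish8 _ _ _ _ _ _ _ _ (fun p => (vanish8 _ _ _ _ _ _ _ _ (fun q => (vanish8 _ _ _ _ _ _ _ _ (key p q)).1)).2.2.2.1)
  have v50 := vanish8 _ _ _ _ _ _ _ _ (fun p => (vanish8 _ _ _ _ _ _ _ _ (fun q => (vanish8 _ _ _ _ _ _ _ _ (key p q)).1)).2.2.2.2.2.1)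
  have v70 := vanish8 _ _ _ _ _ _ _ _ (fun p => (vanish8 _ _ _ _ _ _ _ _ (fun q => (vanish8 _ _ _ _ _ _ _ _ (key p q)).1)).2.2.2.2.2.2.2)
  have v01 := vanish8 _ _ _ _ _ _ _ _ (fun p => (vanish8 _ _ _ _ _ _ _ _ (fun q => (vanish8 _ _ _ _ _ _ _ _ (key p q)).2.1)).1)
  have v21 := vanish8 _ _ _ _ _ _ _ _ (fun p => (vanish8 _ _ _ _ _ _ _ _ (fun q => (vanish8 _ _ _ _ _ _ _ _ (key p q)).2.1)).2.2.1)
  have v41 := vanish8 _ _ _ _ _ _ _ _ (fun p => (vanish8 _ _ _ _ _ _ _ _ (fun q => (vanish8 _ _ _ _ _ _ _ _ (key p q)).2.1)).2.2.2.2.1)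
  have v61 := vanish8 _ _ _ _ _ _ _ _ (fun p => (vanish8 _ _ _ _ _ _ _ _ (fun q => (vanish8 _ _ _ _ _ _ _ _ (key p q)).2.1)).2.2.2.2.2.2.1)
  have v12 := vanish8 _ _ _ _ _ _ _ _ (fun p => (vanish8 _ _ _ _ _ _ _ _ (fun q => (vanish8 _ _ _ _ _ _ _ _ (key p q)).2.2.1)).2.1)
  have v32 := vanish8 _ _ _ _ _ _ _ _ (fun p => (vanish8 _ _ _ _ _ _ _ _ (fun q => (vanish8 _ _ _ _ _ _ _ _ (key p q)).2.2.1)).2.2.2.1)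
  have v52 := vanish8 _ _ _ _ _ _ _ _ (fun p => (vanish8 _ _ _ _ _ _ _ _ (fun q => (vanish8 _ _ _ _ _ _ _ _ (key p q)).2.2.1)).2.2.2.2.2.1)
  have v03 := vanish8 _ _ _ _ _ _ _ _ (fun p => (vanish8 _ _ _ _ _ _ _ _ (fun q => (vanish8 _ _ _ _ _ _ _ _ (key p q)).2.2.2.1)).1)
  have v23 := vanish8 _ _ _ _ _ _ _ _ (fun p => (vanish8 _ _ _ _ _ _ _ _ (fun q => (vanish8 _ _ _ _ _ _ _ _ (key p q)).2.2.2.1)).2.2.1)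
  have v43 := vanish8 _ _ _ _ _ _ _ _ (fun p => (vanish8 _ _ _ _ _ _ _ _ (fun q => (vanish8 _ _ _ _ _ _ _ _ (key p q)).2.2.2.1)).2.2.2.2.1)
  have v14 := vanish8 _ _ _ _ _ _ _ _ (fun p => (vanish8 _ _ _ _ _ _ _ _ (fun q => (vanish8 _ _ _ _ _ _ _ _ (key p q)).2.2.2.2.1)).2.1)
  have v34 := vanish8 _ _ _ _ _ _ _ _ (fun p => (vanish8 _ _ _ _ _ _ _ _ (fun q => (vanish8 _ _ _ _ _ _ _ _ (key p q)).2.2.2.2.1)).2.2.2.1)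
  have v05 := vanish8 _ _ _ _ _ _ _ _ (fun p => (vanish8 _ _ _ _ _ _ _ _ (fun q => (vanish8 _ _ _ _ _ _ _ _ (key p q)).2.2.2.2.2.1)).1)
  have v25 := vanish8 _ _ _ _ _ _ _ _ (fun p => (vanish8 _ _ _ _ _ _ _ _ (fun q => (vanish8 _ _ _ _ _ _ _ _ (key p q)).2.2.2.2.2.1)).2.2.1)
  have v16 := vanish8 _ _ _ _ _ _ _ _ (fun p => (vanish8 _ _ _ _ _ _ _ _ (fun q => (vanish8 _ _ _ _ _ _ _ _ (key p q)).2.2.2.2.2.2.1)).2.1)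
  have v07 := vanish8 _ _ _ _ _ _ _ _ (fun p => (vanish8 _ _ _ _ _ _ _ _ (fun q => (vanish8 _ _ _ _ _ _ _ _ (key p q)).2.2.2.2.2.2.2)).1)
  constructor
  · constructor
    · exact v16.1
    · exact v70.1
    · exact v52.1
    · exact v34.1
    · exact v14.2.2.1
    · exact v14.2.1
    · exact v14.1
    · exact v32.2.2.1
    · exact v32.2.1
    · exact v50.2.1
    · exact v32.1
    · exact v50.1
    · exact v50.2.2.1
    · exact v12.1
    · exact v12.2.1
    · exact v12.2.2.1
    · exact v12.2.2.2.1
    · exact v12.2.2.2.2.1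
    · exact v30.1
    · exact v30.2.1
    · exact v30.2.2.2.1
    · exact v30.2.2.2.2.1
    · exact v10.1
    · exact v10.2.2.2.2.2.2.1
  · constructor
    · exact v07.1
    · exact v61.1
    · exact v43.1
    · exact v25.1
    · exact v05.2.2.1
    · exact v05.2.1
    · exact v05.1
    · exact v23.2.2.1
    · exact v23.2.1
    · exact v41.2.1
    · exact v23.1
    · exact v41.1
    · exact v41.2.2.1
    · exact v03.1
    · exact v03.2.1
    · exact v03.2.2.1
    · exact v03.2.2.2.1
    · exact v03.2.2.2.2.1
    · exact v21.1
    · exact v21.2.1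
    · exact v21.2.2.2.1
    · exact v21.2.2.2.2.1
    · exact v01.1
    · exact v01.2.2.2.2.2.2.1


theorem DeltaP_analyticAt {f g : ℝ × ℝ → ℝ} {v : ℝ × ℝ} (hf : AnalyticAt ℝ f v) (hg : AnalyticAt ℝ g v) :
    AnalyticAt ℝ (fun v => g v * DeltaP (f v) (g v)) v := by
  simp only [DeltaP, m11, m12, m13, m21, m22, m23, m31, m32, m33]
  fun_prop

theorem DeltaP_analytic : AnalyticOnNhd ℝ (fun v : ℝ × ℝ => v.2 * DeltaP v.1 v.2) Set.univ :=
  fun _ _ => DeltaP_analyticAt analyticAt_fst analyticAt_snd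

theorem DeltaP_dense (O : Set (ℝ × ℝ)) (hO : IsOpen O) (hne : O.Nonempty) :
    ∃ v ∈ O, v.2 * DeltaP v.1 v.2 ≠ 0 := by
  by_contra hcon
  push Not at hcon
  obtain ⟨w, hw⟩ := hne
  have h0 : AnalyticOnNhd ℝ (fun _ : ℝ × ℝ => (0 : ℝ)) Set.univ := fun v _ => analyticAt_const
  have hev : (fun v : ℝ × ℝ => v.2 * DeltaP v.1 v.2) =ᶠ[nhds w] fun _ => 0 := by
    filter_upwards [hO.mem_nhds hw] with u hu using hcon u hu
  have h := congrFun (DeltaP_analytic.eq_of_eventuallyEq h0 hev) (2, 1 / 2)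
  simp only [DeltaP, m11, m12, m13, m21, m22, m23, m31, m32, m33] at h
  norm_num at h

theorem pd_eq {f : PhasePt → ℝ} {z : PhasePt} {i : Fin 8} {γ : ℝ → PhasePt} {d : ℝ}
    (hf : DifferentiableAt ℝ f z) (hγ : ∀ s, Function.update z i s = γ s)
    (h : HasDerivAt (fun s => f (γ s)) d (z i)) : pd i f z = d := by
  have h1 : HasDerivAt (fun s => f (Function.update z i s)) (pd i f z) (z i) := by
    have h2 : HasFDerivAt f (fderiv ℝ f z) (Function.update z i (z i)) := by
      rw [Function.update_eq_self]
      exact hf.hasFDerivAt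
    exact h2.comp_hasDerivAt (z i) (hasDerivAt_update z i (z i))
  simp only [hγ] at h1
  exact h1.unique h

theorem upd0 (x y a b p w q r s : ℝ) : Function.update (![x, y, a, b, p, w, q, r] : PhasePt) 0 s = ![s, y, a, b, p, w, q, r] := by
  funext i; fin_cases i <;> rfl
theorem upd1 (x y a b p w q r s : ℝ) : Function.update (![x, y, a, b, p, w, q, r] : PhasePt) 1 s = ![x, s, a, b, p, w, q, r] := by
  funext i; fin_cases i <;> rfl
theorem upd2 (x y a b p w q r s : ℝ) : Function.update (![x, y, a, b, p, w, q, r] : PhasePt) 2 s = ![x, y, s, b, p, w, q, r] := by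
  funext i; fin_cases i <;> rfl
theorem upd3 (x y a b p w q r s : ℝ) : Function.update (![x, y, a, b, p, w, q, r] : PhasePt) 3 s = ![x, y, a, s, p, w, q, r] := by
  funext i; fin_cases i <;> rfl
theorem upd4 (x y a b p w q r s : ℝ) : Function.update (![x, y, a, b, p, w, q, r] : PhasePt) 4 s = ![x, y, a, b, s, w, q, r] := by
  funext i; fin_cases i <;> rfl
theorem upd5 (x y a b p w q r s : ℝ) : Function.update (![x, y, a, b, p, w, q, r] : PhasePt) 5 s = ![x, y, a, b, p, s, q, r] := by
  funext i; fin_cases i <;> rfl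

def gf (x y : ℝ) : ℝ := 1/2*(x-1)/((x+1)^3*(1-y^2))
def gt (x : ℝ) : ℝ := -1/2*(x+1)^2/(x-1)^2

theorem Ham_eq (x y a b p w q r : ℝ) (hx : 1 < x) (hy1 : -1 < y) (hy2 : y < 1) :
    Ham ![x, y, a, b, p, w, q, r] = gh1 x y * p^2 + gh2 x y * w^2 + gf x y * q^2 + gt x * r^2 := by
  have e : Ham ![x, y, a, b, p, w, q, r] = (1/2) * ( ((x^2 - 1) * p^2 + (1 - y^2) * w^2)
      / (((x + 1)/(x - 1))^2 * ((x^2 - 1)^4 / (x^2 - y^2)^3))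
    + q^2 / (((x + 1)/(x - 1))^2 * ((x^2 - 1) * (1 - y^2)))
    - ((x + 1)/(x - 1))^2 * r^2 ) := rfl
  rw [e]
  have h1 : x - 1 ≠ 0 := by linarith
  have h2 : x + 1 ≠ 0 := by linarith
  have h3 : 1 - y^2 ≠ 0 := by nlinarith
  have h4 : x^2 - y^2 ≠ 0 := by nlinarith
  rw [show x^2 - 1 = (x-1)*(x+1) by ring]
  simp only [gh1, gh2, gf, gt]
  field_simp
  ring

theorem Ham_diff (z : PhasePt) (hz : z ∈ TStar) : DifferentiableAt ℝ Ham z := by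
  obtain ⟨hx, hy1, hy2⟩ := hz
  have h1 : z 0 - 1 ≠ 0 := by linarith
  have h2 : z 0 + 1 ≠ 0 := by linarith
  have h3 : 1 - (z 1)^2 ≠ 0 := by nlinarith
  have h4 : (z 0)^2 - (z 1)^2 ≠ 0 := by nlinarith
  have h5 : (z 0)^2 - 1 ≠ 0 := by nlinarith
  have h6 : ((z 0)^2 - (z 1)^2)^3 ≠ 0 := pow_ne_zero _ h4
  have h7 : (((z 0 + 1)/(z 0 - 1))^2) * (((z 0)^2 - 1)^4 / ((z 0)^2 - (z 1)^2)^3) ≠ 0 := by positivity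
  have h8 : (((z 0 + 1)/(z 0 - 1))^2) * (((z 0)^2 - 1) * (1 - (z 1)^2)) ≠ 0 := by positivity
  unfold Ham
  fun_prop (disch := assumption)

theorem gh1_dx (x y : ℝ) (h1 : x - 1 ≠ 0) (h2 : x + 1 ≠ 0) (h4 : x^2 - y^2 ≠ 0) :
    HasDerivAt (fun s => gh1 s y) (gh1x x y) x := by
  have hid := hasDerivAt_id' x
  have h := ((((hid.pow 2).sub_const (y^2)).pow 3).const_mul (1/2)).div
    ((hid.sub_const 1).mul ((hid.add_const 1).pow 5)) (mul_ne_zero h1 (pow_ne_zero 5 h2))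
  refine h.congr_deriv ?_
  simp only [gh1x, Pi.pow_apply, Pi.mul_apply, Pi.sub_apply]
  norm_num
  field_simp
  ring

theorem gh2_dx (x y : ℝ) (h1 : x - 1 ≠ 0) (h2 : x + 1 ≠ 0) (h4 : x^2 - y^2 ≠ 0) :
    HasDerivAt (fun s => gh2 s y) (gh2x x y) x := by
  have hid := hasDerivAt_id' x
  have h := ((((hid.pow 2).sub_const (y^2)).pow 3).const_mul (1/2*(1-y^2))).div
    (((hid.sub_const 1).pow 2).mul ((hid.add_const 1).pow 6)) (mul_ne_zero (pow_ne_zero 2 h1) (pow_ne_zero 6 h2))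
  refine h.congr_deriv ?_
  simp only [gh2x, Pi.pow_apply, Pi.mul_apply, Pi.sub_apply]
  norm_num
  field_simp
  ring

theorem gf_dx (x y : ℝ) (h1 : x - 1 ≠ 0) (h2 : x + 1 ≠ 0) (h3 : 1 - y^2 ≠ 0) :
    HasDerivAt (fun s => gf s y) (gfx x y) x := by
  have hid := hasDerivAt_id' x
  have h := ((hid.sub_const 1).const_mul (1/2)).div
    (((hid.add_const 1).pow 3).mul_const (1 - y^2)) (mul_ne_zero (pow_ne_zero 3 h2) h3)
  refine h.congr_deriv ?_
  simp only [gfx, Pi.pow_apply, Pi.mul_apply, Pi.sub_apply]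
  norm_num
  field_simp

theorem gt_dx (x y : ℝ) (h1 : x - 1 ≠ 0) (h2 : x + 1 ≠ 0) :
    HasDerivAt (fun s => gt s) (gtx x y) x := by
  have hid := hasDerivAt_id' x
  have h := (((hid.add_const 1).pow 2).const_mul (-1/2)).div
    ((hid.sub_const 1).pow 2) (pow_ne_zero 2 h1)
  refine h.congr_deriv ?_
  simp only [gtx, Pi.pow_apply, Pi.mul_apply, Pi.sub_apply]
  norm_num
  field_simp
  ring

theorem gh1_dy (x y : ℝ) (h1 : x - 1 ≠ 0) (h2 : x + 1 ≠ 0) (h4 : x^2 - y^2 ≠ 0) :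
    HasDerivAt (fun s => gh1 x s) (gh1y x y) y := by
  have hid := hasDerivAt_id' y
  have h := ((((hid.pow 2).const_sub (x^2)).pow 3).const_mul (1/2)).div_const ((x-1)*(x+1)^5)
  refine h.congr_deriv ?_
  simp only [gh1y, Pi.pow_apply, Pi.mul_apply, Pi.sub_apply]
  norm_num
  field_simp
  ring

theorem gh2_dy (x y : ℝ) (h1 : x - 1 ≠ 0) (h2 : x + 1 ≠ 0) (h3 : 1 - y^2 ≠ 0) (h4 : x^2 - y^2 ≠ 0) :
    HasDerivAt (fun s => gh2 x s) (gh2y x y) y := by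
  have hid := hasDerivAt_id' y
  have h := ((((hid.pow 2).const_sub 1).const_mul (1/2)).mul (((hid.pow 2).const_sub (x^2)).pow 3)).div_const ((x-1)^2*(x+1)^6)
  refine h.congr_deriv ?_
  simp only [gh2y, Pi.pow_apply, Pi.mul_apply, Pi.sub_apply]
  norm_num
  field_simp
  ring

theorem gf_dy (x y : ℝ) (h1 : x - 1 ≠ 0) (h2 : x + 1 ≠ 0) (h3 : 1 - y^2 ≠ 0) :
    HasDerivAt (fun s => gf x s) (gfy x y) y := by
  have hid := hasDerivAt_id' y
  have h := (hasDerivAt_const y (1/2*(x-1))).div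
    (((hid.pow 2).const_sub 1).const_mul ((x+1)^3)) (mul_ne_zero (pow_ne_zero 3 h2) h3)
  refine h.congr_deriv ?_
  simp only [gfy, Pi.pow_apply, Pi.mul_apply, Pi.sub_apply]
  norm_num
  field_simp

theorem mkz_mem {x y : ℝ} (a b p w q r : ℝ) (hx : 1 < x) (hy1 : -1 < y) (hy2 : y < 1) :
    (![x, y, a, b, p, w, q, r] : PhasePt) ∈ TStar := ⟨hx, hy1, hy2⟩

theorem Ham_pds (x y a b p w q r : ℝ) (hx : 1 < x) (hy1 : -1 < y) (hy2 : y < 1) :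
    pd 0 Ham ![x, y, a, b, p, w, q, r] = gh1x x y * p^2 + gh2x x y * w^2 + gfx x y * q^2 + gtx x y * r^2 ∧
    pd 1 Ham ![x, y, a, b, p, w, q, r] = gh1y x y * p^2 + gh2y x y * w^2 + gfy x y * q^2 ∧
    pd 2 Ham ![x, y, a, b, p, w, q, r] = 0 ∧
    pd 3 Ham ![x, y, a, b, p, w, q, r] = 0 ∧
    pd 4 Ham ![x, y, a, b, p, w, q, r] = 2 * gh1 x y * p ∧
    pd 5 Ham ![x, y, a, b, p, w, q, r] = 2 * gh2 x y * w := by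
  have h1 : x - 1 ≠ 0 := by linarith
  have h2 : x + 1 ≠ 0 := by linarith
  have h3 : 1 - y^2 ≠ 0 := by nlinarith
  have h4 : x^2 - y^2 ≠ 0 := by nlinarith
  have hd := Ham_diff _ (mkz_mem a b p w q r hx hy1 hy2)
  refine ⟨pd_eq hd (upd0 x y a b p w q r) ?_, pd_eq hd (upd1 x y a b p w q r) ?_, pd_eq hd (upd2 x y a b p w q r) ?_,
    pd_eq hd (upd3 x y a b p w q r) ?_, pd_eq hd (upd4 x y a b p w q r) ?_, pd_eq hd (upd5 x y a b p w q r) ?_⟩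
  · change HasDerivAt _ _ x
    have h := ((((gh1_dx x y h1 h2 h4).mul_const (p^2)).add ((gh2_dx x y h1 h2 h4).mul_const (w^2))).add
      ((gf_dx x y h1 h2 h3).mul_const (q^2))).add ((gt_dx x y h1 h2).mul_const (r^2))
    refine h.congr_of_eventuallyEq ?_
    filter_upwards [lt_mem_nhds hx] with s hs
    exact Ham_eq s y a b p w q r hs hy1 hy2
  · change HasDerivAt _ _ y
    have h := ((((gh1_dy x y h1 h2 h4).mul_const (p^2)).add ((gh2_dy x y h1 h2 h3 h4).mul_const (w^2))).add
      ((gf_dy x y h1 h2 h3).mul_const (q^2))).add_const (gt x * r^2)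
    refine h.congr_of_eventuallyEq ?_
    filter_upwards [lt_mem_nhds hy1, gt_mem_nhds hy2] with s hs hs2
    exact Ham_eq x s a b p w q r hx hs hs2
  · change HasDerivAt _ _ a
    simp only [Ham_eq x y _ b p w q r hx hy1 hy2]
    exact hasDerivAt_const _ _
  · change HasDerivAt _ _ b
    simp only [Ham_eq x y a _ p w q r hx hy1 hy2]
    exact hasDerivAt_const _ _
  · change HasDerivAt _ _ p
    simp only [Ham_eq x y a b _ w q r hx hy1 hy2]
    have h := (((((hasDerivAt_id' p).pow 2).const_mul (gh1 x y)).add_const (gh2 x y * w^2)).add_const (gf x y * q^2)).add_const (gt x * r^2)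
    refine h.congr_deriv ?_
    norm_num
    ring
  · change HasDerivAt _ _ w
    simp only [Ham_eq x y a b p _ q r hx hy1 hy2]
    have h := (((((hasDerivAt_id' w).pow 2).const_mul (gh2 x y)).const_add (gh1 x y * p^2)).add_const (gf x y * q^2)).add_const (gt x * r^2)
    refine h.congr_deriv ?_
    norm_num
    ring


theorem Sum6_deriv {g : ℝ → ℕ → ℕ → ℕ → ℕ → ℝ} {g' : ℕ → ℕ → ℕ → ℕ → ℝ} {x : ℝ}
    (h : ∀ i j k m, HasDerivAt (fun s => g s i j k m) (g' i j k m) x) :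
    HasDerivAt (fun s => Sum6 (g s)) (Sum6 g') x := by
  unfold Sum6
  refine HasDerivAt.fun_sum fun i _ => HasDerivAt.fun_sum fun j _ => HasDerivAt.fun_sum fun k _ =>
    HasDerivAt.fun_sum fun m _ => ?_
  split_ifs
  · exact h i j k m
  · exact hasDerivAt_const _ _

theorem TStar_open : IsOpen TStar := by
  have h1 : IsOpen {z : PhasePt | 1 < z 0} := isOpen_lt continuous_const (continuous_apply 0)
  have h2 : IsOpen {z : PhasePt | -1 < z 1} := isOpen_lt continuous_const (continuous_apply 1)
  have h3 : IsOpen {z : PhasePt | z 1 < 1} := isOpen_lt (continuous_apply 1) continuous_const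
  exact h1.inter (h2.inter h3)

def Wset : Set (ℝ × ℝ) := {v | 1 < v.1 ∧ -1 < v.2 ∧ v.2 < 1}

theorem Wset_open : IsOpen Wset := by
  have h1 : IsOpen {z : ℝ × ℝ | 1 < z.1} := isOpen_lt continuous_const continuous_fst
  have h2 : IsOpen {z : ℝ × ℝ | -1 < z.2} := isOpen_lt continuous_const continuous_snd
  have h3 : IsOpen {z : ℝ × ℝ | z.2 < 1} := isOpen_lt continuous_snd continuous_const
  exact h1.inter (h2.inter h3)

/-- restriction of a coefficient to a slice of constant `φ` and `t` -/
def Fsl (c : ℕ → ℕ → ℕ → ℕ → ((Fin 4 → ℝ) → ℝ)) (a b : ℝ) (i j k m : ℕ) (v : ℝ × ℝ) : ℝ :=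
  c i j k m ![v.1, v.2, a, b]

theorem Fsl_smooth {c : ℕ → ℕ → ℕ → ℕ → ((Fin 4 → ℝ) → ℝ)}
    (hc : ∀ i j k m, ContDiffOn ℝ (⊤ : ℕ∞) (c i j k m) Ubase) (a b : ℝ) (i j k m : ℕ) :
    ContDiffOn ℝ (⊤ : ℕ∞) (Fsl c a b i j k m) Wset := by
  have hl : ContDiff ℝ (⊤ : ℕ∞) (fun v : ℝ × ℝ => (![v.1, v.2, a, b] : Fin 4 → ℝ)) := by
    rw [contDiff_pi]
    intro q
    fin_cases q
    · exact contDiff_fst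
    · exact contDiff_snd
    · exact contDiff_const
    · exact contDiff_const
  exact (hc i j k m).comp hl.contDiffOn (fun v hv => hv)

theorem basePt_mk (x y a b p w q r : ℝ) : basePt ![x, y, a, b, p, w, q, r] = ![x, y, a, b] := by
  funext i; fin_cases i <;> rfl

theorem pd_proj6 (i : Fin 8) (z : PhasePt) : pd i Pphi z = if i = 6 then 1 else 0 := by
  have : HasFDerivAt Pphi (ContinuousLinearMap.proj (R := ℝ) (φ := fun _ : Fin 8 => ℝ) 6) z :=
    (ContinuousLinearMap.proj (R := ℝ) (φ := fun _ : Fin 8 => ℝ) 6).hasFDerivAt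
  rw [pd, this.fderiv]
  simp [Pi.single_apply, eq_comm]

theorem pd_proj7 (i : Fin 8) (z : PhasePt) : pd i Ptm z = if i = 7 then 1 else 0 := by
  have : HasFDerivAt Ptm (ContinuousLinearMap.proj (R := ℝ) (φ := fun _ : Fin 8 => ℝ) 7) z :=
    (ContinuousLinearMap.proj (R := ℝ) (φ := fun _ : Fin 8 => ℝ) 7).hasFDerivAt
  rw [pd, this.fderiv]
  simp [Pi.single_apply, eq_comm]

theorem bracketEqs (I : PhasePt → ℝ)
    (hsm : ContDiffOn ℝ (⊤ : ℕ∞) I TStar)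
    (c : ℕ → ℕ → ℕ → ℕ → ((Fin 4 → ℝ) → ℝ))
    (hc : ∀ i j k m, ContDiffOn ℝ (⊤ : ℕ∞) (c i j k m) Ubase)
    (hI : ∀ z ∈ TStar, I z = Sum6 (fun i j k m => c i j k m (basePt z) * (z 4)^i * (z 5)^j * (z 6)^k * (z 7)^m))
    (hH : ∀ z ∈ TStar, pois Ham I z = 0)
    (hphi : ∀ z ∈ TStar, pois Pphi I z = 0)
    (ht : ∀ z ∈ TStar, pois Ptm I z = 0) (a b : ℝ) (v : ℝ × ℝ) (hv : v ∈ Wset) (p q r : ℝ) :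
    (gh1x v.1 v.2*p^2 + gh2x v.1 v.2 + gfx v.1 v.2*q^2 + gtx v.1 v.2*r^2) *
        Sum6 (fun i j k m => Fsl c a b i j k m v * (i * p^(i-1)) * q^k * r^m)
      - 2*gh1 v.1 v.2*p * Sum6 (fun i j k m => fderiv ℝ (Fsl c a b i j k m) v (1, 0) * p^i * q^k * r^m)
      + (gh1y v.1 v.2*p^2 + gh2y v.1 v.2 + gfy v.1 v.2*q^2) *
        Sum6 (fun i j k m => Fsl c a b i j k m v * p^i * j * q^k * r^m)
      - 2*gh2 v.1 v.2 * Sum6 (fun i j k m => fderiv ℝ (Fsl c a b i j k m) v (0, 1) * p^i * q^k * r^m) = 0 := by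
  obtain ⟨x, y⟩ := v
  obtain ⟨hx, hy1, hy2⟩ := hv
  simp only at hx hy1 hy2
  have hI' : ∀ x y w p : ℝ, 1 < x → -1 < y → y < 1 → I ![x, y, a, b, p, w, q, r] =
      Sum6 (fun i j k m => Fsl c a b i j k m (x, y) * p^i * w^j * q^k * r^m) := by
    intro x y w p hx hy1 hy2
    rw [hI _ (mkz_mem a b p w q r hx hy1 hy2), basePt_mk]
    rfl
  have hz := mkz_mem a b p 1 q r hx hy1 hy2
  have hd : DifferentiableAt ℝ I ![x, y, a, b, p, 1, q, r] :=
    (hsm.contDiffAt (TStar_open.mem_nhds hz)).differentiableAt (by simp)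
  have hF : ∀ i j k m, HasFDerivAt (Fsl c a b i j k m) (fderiv ℝ (Fsl c a b i j k m) (x, y)) (x, y) := by
    intro i j k m
    have hw : ((x, y) : ℝ × ℝ) ∈ Wset := ⟨hx, hy1, hy2⟩
    exact (((Fsl_smooth hc a b i j k m).contDiffAt (Wset_open.mem_nhds hw)).differentiableAt (by simp)).hasFDerivAt
  have e0 : pd 0 I ![x, y, a, b, p, 1, q, r] =
      Sum6 (fun i j k m => fderiv ℝ (Fsl c a b i j k m) (x, y) (1, 0) * p^i * q^k * r^m) := by
    refine pd_eq hd (upd0 x y a b p 1 q r) ?_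
    change HasDerivAt _ _ x
    have h : HasDerivAt (fun s => Sum6 (fun i j k m => Fsl c a b i j k m (s, y) * p^i * q^k * r^m)) _ x :=
      Sum6_deriv (fun i j k m => ((((hF i j k m).comp_hasDerivAt x
        ((hasDerivAt_id' x).prodMk (hasDerivAt_const x y))).mul_const (p^i)).mul_const (q^k)).mul_const (r^m))
    refine h.congr_of_eventuallyEq ?_
    filter_upwards [lt_mem_nhds hx] with s hs
    rw [hI' s y 1 p hs hy1 hy2]
    simp
  have e1 : pd 1 I ![x, y, a, b, p, 1, q, r] =
      Sum6 (fun i j k m => fderiv ℝ (Fsl c a b i j k m) (x, y) (0, 1) * p^i * q^k * r^m) := by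
    refine pd_eq hd (upd1 x y a b p 1 q r) ?_
    change HasDerivAt _ _ y
    have h : HasDerivAt (fun s => Sum6 (fun i j k m => Fsl c a b i j k m (x, s) * p^i * q^k * r^m)) _ y :=
      Sum6_deriv (fun i j k m => ((((hF i j k m).comp_hasDerivAt y
        ((hasDerivAt_const y x).prodMk (hasDerivAt_id' y))).mul_const (p^i)).mul_const (q^k)).mul_const (r^m))
    refine h.congr_of_eventuallyEq ?_
    filter_upwards [lt_mem_nhds hy1, gt_mem_nhds hy2] with s hs hs2
    rw [hI' x s 1 p hx hs hs2]
    simp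
  have e4 : pd 4 I ![x, y, a, b, p, 1, q, r] =
      Sum6 (fun i j k m => Fsl c a b i j k m (x, y) * (i * p^(i-1)) * q^k * r^m) := by
    refine pd_eq hd (upd4 x y a b p 1 q r) ?_
    change HasDerivAt _ _ p
    have h : HasDerivAt (fun s => Sum6 (fun i j k m => Fsl c a b i j k m (x, y) * s^i * q^k * r^m)) _ p :=
      Sum6_deriv (fun i j k m => ((((hasDerivAt_pow i p).const_mul (Fsl c a b i j k m (x, y))).mul_const (q^k)).mul_const (r^m)))
    refine h.congr_of_eventuallyEq ?_
    filter_upwards with s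
    rw [hI' x y 1 s hx hy1 hy2]
    simp
  have e5 : pd 5 I ![x, y, a, b, p, 1, q, r] =
      Sum6 (fun i j k m => Fsl c a b i j k m (x, y) * p^i * j * q^k * r^m) := by
    refine pd_eq hd (upd5 x y a b p 1 q r) ?_
    change HasDerivAt _ _ (1 : ℝ)
    have h : HasDerivAt (fun s => Sum6 (fun i j k m => Fsl c a b i j k m (x, y) * p^i * s^j * q^k * r^m)) _ (1 : ℝ) :=
      Sum6_deriv (fun i j k m => ((((hasDerivAt_pow j (1 : ℝ)).const_mul (Fsl c a b i j k m (x, y) * p^i)).mul_const (q^k)).mul_const (r^m)))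
    simp only [one_pow, mul_one] at h
    refine h.congr_of_eventuallyEq ?_
    filter_upwards with s
    rw [hI' x y s p hx hy1 hy2]
  have e2 : pd 2 I ![x, y, a, b, p, 1, q, r] = 0 := by
    have h := hphi _ hz
    simp only [pois, pd_proj6] at h
    simp at h
    exact h
  have e3 : pd 3 I ![x, y, a, b, p, 1, q, r] = 0 := by
    have h := ht _ hz
    simp only [pois, pd_proj7] at h
    simp at h
    exact h
  obtain ⟨g0, g1, g2, g3, g4, g5⟩ := Ham_pds x y a b p 1 q r hx hy1 hy2
  have h := hH _ hz
  simp only [pois, g0, g1, g2, g3, g4, g5, e0, e1, e2, e3, e4, e5] at h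
  linear_combination h

def Vopen : TopologicalSpace.Opens (ℝ × ℝ) :=
  ⟨Wset ∩ {v | v.2 * DeltaP v.1 v.2 ≠ 0}, Wset_open.inter
    (isOpen_ne_fun (continuousOn_univ.mp DeltaP_analytic.continuousOn) continuous_const)⟩

theorem Vopen_good (v : Vopen) : Good v ∧ (v : ℝ × ℝ).1 ≠ 0 ∧ DeltaP (v : ℝ × ℝ).1 (v : ℝ × ℝ).2 ≠ 0 := by
  obtain ⟨⟨x, y⟩, ⟨hx, hy1, hy2⟩, hne⟩ := v
  simp only at hx hy1 hy2
  simp only [Set.mem_ofPred_eq] at hne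
  refine ⟨⟨?_, ?_, ?_, ?_, left_ne_zero_of_mul hne⟩, ?_, right_ne_zero_of_mul hne⟩ <;> simp only
  · linarith
  · linarith
  · nlinarith
  · nlinarith
  · linarith

theorem vanishV (I : PhasePt → ℝ)
    (hsm : ContDiffOn ℝ (⊤ : ℕ∞) I TStar)
    (c : ℕ → ℕ → ℕ → ℕ → ((Fin 4 → ℝ) → ℝ))
    (hc : ∀ i j k m, ContDiffOn ℝ (⊤ : ℕ∞) (c i j k m) Ubase)
    (hodd : ∀ i j k m, ¬ Odd (k + m) → c i j k m = 0)
    (hI : ∀ z ∈ TStar, I z = Sum6 (fun i j k m => c i j k m (basePt z) * (z 4)^i * (z 5)^j * (z 6)^k * (z 7)^m))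
    (hH : ∀ z ∈ TStar, pois Ham I z = 0)
    (hphi : ∀ z ∈ TStar, pois Pphi I z = 0)
    (ht : ∀ z ∈ TStar, pois Ptm I z = 0) (a b p w q r : ℝ) (v : ℝ × ℝ) (hv : v ∈ Vopen) :
    I ![v.1, v.2, a, b, p, w, q, r] = 0 := by
  have hsub : (Vopen : Set (ℝ × ℝ)) ⊆ Wset := fun u hu => hu.1
  have hs : ∀ i j k m, ContDiffOn ℝ (⊤ : ℕ∞) (Fsl c a b i j k m) Vopen :=
    fun i j k m => (Fsl_smooth hc a b i j k m).mono hsub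
  have hz : ∀ i j k m, ¬ Odd (k + m) → Fsl c a b i j k m = fun _ => 0 := by
    intro i j k m h
    funext u
    simp [Fsl, hodd i j k m h]
  have hE := fun u (hu : u ∈ Vopen) => extractLem _ _ _ _ _ _ _ _ _
    (fun i j k m => Fsl c a b i j k m u)
    (fun i j k m => fderiv ℝ (Fsl c a b i j k m) u (1, 0))
    (fun i j k m => fderiv ℝ (Fsl c a b i j k m) u (0, 1))
    (by intro i j k m h; simp [hz i j k m h]) (by intro i j k m h; simp [hz i j k m h])
    (by intro i j k m h; simp [hz i j k m h])
    (bracketEqs I hsm c hc hI hH hphi ht a b u (hsub hu))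
  have f1 := familyLem (fun v => (Vopen_good v).1) (fun v => (Vopen_good v).2.1) (fun v => (Vopen_good v).2.2)
    (fun i => Fsl c a b i (5 - i) 1 0) (fun i => Fsl c a b i (3 - i) 3 0) (fun i => Fsl c a b i (3 - i) 1 2)
    (fun i => Fsl c a b i (1 - i) 5 0) (fun i => Fsl c a b i (1 - i) 3 2) (fun i => Fsl c a b i (1 - i) 1 4)
    (fun i => hs _ _ _ _) (fun i => hs _ _ _ _) (fun i => hs _ _ _ _)
    (fun i => hs _ _ _ _) (fun i => hs _ _ _ _) (fun i => hs _ _ _ _)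
    (fun u hu => (hE u hu).1) v hv
  have f2 := familyLem (fun v => (Vopen_good v).1) (fun v => (Vopen_good v).2.1) (fun v => (Vopen_good v).2.2)
    (fun i => Fsl c a b i (5 - i) 0 1) (fun i => Fsl c a b i (3 - i) 2 1) (fun i => Fsl c a b i (3 - i) 0 3)
    (fun i => Fsl c a b i (1 - i) 4 1) (fun i => Fsl c a b i (1 - i) 2 3) (fun i => Fsl c a b i (1 - i) 0 5)
    (fun i => hs _ _ _ _) (fun i => hs _ _ _ _) (fun i => hs _ _ _ _)
    (fun i => hs _ _ _ _) (fun i => hs _ _ _ _) (fun i => hs _ _ _ _)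
    (fun u hu => (hE u hu).2) v hv
  rw [hI _ (mkz_mem a b p w q r hv.1.1 hv.1.2.1 hv.1.2.2), basePt_mk,
    Sum6_eq _ (by intro i j k m h; simp [hodd i j k m h])]
  norm_num only [Fsl] at f1 f2
  simp [f1, f2]

theorem finalThm (I : PhasePt → ℝ)
    (hsm : ContDiffOn ℝ (⊤ : ℕ∞) I TStar) (hpoly : IsHomPolyMomOdd 6 I)
    (hH : ∀ z ∈ TStar, pois Ham I z = 0)
    (hphi : ∀ z ∈ TStar, pois Pphi I z = 0)
    (ht : ∀ z ∈ TStar, pois Ptm I z = 0) :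
    ∀ z ∈ TStar, I z = 0 := by
  obtain ⟨c, hc, hodd, hI⟩ := hpoly
  have hV := vanishV I hsm c hc hodd hI hH hphi ht
  intro z hz
  by_contra hne
  have hrep : ∀ z : PhasePt, z = ![z 0, z 1, z 2, z 3, z 4, z 5, z 6, z 7] := by
    intro z
    funext i; fin_cases i <;> rfl
  have hl : Continuous (fun v : ℝ × ℝ => (![v.1, v.2, z 2, z 3, z 4, z 5, z 6, z 7] : PhasePt)) := by
    refine continuous_pi fun i => ?_
    fin_cases i
    · exact continuous_fst
    · exact continuous_snd
    all_goals exact continuous_const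
  have hcont : ContinuousOn (fun v : ℝ × ℝ => I ![v.1, v.2, z 2, z 3, z 4, z 5, z 6, z 7]) Wset :=
    hsm.continuousOn.comp hl.continuousOn (fun v hv => hv)
  have hopen := hcont.isOpen_inter_preimage Wset_open (isOpen_ne (x := (0 : ℝ)))
  obtain ⟨v, ⟨hvW, hv0⟩, hvD⟩ := DeltaP_dense _ hopen ⟨(z 0, z 1), hz, by
    simp only [Set.mem_preimage, Set.mem_ofPred_eq]
    rw [← hrep z]
    exact hne⟩
  exact hv0 (hV _ _ _ _ _ _ v ⟨hvW, hvD⟩)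

/-- every σ-odd homogeneous degree-6 integral commuting with `p_φ, p_t`
vanishes identically. -/
theorem odd_degree_six_integrals_vanish (I : PhasePt → ℝ)
    (hsm : ContDiffOn ℝ (⊤ : ℕ∞) I TStar) (hpoly : IsHomPolyMomOdd 6 I)
    (hH : ∀ z ∈ TStar, pois Ham I z = 0)
    (hphi : ∀ z ∈ TStar, pois Pphi I z = 0)
    (ht : ∀ z ∈ TStar, pois Ptm I z = 0) :
    ∀ z ∈ TStar, I z = 0 := by
  exact finalThm I hsm hpoly hH hphi ht

end
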